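/- Balls are the unique minimizers for small volume: let n ≥ 2, α ∈ (0, n−1), and r ∈ (0,1). There exists m₀ = m₀(n,α,r) > 0 such that for every m ∈ (0, m₀), every bounded convex set Ẽ ⊆ ℝⁿ with |Ẽ| = 1 that minimizes the rescaled energy Per_r(F) + m^{(n+1−α)/n} Φ_α(F) among bounded convex sets F with |F| = 1 is, up to a translation and a Lebesgue null set, equal to the ball B of volume 1 centered at the origin. -/

import Mathlib

open MeasureTheory Metric Set Filter Bornology
open scoped ENNReal NNReal Pointwise

noncomputable section

/-- The set of points of Lebesgue density one of `E ⊆ ℝⁿ`. -/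
def densityOnePoints (n : ℕ) (E : Set (EuclideanSpace ℝ (Fin n))) :
    Set (EuclideanSpace ℝ (Fin n)) :=
  {x | Tendsto (fun ρ : ℝ => volume (E ∩ ball x ρ) / volume (ball x ρ))
        (nhdsWithin 0 (Ioi 0)) (nhds 1)}

/-- Minkowski sum `A ⊕ B_r = ⋃_{x ∈ A} B_r(x)`. -/
def minkSum (n : ℕ) (r : ℝ) (A : Set (EuclideanSpace ℝ (Fin n))) :
    Set (EuclideanSpace ℝ (Fin n)) :=
  ⋃ x ∈ A, ball x r

/-- The nonlocal Minkowski perimeter `Per_r(E) = (1/(2r)) |(∂E) ⊕ B_r|`, where `∂E`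
is the topological boundary of the density-one representative of `E`. -/
def perR (n : ℕ) (r : ℝ) (E : Set (EuclideanSpace ℝ (Fin n))) : ℝ≥0∞ :=
  volume (minkSum n r (frontier (densityOnePoints n E))) / ENNReal.ofReal (2 * r)

/-- The inner set `E ⊖ B_r = E \ ((∂E) ⊕ B_r)` (for the density-one representative). -/
def minkSub (n : ℕ) (r : ℝ) (E : Set (EuclideanSpace ℝ (Fin n))) :
    Set (EuclideanSpace ℝ (Fin n)) :=
  densityOnePoints n E \ minkSum n r (frontier (densityOnePoints n E))

/-- The Riesz energy `Φ_α(E) = ∫_E ∫_E |x-y|^{-α} dx dy`. -/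
def rieszEnergy (n : ℕ) (α : ℝ) (E : Set (EuclideanSpace ℝ (Fin n))) : ℝ≥0∞ :=
  ∫⁻ x in E, ∫⁻ y in E, edist x y ^ (-α)

/-- The radius of the ball in `ℝⁿ` with unit volume. -/
def unitRadius (n : ℕ) : ℝ :=
  (volume (ball (0 : EuclideanSpace ℝ (Fin n)) 1)).toReal ^ (-(n : ℝ)⁻¹)

/-- A rigid motion of `ℝⁿ`: a rotation followed by a translation. -/
def IsRigidMotion (n : ℕ) (g : EuclideanSpace ℝ (Fin n) → EuclideanSpace ℝ (Fin n)) : Prop :=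
  ∃ (R : EuclideanSpace ℝ (Fin n) ≃ₗᵢ[ℝ] EuclideanSpace ℝ (Fin n))
    (v : EuclideanSpace ℝ (Fin n)),
    LinearMap.det (R.toLinearEquiv : EuclideanSpace ℝ (Fin n) →ₗ[ℝ] EuclideanSpace ℝ (Fin n)) = 1 ∧
    ∀ x, g x = R x + v

set_option linter.all false

namespace Mf
open InnerProductSpace Module

section slicing
variable {V : Type*} [NormedAddCommGroup V] [InnerProductSpace ℝ V] [FiniteDimensional ℝ V]
  [MeasurableSpace V] [BorelSpace V]

/-- The orthogonal complement of the line spanned by `u`. -/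
abbrev Ku (u : V) : Submodule ℝ V := (Submodule.span ℝ {u})ᗮ

lemma Ku_inner (u : V) (k : Ku u) : inner ℝ (k : V) u = 0 := by
  have := k.2
  rw [Submodule.mem_orthogonal_singleton_iff_inner_right] at this
  rw [real_inner_comm]; exact this

lemma slice_mp (u : V) (hu : ‖u‖ = 1) :
    MeasurePreserving (fun p : Ku u × ℝ => (p.1 : V) + p.2 • u)
      ((volume : Measure (Ku u)).prod (volume : Measure ℝ)) volume := by
  set s : Submodule ℝ V := Submodule.span ℝ {u}
  have h1 : MeasurePreserving (fun q : s × sᗮ => ((q.1 : V) + (q.2 : V))) volume volume := by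
    have e : MeasurePreserving (s.orthogonalDecomposition) volume volume :=
      s.orthogonalDecomposition.measurePreserving
    have e2 := (WithLp.volume_preserving_toLp (s) (sᗮ))
    have e3 : MeasurePreserving (s.orthogonalDecomposition.symm) volume volume :=
      s.orthogonalDecomposition.symm.measurePreserving
    have := e3.comp e2
    have hh : (fun q : s × sᗮ => ((q.1 : V) + (q.2 : V))) =
        s.orthogonalDecomposition.symm ∘ WithLp.toLp 2 := by
      funext q
      apply s.orthogonalDecomposition.injective
      simp
    rw [hh]; exact this
  have h2 : MeasurePreserving (LinearIsometryEquiv.toSpanUnitSingleton u hu) volume volume :=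
    (LinearIsometryEquiv.toSpanUnitSingleton u hu).measurePreserving
  have h3 := (h2.prod (MeasurePreserving.id (volume : Measure (sᗮ)))).comp
    (Measure.measurePreserving_swap (μ := (volume : Measure (Ku u))) (ν := (volume : Measure ℝ)))
  have h4 := h1.comp h3
  convert h4 using 1
  ext p
  simp [add_comm]

lemma slice_lintegral (u : V) (hu : ‖u‖ = 1) (F : V → ℝ≥0∞) (hF : Measurable F) :
    ∫⁻ x, F x = ∫⁻ k : Ku u, ∫⁻ t : ℝ, F ((k : V) + t • u) := by
  rw [← (slice_mp u hu).lintegral_comp hF, lintegral_prod]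
  exact (hF.comp (slice_mp u hu).measurable).aemeasurable

lemma slice_volume (u : V) (hu : ‖u‖ = 1) {S : Set V} (hS : MeasurableSet S) :
    volume S = ∫⁻ k : Ku u, volume {t : ℝ | (k : V) + t • u ∈ S} := by
  rw [← (slice_mp u hu).measure_preimage hS.nullMeasurableSet,
    Measure.prod_apply ((slice_mp u hu).measurable hS)]
  rfl

lemma slice_meas (u : V) (hu : ‖u‖ = 1) {S : Set V} (hS : MeasurableSet S) :
    Measurable (fun k : Ku u => volume {t : ℝ | (k : V) + t • u ∈ S}) :=
  measurable_measure_prodMk_left ((slice_mp u hu).measurable hS)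

/-- decomposition of points -/
lemma decomp (u : V) (hu : ‖u‖ = 1) (x : V) : ∃ (k : Ku u) (t : ℝ), x = (k : V) + t • u ∧ t = inner ℝ x u := by
  refine ⟨⟨x - (inner ℝ x u) • u, ?_⟩, inner ℝ x u, by simp, rfl⟩
  rw [Submodule.mem_orthogonal_singleton_iff_inner_right, inner_sub_right, inner_smul_right,
    real_inner_self_eq_norm_sq, hu, real_inner_comm]; simp

lemma decomp_inner (u : V) (hu : ‖u‖ = 1) (k : Ku u) (t : ℝ) : inner ℝ ((k : V) + t • u) u = t := by
  rw [inner_add_left, Ku_inner, inner_smul_left, real_inner_self_eq_norm_sq, hu]; simp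

lemma decomp_norm_sq (u : V) (hu : ‖u‖ = 1) (k : Ku u) (t : ℝ) :
    ‖(k : V) + t • u‖ ^ 2 = ‖k‖ ^ 2 + t ^ 2 := by
  rw [norm_add_sq_real, inner_smul_right, Ku_inner, norm_smul, hu]; simp

end slicing
end Mf

namespace Mf
open InnerProductSpace Module

section fibers
variable {V : Type*} [NormedAddCommGroup V] [InnerProductSpace ℝ V] [FiniteDimensional ℝ V]
  [MeasurableSpace V] [BorelSpace V]

/-- fiber of `A` over `k` in direction `u` -/
def fib (u : V) (A : Set V) (k : V) : Set ℝ := {t | k + t • u ∈ A}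
/-- top of fiber -/
def hi (u : V) (A : Set V) (k : V) : ℝ := sSup (fib u A k)
/-- bottom of fiber -/
def lo (u : V) (A : Set V) (k : V) : ℝ := - hi (-u) A k

lemma mem_fib {u : V} {A : Set V} {k : V} {t : ℝ} : t ∈ fib u A k ↔ k + t • u ∈ A := Iff.rfl

lemma mem_fib_neg {u : V} {A : Set V} {k : V} {t : ℝ} : t ∈ fib (-u) A k ↔ -t ∈ fib u A k := by
  simp [fib]

lemma fib_neg (u : V) (A : Set V) (k : V) : fib (-u) A k = - fib u A k := by
  ext t; rw [mem_fib_neg, Set.mem_neg]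

lemma fib_isOpen {u : V} {A : Set V} (hA : IsOpen A) (k : V) : IsOpen (fib u A k) :=
  hA.preimage (by fun_prop)

lemma fib_convex {u : V} {A : Set V} (hA : Convex ℝ A) (k : V) : Convex ℝ (fib u A k) := by
  intro s hs t ht a b ha hb hab
  rw [mem_fib] at *
  have := hA hs ht ha hb hab
  convert this using 1
  rw [smul_add, smul_add, add_add_add_comm, ← add_smul, hab, one_smul, smul_smul, smul_smul,
    ← add_smul]; simp

lemma fib_bdd {u : V} (hu : ‖u‖ = 1) {A : Set V} (hA : IsBounded A) (k : V) :
    IsBounded (fib u A k) := by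
  obtain ⟨C, hC⟩ := hA.exists_norm_le
  refine (isBounded_iff_forall_norm_le).2 ⟨C + ‖k‖, fun t ht => ?_⟩
  have h1 := hC _ ht
  have h2 : ‖t • u‖ ≤ ‖k + t • u‖ + ‖k‖ := by
    have := norm_sub_le (k + t • u) k
    simpa using this
  rw [norm_smul, hu, mul_one] at h2
  linarith

lemma fib_bddAbove {u : V} (hu : ‖u‖ = 1) {A : Set V} (hA : IsBounded A) (k : V) :
    BddAbove (fib u A k) := (fib_bdd hu hA k).bddAbove
lemma fib_bddBelow {u : V} (hu : ‖u‖ = 1) {A : Set V} (hA : IsBounded A) (k : V) :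
    BddBelow (fib u A k) := (fib_bdd hu hA k).bddBelow

lemma lo_eq (u : V) (A : Set V) (k : V) : lo u A k = sInf (fib u A k) := by
  rw [lo, hi, fib_neg, Real.sInf_def]

lemma fib_eq_Ioo {u : V} (hu : ‖u‖ = 1) {A : Set V} (hA : IsBounded A) (hc : Convex ℝ A)
    (ho : IsOpen A) {k : V} (hne : (fib u A k).Nonempty) :
    fib u A k = Ioo (lo u A k) (hi u A k) := by
  apply Subset.antisymm
  · intro t ht
    have hop := fib_isOpen (u := u) ho k
    obtain ⟨e, he, hball⟩ := Metric.isOpen_iff.1 hop t ht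
    have h1 : t + e / 2 ∈ fib u A k := hball (by simp [Real.dist_eq, abs_of_pos, he])
    have h2 : t - e / 2 ∈ fib u A k := hball (by
      rw [Metric.mem_ball, Real.dist_eq]; simp [abs_of_pos, he])
    have h3 := le_csSup (fib_bddAbove hu hA k) h1
    have h4 := csInf_le (fib_bddBelow hu hA k) h2
    rw [lo_eq]
    constructor
    · linarith
    · change _ < sSup _; linarith
  · rw [lo_eq, hi]
    exact IsConnected.Ioo_csInf_csSup_subset ⟨hne, (fib_convex hc k).isPreconnected⟩
      (fib_bddBelow hu hA k) (fib_bddAbove hu hA k)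

lemma fib_eq_Icc {u : V} (hu : ‖u‖ = 1) {A : Set V} (hc : Convex ℝ A)
    (ho : IsCompact A) {k : V} (hne : (fib u A k).Nonempty) :
    fib u A k = Icc (lo u A k) (hi u A k) := by
  have hcl : IsClosed (fib u A k) := ho.isClosed.preimage (by fun_prop)
  have hcomp : IsCompact (fib u A k) := isCompact_of_isClosed_isBounded hcl (fib_bdd hu ho.isBounded k)
  have := eq_Icc_of_connected_compact ⟨hne, (fib_convex (u := u) hc k).isPreconnected⟩ hcomp
  rw [lo_eq]; exact this

lemma hi_point_closure {u : V} (hu : ‖u‖ = 1) {A : Set V} (hA : IsBounded A) {k : V}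
    (hne : (fib u A k).Nonempty) : k + hi u A k • u ∈ closure A := by
  have h := csSup_mem_closure hne (fib_bddAbove hu hA k)
  exact map_mem_closure (f := fun t : ℝ => k + t • u) (by fun_prop) h (fun t ht => ht)

/-- reflection -/
abbrev sg (u : V) : V ≃ₗᵢ[ℝ] V := (Ku u).reflection

lemma sg_apply {u : V} (hu : ‖u‖ = 1) (x : V) : sg u x = x - (2 * inner ℝ x u) • u := by
  rw [sg, Submodule.reflection_orthogonal_apply, Submodule.reflection_singleton_apply, hu]
  rw [real_inner_comm]
  simp only [RCLike.ofReal_real_eq_id, id_eq, one_pow, div_one, neg_sub]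
  rw [mul_smul, two_smul, two_smul]

lemma sg_Ku {u : V} (k : Ku u) : sg u (k : V) = k :=
  Submodule.reflection_mem_subspace_eq_self k.2

lemma sg_u {u : V} (hu : ‖u‖ = 1) : sg u u = -u := by
  rw [sg_apply hu, real_inner_self_eq_norm_sq, hu, one_pow, mul_one, two_smul]; abel

lemma top_support {u : V} (hu : ‖u‖ = 1) {E : Set V} (hc : Convex ℝ E) (hE : IsCompact E)
    {r : ℝ} (hr : 0 < r) {k : V} (hne : (fib u (thickening r E) k).Nonempty) :
    ∃ P : V, inner ℝ P u = 1 ∧ ∀ x ∈ E, inner ℝ (x - k) P ≤ hi u (thickening r E) k - r * ‖P‖ := by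
  set A := thickening r E with hA
  have hAb : IsBounded A := hE.isBounded.thickening
  have hAo : IsOpen A := isOpen_thickening
  have hAc : Convex ℝ A := hc.thickening r
  set X := k + hi u A k • u with hX
  have hXc : X ∈ closure A := hi_point_closure hu hAb hne
  have hEne : E.Nonempty := by
    obtain ⟨t, ht⟩ := hne
    obtain ⟨z, hz, _⟩ := mem_thickening_iff.1 ht
    exact ⟨z, hz⟩
  have hXn : X ∉ A := by
    intro h
    have : hi u A k ∈ fib u A k := h
    rw [fib_eq_Ioo hu hAb hAc hAo hne] at this
    exact lt_irrefl _ this.2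
  obtain ⟨p, hp, hpd⟩ := hE.exists_infDist_eq_dist hEne X
  have hd : dist X p = r := by
    apply le_antisymm
    · rw [← hpd]
      have h1 : X ∈ cthickening r E := closure_thickening_subset_cthickening _ _ hXc
      rw [mem_cthickening_iff] at h1
      rw [infDist]
      exact ENNReal.toReal_le_of_le_ofReal hr.le h1
    · by_contra hlt
      push Not at hlt
      exact hXn (mem_thickening_iff.2 ⟨p, hp, hlt⟩)
  have hproj : ∀ y ∈ E, inner ℝ (X - p) (y - p) ≤ 0 := by
    apply (norm_eq_iInf_iff_real_inner_le_zero hc hp).1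
    rw [← dist_eq_norm, ← hpd]
    rw [infDist_eq_iInf]
    simp [dist_eq_norm]
  have hd' : ‖X - p‖ = r := by rw [← dist_eq_norm, hd]
  -- positivity
  have hpos : 0 < inner ℝ (X - p) u := by
    obtain ⟨t, ht⟩ := hne
    obtain ⟨y, hy, hyd⟩ := mem_thickening_iff.1 (show k + t • u ∈ thickening r E from ht)
    have hlt : t < hi u A k := by
      have : t ∈ fib u A k := ht
      rw [fib_eq_Ioo hu hAb hAc hAo ⟨t, ht⟩] at this
      exact this.2
    have h1 := hproj y hy
    have h2 : inner ℝ (X - p) (k + t • u - y) < r * r := by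
      calc inner ℝ (X - p) (k + t • u - y) ≤ ‖X - p‖ * ‖k + t • u - y‖ := real_inner_le_norm _ _
        _ = r * ‖k + t • u - y‖ := by rw [hd']
        _ < r * r := by
          apply mul_lt_mul_of_pos_left _ hr
          rwa [← dist_eq_norm]
    have h3 : inner ℝ (X - p) (X - p) = r * r := by
      rw [real_inner_self_eq_norm_mul_norm, hd']
    have h4 : inner ℝ (X - p) (X - p) - inner ℝ (X - p) (k + t • u - y) - inner ℝ (X - p) (y - p)
      = (hi u A k - t) * inner ℝ (X - p) u := by
      rw [← inner_sub_right, ← inner_sub_right, ← inner_smul_right]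
      congr 1
      rw [hX, sub_smul]; abel
    have h5 : 0 < (hi u A k - t) * inner ℝ (X - p) u := by rw [← h4]; linarith
    exact (mul_pos_iff_of_pos_left (by linarith)).1 h5
  set w := inner ℝ (X - p) u with hw
  refine ⟨w⁻¹ • (X - p), ?_, ?_⟩
  · rw [inner_smul_left]; simp [← hw, hpos.ne']
  · intro x hx
    have h1 := hproj x hx
    rw [inner_smul_right, norm_smul, hd']
    have h3 : inner ℝ (X - p) (X - p) = r * r := by
      rw [real_inner_self_eq_norm_mul_norm, hd']
    have h4 : inner ℝ (x - k) (X - p) = inner ℝ (X - p) (x - p) - inner ℝ (X - p) (X - p) + hi u A k * w := by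
      rw [real_inner_comm, hw, ← inner_smul_right, ← inner_sub_right, ← inner_add_right]
      congr 1
      rw [hX]; abel
    rw [h4, h3, Real.norm_of_nonneg (by positivity)]
    have : w⁻¹ * (inner ℝ (X - p) (x - p) - r * r + hi u A k * w)
      = w⁻¹ * inner ℝ (X - p) (x - p) + hi u A k - r * (w⁻¹ * r) := by
      field_simp; ring
    rw [this]
    have : w⁻¹ * inner ℝ (X - p) (x - p) ≤ 0 := mul_nonpos_of_nonneg_of_nonpos (by positivity) h1
    linarith

end fibers
end Mf

namespace Mf
open InnerProductSpace Module

section steiner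
variable {V : Type*} [NormedAddCommGroup V] [InnerProductSpace ℝ V] [FiniteDimensional ℝ V]
  [MeasurableSpace V] [BorelSpace V]

/-- Steiner symmetrization of a convex set -/
def stn (u : V) (E : Set V) : Set V :=
  {z | ∃ x ∈ E, ∃ y ∈ E, ∃ c : ℝ, x = y + c • u ∧ z = (1/2 : ℝ) • (x + sg u y)}

lemma stn_convex (u : V) {E : Set V} (hE : Convex ℝ E) : Convex ℝ (stn u E) := by
  rintro _ ⟨x, hx, y, hy, c, hc, rfl⟩ _ ⟨x', hx', y', hy', c', hc', rfl⟩ a b ha hb hab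
  refine ⟨a • x + b • x', hE hx hx' ha hb hab, a • y + b • y', hE hy hy' ha hb hab,
    a * c + b * c', ?_, ?_⟩
  · rw [hc, hc']; module
  · rw [map_add, map_smul, map_smul]; module

lemma stn_compact (u : V) {E : Set V} (hE : IsCompact E) : IsCompact (stn u E) := by
  have : stn u E = (fun p : V × V => (1/2 : ℝ) • (p.1 + sg u p.2)) ''
      ((E ×ˢ E) ∩ {p | p.1 - p.2 ∈ Submodule.span ℝ {u}}) := by
    ext z
    constructor
    · rintro ⟨x, hx, y, hy, c, hc, rfl⟩
      refine ⟨(x, y), ⟨⟨hx, hy⟩, ?_⟩, rfl⟩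
      rw [mem_setOf_eq, Submodule.mem_span_singleton]
      exact ⟨c, by simp [hc]⟩
    · rintro ⟨⟨x, y⟩, ⟨⟨hx, hy⟩, h⟩, rfl⟩
      rw [mem_setOf_eq, Submodule.mem_span_singleton] at h
      obtain ⟨c, hc⟩ := h
      refine ⟨x, hx, y, hy, c, ?_, rfl⟩
      rw [hc]; abel
  rw [this]
  apply IsCompact.image _ (by fun_prop)
  apply (hE.prod hE).inter_right
  exact (Submodule.closed_of_finiteDimensional _).preimage (by fun_prop)

lemma stn_nonempty (u : V) {E : Set V} (hE : E.Nonempty) : (stn u E).Nonempty := by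
  obtain ⟨x, hx⟩ := hE
  exact ⟨_, x, hx, x, hx, 0, by simp, rfl⟩

lemma stn_subset (u : V) {E : Set V} {C : ℝ} (hE : E ⊆ closedBall 0 C) :
    stn u E ⊆ closedBall 0 C := by
  rintro _ ⟨x, hx, y, hy, c, hc, rfl⟩
  have h1 := hE hx
  have h2 := hE hy
  rw [mem_closedBall_zero_iff] at *
  calc ‖(1/2 : ℝ) • (x + sg u y)‖ = 1/2 * ‖x + sg u y‖ := by rw [norm_smul]; norm_num
    _ ≤ 1/2 * (‖x‖ + ‖sg u y‖) := by gcongr; exact norm_add_le _ _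
    _ = 1/2 * (‖x‖ + ‖y‖) := by rw [LinearIsometryEquiv.norm_map]
    _ ≤ C := by linarith

lemma fib_stn {u : V} (hu : ‖u‖ = 1) (E : Set V) (k : Ku u) (t : ℝ) :
    t ∈ fib u (stn u E) k ↔ ∃ s ∈ fib u E k, ∃ s' ∈ fib u E k, t = (s - s') / 2 := by
  constructor
  · rintro ⟨x, hx, y, hy, c, hc, h⟩
    obtain ⟨k', s', hy', -⟩ := decomp u hu y
    have hsy : sg u y = (k' : V) - s' • u := by
      rw [hy', map_add, map_smul, sg_Ku, sg_u hu]; simp [sub_eq_add_neg]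
    have h2 : (k : V) + t • u = (k' : V) + (c/2) • u := by
      rw [h, hsy, hc, hy']; module
    have ht : t = c / 2 := by
      have := congrArg (fun z => inner ℝ z u) h2
      simpa [decomp_inner u hu] using this
    have hk : (k : V) = k' := by
      rw [ht] at h2; exact add_right_cancel h2
    refine ⟨s' + c, ?_, s', ?_, by rw [ht]; ring⟩
    · rw [mem_fib, hk]; convert hx using 1; rw [hc, hy']; module
    · rw [mem_fib, hk, ← hy']; exact hy
  · rintro ⟨s, hs, s', hs', rfl⟩
    refine ⟨_, hs, _, hs', s - s', by module, ?_⟩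
    rw [map_add, map_smul, sg_Ku, sg_u hu]; module

lemma vol_fib_stn {u : V} (hu : ‖u‖ = 1) {E : Set V} (hc : Convex ℝ E) (hE : IsCompact E) (k : Ku u) :
    volume (fib u (stn u E) k) = volume (fib u E k) := by
  rcases (fib u E (k : V)).eq_empty_or_nonempty with h | h
  · have : fib u (stn u E) (k : V) = ∅ := by
      ext t; rw [fib_stn hu, h]; simp
    rw [this, h]
  · have h1 := fib_eq_Icc hu hc hE h
    have hle : lo u E k ≤ hi u E k := by
      rw [h1, nonempty_Icc] at h; exact h
    have h2 : fib u (stn u E) (k : V) = Icc (-((hi u E k - lo u E k)/2)) ((hi u E k - lo u E k)/2) := by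
      ext t
      rw [fib_stn hu, h1]
      constructor
      · rintro ⟨s, hs, s', hs', rfl⟩
        constructor <;> linarith [hs.1, hs.2, hs'.1, hs'.2]
      · intro ht
        refine ⟨(hi u E k + lo u E k)/2 + t, ⟨?_, ?_⟩, (hi u E k + lo u E k)/2 - t, ⟨?_, ?_⟩, by ring⟩ <;>
        linarith [ht.1, ht.2]
    rw [h2, h1, Real.volume_Icc, Real.volume_Icc]
    congr 1; ring

lemma stn_volume {u : V} (hu : ‖u‖ = 1) {E : Set V} (hc : Convex ℝ E) (hE : IsCompact E) :
    volume (stn u E) = volume E := by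
  rw [slice_volume u hu hE.measurableSet, slice_volume u hu (stn_compact u hE).measurableSet]
  exact lintegral_congr (fun k => vol_fib_stn hu hc hE k)

lemma stn_gap {u : V} (hu : ‖u‖ = 1) {E : Set V} (hc : Convex ℝ E) (hE : IsCompact E)
    {r : ℝ} (hr : 0 < r) (k : Ku u) (hne : (fib u (thickening r E) k).Nonempty) :
    ∃ P Q : V, inner ℝ P u = 1 ∧ inner ℝ Q u = 1 ∧
      (∀ x ∈ E, inner ℝ (x - k) P ≤ hi u (thickening r E) k - r * ‖P‖) ∧
      (∀ x ∈ E, inner ℝ (sg u x - k) Q ≤ - lo u (thickening r E) k - r * ‖Q‖) ∧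
      ∀ t ∈ fib u (thickening r (stn u E)) k,
        2 * |t| ≤ hi u (thickening r E) k - lo u (thickening r E) k - r * (‖P‖ + ‖Q‖ - ‖P + Q‖) := by
  obtain ⟨P, hP1, hP2⟩ := top_support hu hc hE hr hne
  have hne' : (fib (-u) (thickening r E) k).Nonempty := by
    rw [fib_neg]; exact hne.neg
  obtain ⟨Q', hQ1, hQ2⟩ := top_support (u := -u) (by simpa using hu) hc hE hr hne'
  have hQu : inner ℝ (sg u Q') u = 1 := by
    have : inner ℝ (sg u Q') (sg u (-u)) = (1 : ℝ) := by
      rw [LinearIsometryEquiv.inner_map_map, hQ1]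
    rwa [map_neg, sg_u hu, neg_neg] at this
  have hQ3 : ∀ x ∈ E, inner ℝ (sg u x - k) (sg u Q') ≤
      - lo u (thickening r E) k - r * ‖sg u Q'‖ := by
    intro x hx
    have h1 := hQ2 x hx
    have h2 : sg u x - k = sg u (x - k) := by rw [map_sub, sg_Ku]
    rw [h2, LinearIsometryEquiv.inner_map_map, LinearIsometryEquiv.norm_map, lo, neg_neg]
    exact h1
  refine ⟨P, sg u Q', hP1, hQu, hP2, hQ3, ?_⟩
  set Q := sg u Q'
  set g := hi u (thickening r E) k
  set l := lo u (thickening r E) k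
  -- one-sided bound
  have key : ∀ t ∈ fib u (thickening r (stn u E)) k, 2 * t ≤ g - l - r * (‖P‖ + ‖Q‖ - ‖P + Q‖) := by
    intro t ht
    obtain ⟨q, ⟨x, hx, y, hy, c, hc', hq⟩, hd⟩ := mem_thickening_iff.1 (show (k : V) + t • u ∈ _ from ht)
    have h1 := hP2 x hx
    have h2 := hQ3 y hy
    have hxy : ∃ e : ℝ, x = q + e • u ∧ sg u y = q - e • u := by
      refine ⟨inner ℝ y u + c/2, ?_, ?_⟩
      · rw [hq, hc', sg_apply hu]; module
      · rw [hq, hc', sg_apply hu]; module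
    obtain ⟨e, he1, he2⟩ := hxy
    have h3 : 2 * t = inner ℝ (x - k) P + inner ℝ (sg u y - k) Q
        + inner ℝ ((k : V) + t • u - q) (P + Q) := by
      rw [he1, he2]
      have e1 : (q + e • u - (k : V)) = (q - k) + e • u := by abel
      have e2 : (q - e • u - (k : V)) = (q - k) - e • u := by abel
      have e3 : ((k : V) + t • u - q) = t • u - (q - k) := by abel
      rw [e1, e2, e3]
      simp only [inner_add_left, inner_sub_left, inner_add_right, inner_smul_left]
      rw [real_inner_comm u P] at hP1
      rw [real_inner_comm u Q] at hQu
      simp only [hP1, hQu]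
      simp; ring
    have h4 : inner ℝ ((k : V) + t • u - q) (P + Q) ≤ r * ‖P + Q‖ := by
      refine (real_inner_le_norm _ _).trans ?_
      gcongr
      rw [← dist_eq_norm]; exact hd.le
    linarith
  intro t ht
  rcases abs_cases t with ⟨h, _⟩ | ⟨h, _⟩
  · rw [h]; exact key t ht
  · rw [h]; apply key (-t)
    obtain ⟨q, ⟨x, hx, y, hy, c, hc', hq⟩, hd⟩ := mem_thickening_iff.1 (show (k : V) + t • u ∈ _ from ht)
    refine mem_thickening_iff.2 ⟨sg u q, ⟨y, hy, x, hx, -c, by rw [hc']; module, ?_⟩, ?_⟩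
    · rw [hq, map_smul, map_add, Submodule.reflection_reflection, add_comm]
    · have : (k : V) + (-t) • u = sg u ((k : V) + t • u) := by
        rw [map_add, map_smul, sg_Ku, sg_u hu]; simp
      rw [this, LinearIsometryEquiv.dist_map]; exact hd

lemma fib_stn_empty {u : V} (hu : ‖u‖ = 1) {E : Set V}
    {r : ℝ} (k : Ku u) (hne : ¬ (fib u (thickening r E) k).Nonempty) :
    fib u (thickening r (stn u E)) k = ∅ := by
  by_contra h
  rw [← ne_eq, ← nonempty_iff_ne_empty] at h
  obtain ⟨t, ht⟩ := h
  apply hne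
  obtain ⟨q, ⟨x, hx, y, hy, c, hc', hq⟩, hd⟩ := mem_thickening_iff.1 (show (k : V) + t • u ∈ _ from ht)
  refine ⟨t + inner ℝ y u + c/2, mem_thickening_iff.2 ⟨x, hx, ?_⟩⟩
  rw [dist_eq_norm] at *
  convert hd using 2
  rw [hq, hc', sg_apply hu]; module

lemma gap_nonneg {P Q : V} : 0 ≤ ‖P‖ + ‖Q‖ - ‖P + Q‖ := by
  have := norm_add_le P Q; linarith

/-- fiberwise comparison -/
lemma vol_fib_le {u : V} (hu : ‖u‖ = 1) {E : Set V} (hc : Convex ℝ E) (hE : IsCompact E)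
    {r : ℝ} (hr : 0 < r) (k : Ku u) :
    volume (fib u (thickening r (stn u E)) k) ≤ volume (fib u (thickening r E) k) := by
  by_cases hne : (fib u (thickening r E) k).Nonempty
  · obtain ⟨P, Q, -, -, -, -, h⟩ := stn_gap hu hc hE hr k hne
    rw [fib_eq_Ioo hu hE.isBounded.thickening (hc.thickening r) isOpen_thickening hne,
      Real.volume_Ioo]
    set g := hi u (thickening r E) k
    set l := lo u (thickening r E) k
    have hsub : fib u (thickening r (stn u E)) k ⊆ Icc (-((g - l)/2)) ((g-l)/2) := by
      intro t ht
      have h1 := h t ht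
      have h2 : 0 ≤ r * (‖P‖ + ‖Q‖ - ‖P + Q‖) := mul_nonneg hr.le gap_nonneg
      have h3 : |t| ≤ (g-l)/2 := by linarith
      exact abs_le.1 h3
    refine (measure_mono hsub).trans ?_
    rw [Real.volume_Icc]
    apply le_of_eq; congr 1; ring
  · rw [fib_stn_empty hu k hne]; simp

end steiner
end Mf

namespace Mf
open InnerProductSpace Module

section col
variable {V : Type*} [NormedAddCommGroup V] [InnerProductSpace ℝ V] [FiniteDimensional ℝ V]
  [MeasurableSpace V] [BorelSpace V]

/-- fiberwise Steiner gain -/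
def kap (u : V) (r : ℝ) (E : Set V) (k : Ku u) : ℝ :=
  (volume (fib u (thickening r E) k)).toReal - (volume (fib u (thickening r (stn u E)) k)).toReal

lemma gap_lower {u : V} (hu : ‖u‖ = 1) {P Q : V} (hP : inner ℝ P u = 1) (hQ : inner ℝ Q u = 1)
    {L : ℝ} (hPL : ‖P‖ ≤ L) (hQL : ‖Q‖ ≤ L) :
    ‖P - Q‖ ^ 2 / (4 * L ^ 3) ≤ ‖P‖ + ‖Q‖ - ‖P + Q‖ := by
  have hP1 : 1 ≤ ‖P‖ := by
    have := real_inner_le_norm P u; rw [hP, hu] at this; linarith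
  have hQ1 : 1 ≤ ‖Q‖ := by
    have := real_inner_le_norm Q u; rw [hQ, hu] at this; linarith
  have hL : 1 ≤ L := hP1.trans hPL
  set p := ‖P‖ with hp
  set q := ‖Q‖ with hq
  set w := inner ℝ P Q with hw
  have hD : ‖P - Q‖ ^ 2 = p ^ 2 - 2 * w + q ^ 2 := by rw [norm_sub_sq_real]
  have hS : ‖P + Q‖ ^ 2 = p ^ 2 + 2 * w + q ^ 2 := by rw [norm_add_sq_real]
  -- Gram bound
  have hPu : ‖P - u‖ ^ 2 = p ^ 2 - 1 := by rw [norm_sub_sq_real, hP, hu]; ring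
  have hin : inner ℝ (P - u) (P - Q) = p ^ 2 - w := by
    rw [inner_sub_left, inner_sub_right, inner_sub_right, real_inner_self_eq_norm_sq,
      real_inner_comm P u, real_inner_comm Q u, hP, hQ]; ring
  have hcs : (p ^ 2 - w) ^ 2 ≤ (p ^ 2 - 1) * ‖P - Q‖ ^ 2 := by
    rw [← hin, ← hPu, ← mul_pow]
    exact sq_le_sq' (by linarith [neg_le_of_abs_le (abs_real_inner_le_norm (P - u) (P - Q))]) (real_inner_le_norm _ _)
  have hgram : ‖P - Q‖ ^ 2 ≤ (p * q - w) * (p * q + w) := by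
    nlinarith
  have hwle : w ≤ p * q := real_inner_le_norm P Q
  have hwge : - (p * q) ≤ w := neg_le_of_abs_le (abs_real_inner_le_norm P Q)
  have hpqL : p * q ≤ L ^ 2 := by nlinarith
  have h1 : ‖P - Q‖ ^ 2 ≤ (p * q - w) * (2 * L ^ 2) := by
    refine hgram.trans ?_
    apply mul_le_mul_of_nonneg_left _ (by linarith)
    linarith
  have hs0 := norm_nonneg (P + Q)
  have hsle : ‖P + Q‖ ≤ p + q := norm_add_le _ _
  have h2 : 2 * (p * q - w) = (p + q - ‖P + Q‖) * (p + q + ‖P + Q‖) := by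
    nlinarith
  have h3 : 2 * (p * q - w) ≤ (p + q - ‖P + Q‖) * (4 * L) := by
    rw [h2]; apply mul_le_mul_of_nonneg_left _ (by linarith); linarith
  rw [div_le_iff₀ (by positivity)]
  calc ‖P - Q‖ ^ 2 ≤ (p * q - w) * (2 * L ^ 2) := h1
    _ = (2 * (p * q - w)) * L ^ 2 := by ring
    _ ≤ ((p + q - ‖P + Q‖) * (4 * L)) * L ^ 2 := by gcongr
    _ = _ := by ring

lemma fib_stn_nonempty {u : V} (hu : ‖u‖ = 1) {E : Set V}
    {r : ℝ} (k : Ku u) (hne : (fib u (thickening r E) k).Nonempty) :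
    (fib u (thickening r (stn u E)) k).Nonempty := by
  obtain ⟨t, ht⟩ := hne
  obtain ⟨x, hx, hd⟩ := mem_thickening_iff.1 (show (k : V) + t • u ∈ _ from ht)
  refine ⟨t - inner ℝ x u, mem_thickening_iff.2 ⟨_, ⟨x, hx, x, hx, 0, by simp, rfl⟩, ?_⟩⟩
  rw [dist_eq_norm] at *
  convert hd using 2
  rw [sg_apply hu]; module

lemma col_point {u : V} (hu : ‖u‖ = 1) {E : Set V} (hc : Convex ℝ E) (hE : IsCompact E)
    {r : ℝ} (hr : 0 < r) {ρ1 ρ2 : ℝ} (hρ1 : 0 < ρ1) {c0 : V} (hA2 : thickening r E ⊆ ball c0 ρ2)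
    (k : Ku u) {s : ℝ} (hs : ball ((k : V) + s • u) ρ1 ⊆ thickening r E) :
    ∃ P Q : V, inner ℝ P u = 1 ∧ inner ℝ Q u = 1 ∧
      (∀ z ∈ thickening r E, inner ℝ (z - k) P ≤ hi u (thickening r E) k) ∧
      (∀ z ∈ thickening r E, inner ℝ (sg u z - k) Q ≤ - lo u (thickening r E) k) ∧
      ‖P‖ ≤ 4 * ρ2 / ρ1 ∧ ‖Q‖ ≤ 4 * ρ2 / ρ1 ∧
      r / (4 * (4 * ρ2 / ρ1) ^ 3) * ‖P - Q‖ ^ 2 ≤ kap u r E k := by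
  have hsA : s ∈ fib u (thickening r E) k := hs (mem_ball_self hρ1)
  have hne : (fib u (thickening r E) k).Nonempty := ⟨s, hsA⟩
  obtain ⟨P, Q, hP1, hQ1, hP2, hQ2, hgap⟩ := stn_gap hu hc hE hr k hne
  have hfib := fib_eq_Ioo hu hE.isBounded.thickening (hc.thickening r) isOpen_thickening hne
  have hP3 : ∀ z ∈ thickening r E, inner ℝ (z - k) P ≤ hi u (thickening r E) k := by
    intro z hz
    obtain ⟨x, hx, hd⟩ := mem_thickening_iff.1 hz
    have h1 := hP2 x hx
    have h2 : inner ℝ (z - x) P ≤ r * ‖P‖ := by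
      refine (real_inner_le_norm _ _).trans ?_
      gcongr; rw [← dist_eq_norm]; exact hd.le
    have h3 : inner ℝ (z - k) P = inner ℝ (z - x) P + inner ℝ (x - k) P := by
      rw [← inner_add_left]; congr 1; abel
    linarith
  have hQ3 : ∀ z ∈ thickening r E, inner ℝ (sg u z - k) Q ≤ - lo u (thickening r E) k := by
    intro z hz
    obtain ⟨x, hx, hd⟩ := mem_thickening_iff.1 hz
    have h1 := hQ2 x hx
    have h2 : inner ℝ (sg u z - sg u x) Q ≤ r * ‖Q‖ := by
      refine (real_inner_le_norm _ _).trans ?_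
      gcongr; rw [← dist_eq_norm, LinearIsometryEquiv.dist_map]; exact hd.le
    have h3 : inner ℝ (sg u z - k) Q = inner ℝ (sg u z - sg u x) Q + inner ℝ (sg u x - k) Q := by
      rw [← inner_add_left]; congr 1; abel
    linarith
  set g := hi u (thickening r E) k
  set l := lo u (thickening r E) k
  have hdist : ∀ t ∈ fib u (thickening r E) k, |t - s| ≤ 2 * ρ2 := by
    intro t ht
    have h1 := hA2 ht
    have h2 := hA2 hsA
    have h3 : dist ((k : V) + t • u) ((k : V) + s • u) = |t - s| := by
      rw [dist_eq_norm]
      have : (k : V) + t • u - ((k : V) + s • u) = (t - s) • u := by module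
      rw [this, norm_smul, hu]; simp
    rw [← h3]
    have := dist_triangle_right ((k : V) + t • u) ((k : V) + s • u) c0
    rw [mem_ball] at h1 h2
    linarith
  have hgs : g - s ≤ 2 * ρ2 := by
    have : g ≤ s + 2 * ρ2 := csSup_le hne (fun t ht => by linarith [le_abs_self (t - s), hdist t ht])
    linarith
  have hsl : s - l ≤ 2 * ρ2 := by
    have : s - 2 * ρ2 ≤ l := by
      change s - 2 * ρ2 ≤ lo u (thickening r E) k
      rw [lo_eq]
      exact le_csInf hne (fun t ht => by linarith [neg_abs_le (t - s), hdist t ht])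
    linarith
  have hP0 : ‖P‖ ≠ 0 := by
    intro h; rw [norm_eq_zero] at h; rw [h] at hP1; simp at hP1
  have hQ0 : ‖Q‖ ≠ 0 := by
    intro h; rw [norm_eq_zero] at h; rw [h] at hQ1; simp at hQ1
  have hPL : ‖P‖ ≤ 4 * ρ2 / ρ1 := by
    have hz : (k : V) + s • u + (ρ1/2) • (‖P‖⁻¹ • P) ∈ ball ((k : V) + s • u) ρ1 := by
      rw [mem_ball, dist_eq_norm, add_sub_cancel_left, norm_smul, norm_smul, norm_inv, norm_norm,
        inv_mul_cancel₀ hP0, Real.norm_of_nonneg (by positivity)]; linarith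
    have h1 := hP3 _ (hs hz)
    have h2 : (k : V) + s • u + (ρ1/2) • (‖P‖⁻¹ • P) - k = s • u + (ρ1/2) • (‖P‖⁻¹ • P) := by abel
    rw [h2, inner_add_left, inner_smul_left, inner_smul_left, inner_smul_left, real_inner_comm P u, hP1,
      real_inner_self_eq_norm_sq] at h1
    simp only [conj_trivial] at h1
    have h3 : ‖P‖⁻¹ * ‖P‖ ^ 2 = ‖P‖ := by field_simp
    rw [h3] at h1
    rw [le_div_iff₀ hρ1]; linarith
  have hQL : ‖Q‖ ≤ 4 * ρ2 / ρ1 := by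
    have hz : (k : V) + s • u + (ρ1/2) • (‖Q‖⁻¹ • sg u Q) ∈ ball ((k : V) + s • u) ρ1 := by
      rw [mem_ball, dist_eq_norm, add_sub_cancel_left, norm_smul, norm_smul, norm_inv, norm_norm,
        LinearIsometryEquiv.norm_map,
        inv_mul_cancel₀ hQ0, Real.norm_of_nonneg (by positivity)]; linarith
    have h1 := hQ3 _ (hs hz)
    have h2 : sg u ((k : V) + s • u + (ρ1/2) • (‖Q‖⁻¹ • sg u Q)) - k
        = -(s • u) + (ρ1/2) • (‖Q‖⁻¹ • Q) := by
      rw [map_add, map_add, map_smul, map_smul, map_smul, sg_Ku, sg_u hu, Submodule.reflection_reflection]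
      module
    rw [h2, inner_add_left, inner_neg_left, inner_smul_left, inner_smul_left, inner_smul_left, real_inner_comm Q u, hQ1,
      real_inner_self_eq_norm_sq] at h1
    simp only [conj_trivial] at h1
    have h3 : ‖Q‖⁻¹ * ‖Q‖ ^ 2 = ‖Q‖ := by field_simp
    rw [h3] at h1
    rw [le_div_iff₀ hρ1]; linarith
  refine ⟨P, Q, hP1, hQ1, hP3, hQ3, hPL, hQL, ?_⟩
  have h1 := gap_lower hu hP1 hQ1 hPL hQL
  set L := 4 * ρ2 / ρ1
  have h2 : r / (4 * L ^ 3) * ‖P - Q‖ ^ 2 ≤ r * (‖P‖ + ‖Q‖ - ‖P + Q‖) := by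
    calc r / (4 * L ^ 3) * ‖P - Q‖ ^ 2 = r * (‖P - Q‖ ^ 2 / (4 * L ^ 3)) := by ring
      _ ≤ _ := by gcongr
  refine h2.trans ?_
  rw [kap, hfib, Real.volume_Ioo]
  have hlg : l < g := by
    have : s ∈ Ioo l g := by rw [← hfib]; exact hsA
    exact this.1.trans this.2
  rw [ENNReal.toReal_ofReal (by linarith)]
  set M := g - l - r * (‖P‖ + ‖Q‖ - ‖P + Q‖) with hM
  have hM0 : 0 ≤ M := by
    obtain ⟨t, ht⟩ := fib_stn_nonempty hu k hne
    have := hgap t ht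
    have := abs_nonneg t
    linarith
  have hsub : fib u (thickening r (stn u E)) k ⊆ Icc (-(M/2)) (M/2) := by
    intro t ht
    have h1 := hgap t ht
    have h3 : |t| ≤ M/2 := by linarith
    exact abs_le.1 h3
  have hv : (volume (fib u (thickening r (stn u E)) k)).toReal ≤ M := by
    apply ENNReal.toReal_le_of_le_ofReal hM0
    refine (measure_mono hsub).trans ?_
    rw [Real.volume_Icc]; apply le_of_eq; congr 1; ring
  linarith

end col
end Mf

namespace Mf
open InnerProductSpace Module

lemma deriv_of_supergrad {G : ℝ → ℝ} {t p : ℝ} (ht : t ∈ Ioo (0:ℝ) 1) (hd : DifferentiableAt ℝ G t)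
    (h : ∀ t' ∈ Icc (0:ℝ) 1, G t' ≤ G t + p * (t' - t)) : deriv G t = p := by
  have hmax : IsLocalMax (fun s => G s - p * (s - t)) t := by
    have : Icc (0:ℝ) 1 ∈ nhds t := Icc_mem_nhds ht.1 ht.2
    filter_upwards [this] with s hs
    have := h s hs
    simp; linarith
  have h1 := hmax.deriv_eq_zero
  have h2 : HasDerivAt (fun s => G s - p * (s - t)) (deriv G t - p * 1) t :=
    hd.hasDerivAt.sub (((hasDerivAt_id t).sub_const t).const_mul p)
  rw [h2.deriv] at h1
  linarith

lemma lint_cs {f : ℝ → ℝ≥0∞} (hf : AEMeasurable f (volume.restrict (Ioo (0:ℝ) 1))) :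
    (∫⁻ t in Ioo (0:ℝ) 1, f t) ^ 2 ≤ ∫⁻ t in Ioo (0:ℝ) 1, f t ^ 2 := by
  have h := ENNReal.lintegral_mul_le_Lp_mul_Lq (volume.restrict (Ioo (0:ℝ) 1))
    (p := 2) (q := 2) (by constructor <;> norm_num) hf (aemeasurable_const (b := (1:ℝ≥0∞)))
  simp only [Pi.mul_apply, mul_one, ENNReal.one_rpow, lintegral_const, Measure.restrict_apply,
    MeasurableSet.univ, univ_inter, Real.volume_Ioo, sub_zero, ENNReal.ofReal_one, one_mul] at h
  have h2 := pow_le_pow_left' h 2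
  refine h2.trans (le_of_eq ?_)
  rw [← ENNReal.rpow_natCast, ← ENNReal.rpow_mul]
  norm_num

lemma oned {G H : ℝ → ℝ} {M : ℝ≥0} (hG : LipschitzOnWith M G (Icc 0 1))
    (hH : LipschitzOnWith M H (Icc 0 1)) {κ : ℝ → ℝ≥0∞}
    (h : ∀ t ∈ Ioo (0:ℝ) 1, ∃ p q : ℝ, (∀ t' ∈ Icc (0:ℝ) 1, G t' ≤ G t + p * (t' - t)) ∧
      (∀ t' ∈ Icc (0:ℝ) 1, H t' ≤ H t + q * (t' - t)) ∧ ENNReal.ofReal ((p - q) ^ 2) ≤ κ t) :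
    ENNReal.ofReal (((G 1 - H 1) - (G 0 - H 0)) ^ 2) ≤ ∫⁻ t in Ioo (0:ℝ) 1, κ t := by
  have hGa : AbsolutelyContinuousOnInterval G 0 1 :=
    LipschitzOnWith.absolutelyContinuousOnInterval (by rw [uIcc_of_le zero_le_one]; exact hG)
  have hHa : AbsolutelyContinuousOnInterval H 0 1 :=
    LipschitzOnWith.absolutelyContinuousOnInterval (by rw [uIcc_of_le zero_le_one]; exact hH)
  have hq := (hGa.sub hHa).integral_deriv_eq_sub
  have hIntg := (hGa.sub hHa).intervalIntegrable_deriv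
  have hGd := hG.ae_differentiableWithinAt (μ := volume) measurableSet_Icc
  have hHd := hH.ae_differentiableWithinAt (μ := volume) measurableSet_Icc
  rw [intervalIntegral.integral_of_le zero_le_one, integral_Ioc_eq_integral_Ioo] at hq
  have e1 : (fun x => G x - H x) 1 - (fun x => G x - H x) 0 = (G 1 - H 1) - (G 0 - H 0) := rfl
  have hq' : ∫ t in Ioo (0:ℝ) 1, deriv (G - H) t = (G 1 - H 1) - (G 0 - H 0) := hq
  have hmeas : AEMeasurable (fun t => ‖deriv (G - H) t‖ₑ) (volume.restrict (Ioo (0:ℝ) 1)) :=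
    (measurable_deriv _).enorm.aemeasurable
  calc ENNReal.ofReal (((G 1 - H 1) - (G 0 - H 0)) ^ 2)
      = ‖∫ t in Ioo (0:ℝ) 1, deriv (G - H) t‖ₑ ^ 2 := by
        rw [hq', Real.enorm_eq_ofReal_abs, ← ENNReal.ofReal_pow (abs_nonneg _), sq_abs]
    _ ≤ (∫⁻ t in Ioo (0:ℝ) 1, ‖deriv (G - H) t‖ₑ) ^ 2 := by
        gcongr; exact enorm_integral_le_lintegral_enorm _
    _ ≤ ∫⁻ t in Ioo (0:ℝ) 1, ‖deriv (G - H) t‖ₑ ^ 2 := lint_cs hmeas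
    _ ≤ ∫⁻ t in Ioo (0:ℝ) 1, κ t := by
        apply lintegral_mono_ae
        have hs : ∀ᵐ t ∂(volume.restrict (Ioo (0:ℝ) 1)), t ∈ Ioo (0:ℝ) 1 :=
          ae_restrict_mem measurableSet_Ioo
        have hGd' := ae_restrict_of_ae_restrict_of_subset (Ioo_subset_Icc_self) hGd
        have hHd' := ae_restrict_of_ae_restrict_of_subset (Ioo_subset_Icc_self) hHd
        filter_upwards [hs, hGd', hHd'] with t ht h1 h2
        have hnh : Icc (0:ℝ) 1 ∈ nhds t := Icc_mem_nhds ht.1 ht.2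
        have h1' := h1.differentiableAt hnh
        have h2' := h2.differentiableAt hnh
        obtain ⟨p, q, hp, hq, hk⟩ := h t ht
        rw [deriv_sub h1' h2', deriv_of_supergrad ht h1' hp, deriv_of_supergrad ht h2' hq,
          Real.enorm_eq_ofReal_abs, ← ENNReal.ofReal_pow (abs_nonneg _), sq_abs]
        exact hk

section seg
variable {V : Type*} [NormedAddCommGroup V] [InnerProductSpace ℝ V] [FiniteDimensional ℝ V]
  [MeasurableSpace V] [BorelSpace V]

/-- the doubled midpoint of the fiber of the parallel set -/
def mid (u : V) (A : Set V) (k : V) : ℝ := hi u A k + lo u A k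

lemma supergrad_hi {u : V} {A : Set V} {k k' P : V} (hP1 : inner ℝ P u = 1)
    (hP : ∀ z ∈ A, inner ℝ (z - k) P ≤ hi u A k) (hne : (fib u A k').Nonempty) :
    hi u A k' ≤ hi u A k - inner ℝ (k' - k) P := by
  apply csSup_le hne
  intro t ht
  have := hP _ ht
  have e : k' + t • u - k = (k' - k) + t • u := by abel
  rw [e, inner_add_left, inner_smul_left, real_inner_comm P u, hP1] at this
  simp at this; linarith

lemma supergrad_lo {u : V} (hu : ‖u‖ = 1) {A : Set V} {k k' : Ku u} {Q : V} (hQ1 : inner ℝ Q u = 1)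
    (hQ : ∀ z ∈ A, inner ℝ (sg u z - k) Q ≤ - lo u A k) (hne : (fib u A k').Nonempty) :
    - lo u A k' ≤ - lo u A k - inner ℝ ((k' : V) - k) Q := by
  rw [lo_eq u A k']
  rw [neg_le]
  apply le_csInf hne
  intro t ht
  have := hQ _ ht
  have e : sg u ((k' : V) + t • u) - k = ((k' : V) - k) - t • u := by
    rw [map_add, map_smul, sg_Ku, sg_u hu]; module
  rw [e, inner_sub_left, inner_smul_left, real_inner_comm Q u, hQ1] at this
  simp at this; linarith

lemma seg_bound {u : V} (hu : ‖u‖ = 1) {E : Set V} (hc : Convex ℝ E) (hE : IsCompact E)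
    {r : ℝ} (hr : 0 < r) {ρ1 ρ2 : ℝ} (hρ1 : 0 < ρ1) {c0 : V} (hA2 : thickening r E ⊆ ball c0 ρ2)
    {D : Set (Ku u)} (hD : Convex ℝ D)
    (hDb : ∀ k ∈ D, ∃ s : ℝ, ball ((k : V) + s • u) ρ1 ⊆ thickening r E)
    {k k' : Ku u} (hk : k ∈ D) (hk' : k' ∈ D) :
    ENNReal.ofReal ((mid u (thickening r E) k' - mid u (thickening r E) k) ^ 2) ≤
      ENNReal.ofReal (‖k' - k‖ ^ 2 * (4 * (4 * ρ2 / ρ1) ^ 3 / r)) *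
        ∫⁻ t in Ioo (0:ℝ) 1, ENNReal.ofReal (kap u r E (k + t • (k' - k))) := by
  set A := thickening r E with hA
  have hρ2 : 0 < ρ2 := by
    obtain ⟨s, hs⟩ := hDb k hk
    exact pos_of_mem_ball (hA2 (hs (mem_ball_self hρ1)))
  set L := 4 * ρ2 / ρ1 with hL
  have hLpos : 0 < L := by positivity
  set e := k' - k with he
  have hseg : ∀ t ∈ Icc (0:ℝ) 1, k + t • e ∈ D := by
    intro t ht
    have := hD hk hk' (a := 1 - t) (b := t) (by linarith [ht.2]) ht.1 (by ring)
    convert this using 1; rw [he]; module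
  have hne : ∀ t ∈ Icc (0:ℝ) 1, (fib u A ((k + t • e : Ku u) : V)).Nonempty := by
    intro t ht
    obtain ⟨s, hs⟩ := hDb _ (hseg t ht)
    exact ⟨s, hs (mem_ball_self hρ1)⟩
  have hsg : ∀ t ∈ Icc (0:ℝ) 1, ∃ p q : ℝ, |p| ≤ L * ‖e‖ ∧ |q| ≤ L * ‖e‖ ∧
      (∀ t' ∈ Icc (0:ℝ) 1, hi u A ((k + t' • e : Ku u) : V) ≤ hi u A ((k + t • e : Ku u) : V) + p * (t' - t)) ∧
      (∀ t' ∈ Icc (0:ℝ) 1, - lo u A ((k + t' • e : Ku u) : V) ≤ - lo u A ((k + t • e : Ku u) : V) + q * (t' - t)) ∧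
      (p - q) ^ 2 ≤ ‖e‖ ^ 2 * (4 * L ^ 3 / r) * kap u r E (k + t • e) := by
    intro t ht
    obtain ⟨s, hs⟩ := hDb _ (hseg t ht)
    obtain ⟨P, Q, hP1, hQ1, hP, hQ, hPL, hQL, hκ⟩ := col_point hu hc hE hr hρ1 hA2 _ hs
    have hdiff : ∀ t' : ℝ, ((k + t' • e : Ku u) : V) - ((k + t • e : Ku u) : V) = (t' - t) • (e : V) := by
      intro t'; push_cast; module
    refine ⟨- inner ℝ (e : V) P, - inner ℝ (e : V) Q, ?_, ?_, ?_, ?_, ?_⟩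
    · rw [abs_neg]
      refine (abs_real_inner_le_norm _ _).trans ?_
      rw [mul_comm]; gcongr; rfl
    · rw [abs_neg]
      refine (abs_real_inner_le_norm _ _).trans ?_
      rw [mul_comm]; gcongr; rfl
    · intro t' ht'
      have := supergrad_hi hP1 hP (hne t' ht')
      rw [hdiff, inner_smul_left] at this
      simp only [conj_trivial] at this
      linarith
    · intro t' ht'
      have := supergrad_lo hu hQ1 hQ (hne t' ht')
      rw [hdiff, inner_smul_left] at this
      simp only [conj_trivial] at this
      linarith
    · have h1 : (- inner ℝ (e : V) P - - inner ℝ (e : V) Q) = - inner ℝ (e : V) (P - Q) := by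
        rw [inner_sub_right]; ring
      rw [h1, neg_sq]
      have h2 : (inner ℝ (e : V) (P - Q)) ^ 2 ≤ ‖e‖ ^ 2 * ‖P - Q‖ ^ 2 := by
        rw [← sq_abs, ← mul_pow]
        gcongr
        exact abs_real_inner_le_norm _ _
      refine h2.trans ?_
      rw [mul_assoc]
      gcongr
      calc ‖P - Q‖ ^ 2 = 4 * L ^ 3 / r * (r / (4 * L ^ 3) * ‖P - Q‖ ^ 2) := by
            field_simp
        _ ≤ _ := by gcongr
  set M : ℝ≥0 := ⟨L * ‖e‖, by positivity⟩
  have hG : LipschitzOnWith M (fun t : ℝ => hi u A ((k + t • e : Ku u) : V)) (Icc 0 1) := by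
    refine LipschitzOnWith.of_le_add_mul M ?_
    intro x hx y hy
    obtain ⟨p, q, hp, -, h1, -, -⟩ := hsg y hy
    have := h1 x hx
    have h2 : p * (x - y) ≤ L * ‖e‖ * dist x y := by
      rw [Real.dist_eq]
      refine (le_abs_self _).trans ?_
      rw [abs_mul]; gcongr
    change _ ≤ _ + L * ‖e‖ * dist x y
    linarith
  have hH : LipschitzOnWith M (fun t : ℝ => - lo u A ((k + t • e : Ku u) : V)) (Icc 0 1) := by
    refine LipschitzOnWith.of_le_add_mul M ?_
    intro x hx y hy
    obtain ⟨p, q, -, hp, -, h1, -⟩ := hsg y hy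
    have := h1 x hx
    have h2 : q * (x - y) ≤ L * ‖e‖ * dist x y := by
      rw [Real.dist_eq]
      refine (le_abs_self _).trans ?_
      rw [abs_mul]; gcongr
    change _ ≤ _ + L * ‖e‖ * dist x y
    linarith
  have hmain := oned hG hH (κ := fun t => ENNReal.ofReal (‖e‖ ^ 2 * (4 * L ^ 3 / r)) *
      ENNReal.ofReal (kap u r E (k + t • e))) (by
    intro t ht
    obtain ⟨p, q, -, -, h1, h2, h3⟩ := hsg t (Ioo_subset_Icc_self ht)
    refine ⟨p, q, h1, h2, ?_⟩
    rw [← ENNReal.ofReal_mul (by positivity)]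
    exact ENNReal.ofReal_le_ofReal h3)
  rw [lintegral_const_mul' _ _ ENNReal.ofReal_ne_top] at hmain
  refine le_trans (le_of_eq ?_) hmain
  congr 1
  simp only [mid, he, one_smul, zero_smul, add_zero, add_sub_cancel]
  ring

lemma kap_nonneg {u : V} (hu : ‖u‖ = 1) {E : Set V} (hc : Convex ℝ E) (hE : IsCompact E)
    {r : ℝ} (hr : 0 < r) (k : Ku u) : 0 ≤ kap u r E k := by
  rw [kap, sub_nonneg]
  apply ENNReal.toReal_mono _ (vol_fib_le hu hc hE hr k)
  exact ((fib_bdd hu hE.isBounded.thickening _).measure_lt_top).ne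

lemma kap_eq {u : V} (hu : ‖u‖ = 1) {E : Set V} (hc : Convex ℝ E) (hE : IsCompact E)
    {r : ℝ} (hr : 0 < r) (k : Ku u) : ENNReal.ofReal (kap u r E k) =
      volume (fib u (thickening r E) k) - volume (fib u (thickening r (stn u E)) k) := by
  have h1 : volume (fib u (thickening r E) (k:V)) ≠ ⊤ :=
    ((fib_bdd hu hE.isBounded.thickening _).measure_lt_top).ne
  have h2 : volume (fib u (thickening r (stn u E)) (k:V)) ≠ ⊤ :=
    ne_top_of_le_ne_top h1 (vol_fib_le hu hc hE hr k)
  rw [kap, ENNReal.ofReal_sub _ ENNReal.toReal_nonneg, ENNReal.ofReal_toReal h1, ENNReal.ofReal_toReal h2]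

lemma kap_meas {u : V} (hu : ‖u‖ = 1) {E : Set V} {r : ℝ} : Measurable (kap u r E) := by
  apply Measurable.sub
  · exact (slice_meas u hu isOpen_thickening.measurableSet).ennreal_toReal
  · exact (slice_meas u hu isOpen_thickening.measurableSet).ennreal_toReal

lemma kap_int {u : V} (hu : ‖u‖ = 1) {E : Set V} (hc : Convex ℝ E) (hE : IsCompact E)
    {r : ℝ} (hr : 0 < r) : ∫⁻ k, ENNReal.ofReal (kap u r E k) =
      volume (thickening r E) - volume (thickening r (stn u E)) := by
  simp_rw [kap_eq hu hc hE hr]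
  rw [slice_volume u hu (S := thickening r E) isOpen_thickening.measurableSet,
    slice_volume u hu (S := thickening r (stn u E)) isOpen_thickening.measurableSet]
  apply lintegral_sub (slice_meas u hu isOpen_thickening.measurableSet)
  · rw [← slice_volume u hu (S := thickening r (stn u E)) isOpen_thickening.measurableSet]
    exact ((stn_compact u hE).isBounded.thickening.measure_lt_top).ne
  · exact Eventually.of_forall (fun k => vol_fib_le hu hc hE hr k)

lemma vol_stn_le {u : V} (hu : ‖u‖ = 1) {E : Set V} (hc : Convex ℝ E) (hE : IsCompact E)
    {r : ℝ} (hr : 0 < r) : volume (thickening r (stn u E)) ≤ volume (thickening r E) := by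
  rw [slice_volume u hu (S := thickening r E) isOpen_thickening.measurableSet,
    slice_volume u hu (S := thickening r (stn u E)) isOpen_thickening.measurableSet]
  exact lintegral_mono (fun k => vol_fib_le hu hc hE hr k)

end seg
end Mf

namespace Mf
open InnerProductSpace Module
section
variable {V : Type*} [NormedAddCommGroup V] [InnerProductSpace ℝ V] [FiniteDimensional ℝ V]
  [MeasurableSpace V] [BorelSpace V]

lemma lin_cv {W : Type*} [NormedAddCommGroup W] [InnerProductSpace ℝ W] [FiniteDimensional ℝ W]
    [MeasurableSpace W] [BorelSpace W] (g : W → ℝ≥0∞) (hg : Measurable g) {a : ℝ} (ha : 1 / 2 ≤ a)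
    (c : W) : ∫⁻ k, g (a • k + c) ≤ 2 ^ finrank ℝ W * ∫⁻ k, g k := by
  have ha0 : 0 < a := by linarith
  have h1 : ∫⁻ k, g (a • k + c) = ENNReal.ofReal (abs (a ^ finrank ℝ W)⁻¹) * ∫⁻ k, g (k + c) := by
    have := lintegral_map (μ := (volume : Measure W)) (f := fun k => g (k + c))
      (g := fun k => a • k) (by fun_prop) (by fun_prop)
    rw [← this, Measure.map_addHaar_smul _ ha0.ne', lintegral_smul_measure]; rfl
  rw [h1, lintegral_add_right_eq_self]
  gcongr
  rw [abs_of_pos (by positivity), ← inv_pow, ENNReal.ofReal_pow (by positivity)]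
  gcongr
  rw [show (2:ℝ≥0∞) = ENNReal.ofReal 2 by norm_num]
  apply ENNReal.ofReal_le_ofReal
  rw [inv_le_comm₀ ha0 (by norm_num)]; linarith

lemma avg_seg {W : Type*} [NormedAddCommGroup W] [InnerProductSpace ℝ W] [FiniteDimensional ℝ W]
    [MeasurableSpace W] [BorelSpace W] (g : W → ℝ≥0∞) (hg : Measurable g) (D : Set W) :
    ∫⁻ k in D, ∫⁻ k' in D, ∫⁻ t in Ioo (0:ℝ) 1, g (k + t • (k' - k)) ≤
      2 ^ finrank ℝ W * volume D * ∫⁻ k, g k := by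
  have m1 : Measurable (fun p : (W × W) × ℝ => g (p.1.1 + p.2 • (p.1.2 - p.1.1))) := by fun_prop
  have e1 : ∀ k, ∫⁻ k' in D, ∫⁻ t in Ioo (0:ℝ) 1, g (k + t • (k' - k)) =
      ∫⁻ t in Ioo (0:ℝ) 1, ∫⁻ k' in D, g (k + t • (k' - k)) := fun k =>
    lintegral_lintegral_swap (by fun_prop)
  simp_rw [e1]
  have m2 : Measurable (fun p : W × ℝ => ∫⁻ k' in D, g (p.1 + p.2 • (k' - p.1))) := by
    apply Measurable.lintegral_prod_right' (f := fun q : (W × ℝ) × W => g (q.1.1 + q.1.2 • (q.2 - q.1.1)))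
    fun_prop
  rw [lintegral_lintegral_swap m2.aemeasurable]
  have key : ∀ t ∈ Ioo (0:ℝ) 1, ∫⁻ k in D, ∫⁻ k' in D, g (k + t • (k' - k)) ≤
      2 ^ finrank ℝ W * volume D * ∫⁻ k, g k := by
    intro t ht
    rcases le_total (1/2) t with h | h
    · calc ∫⁻ k in D, ∫⁻ k' in D, g (k + t • (k' - k))
          ≤ ∫⁻ k in D, 2 ^ finrank ℝ W * ∫⁻ k, g k := by
            apply lintegral_mono; intro k
            refine (setLIntegral_le_lintegral _ _).trans ?_
            refine le_trans (le_of_eq ?_) (lin_cv g hg h ((1 - t) • k))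
            congr 1; ext k'; congr 1; module
        _ = _ := by rw [setLIntegral_const]; ring
    · rw [lintegral_lintegral_swap (by fun_prop)]
      calc ∫⁻ k' in D, ∫⁻ k in D, g (k + t • (k' - k))
          ≤ ∫⁻ k in D, 2 ^ finrank ℝ W * ∫⁻ k, g k := by
            apply lintegral_mono; intro k'
            refine (setLIntegral_le_lintegral _ _).trans ?_
            refine le_trans (le_of_eq ?_) (lin_cv g hg (a := 1 - t) (by linarith) (t • k'))
            congr 1; ext k; congr 1; module
        _ = _ := by rw [setLIntegral_const]; ring
  calc _ ≤ ∫⁻ t in Ioo (0:ℝ) 1, 2 ^ finrank ℝ W * volume D * ∫⁻ k, g k := by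
        apply setLIntegral_mono measurable_const; exact key
    _ = _ := by rw [setLIntegral_const]; simp

/-- Poincare-type inequality for the midpoint function. -/
lemma col {u : V} (hu : ‖u‖ = 1) {E : Set V} (hc : Convex ℝ E) (hE : IsCompact E)
    {r : ℝ} (hr : 0 < r) {ρ1 ρ2 : ℝ} (hρ1 : 0 < ρ1) {c0 : V} (hA2 : thickening r E ⊆ ball c0 ρ2)
    {D : Set (Ku u)} (hD : Convex ℝ D) (hDm : MeasurableSet D)
    (hDb : ∀ k ∈ D, ∃ s : ℝ, ball ((k : V) + s • u) ρ1 ⊆ thickening r E)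
    {M : ℝ} (hM : ∀ k ∈ D, ∀ k' ∈ D, ‖k' - k‖ ≤ M) :
    ∫⁻ k in D, ∫⁻ k' in D,
      ENNReal.ofReal ((mid u (thickening r E) k' - mid u (thickening r E) k) ^ 2) ≤
      ENNReal.ofReal (M ^ 2 * (4 * (4 * ρ2 / ρ1) ^ 3 / r)) * (2 ^ finrank ℝ (Ku u) * volume D *
        (volume (thickening r E) - volume (thickening r (stn u E)))) := by
  set C := ENNReal.ofReal (M ^ 2 * (4 * (4 * ρ2 / ρ1) ^ 3 / r)) with hC
  have km : Measurable (fun k => ENNReal.ofReal (kap u r E k)) := (kap_meas hu).ennreal_ofReal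
  calc _ ≤ ∫⁻ k in D, ∫⁻ k' in D, C * ∫⁻ t in Ioo (0:ℝ) 1,
        ENNReal.ofReal (kap u r E (k + t • (k' - k))) := by
        refine setLIntegral_mono' hDm fun k hk => setLIntegral_mono' hDm fun k' hk' => ?_
        refine (seg_bound hu hc hE hr hρ1 hA2 hD hDb hk hk').trans ?_
        have : 0 < ρ2 := by
          obtain ⟨s, hs⟩ := hDb k hk
          have := hA2 (hs (mem_ball_self hρ1))
          exact pos_of_mem_ball this
        rw [hC]
        gcongr
        exact hM k hk k' hk'
    _ ≤ C * ∫⁻ k in D, ∫⁻ k' in D, ∫⁻ t in Ioo (0:ℝ) 1,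
        ENNReal.ofReal (kap u r E (k + t • (k' - k))) := by
        have hCt : C ≠ ⊤ := ENNReal.ofReal_ne_top
        simp_rw [lintegral_const_mul' _ _ hCt]
        exact le_rfl
    _ ≤ _ := by
        gcongr
        rw [← kap_int hu hc hE hr]
        exact avg_seg _ km D

lemma volK {u : V} (hu : ‖u‖ = 1) {d : ℝ} (hd : 0 < d) :
    volume (closedBall (0 : Ku u) d) * ENNReal.ofReal (2 * d) ≤ volume (ball (0 : V) (2 * d)) := by
  rw [slice_volume u hu measurableSet_ball, mul_comm, ← setLIntegral_const, ← lintegral_indicator measurableSet_closedBall]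
  apply lintegral_mono
  intro k
  simp only [indicator]
  split_ifs with hk
  · have : Ioo (-d) d ⊆ {t : ℝ | (k : V) + t • u ∈ ball (0:V) (2 * d)} := by
      intro t ht
      simp only [mem_setOf_eq, mem_ball_zero_iff]
      have h1 : ‖k‖ ≤ d := by simpa using hk
      have h2 : |t| < d := abs_lt.2 ht
      calc ‖(k : V) + t • u‖ ≤ ‖(k:V)‖ + ‖t • u‖ := norm_add_le _ _
        _ = ‖k‖ + |t| := by rw [norm_smul, hu, mul_one]; rfl
        _ < 2 * d := by linarith
    refine le_trans (le_of_eq ?_) (measure_mono this)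
    rw [Real.volume_Ioo]; congr 1; ring
  · exact zero_le

lemma volK' {u : V} (hu : ‖u‖ = 1) {d : ℝ} (hd : 0 < d) :
    volume (ball (0 : V) d) ≤ volume (ball (0 : Ku u) d) * ENNReal.ofReal (2 * d) := by
  rw [slice_volume u hu measurableSet_ball, mul_comm, ← setLIntegral_const, ← lintegral_indicator measurableSet_ball]
  apply lintegral_mono
  intro k
  simp only [indicator]
  have hs : ∀ t : ℝ, (k : V) + t • u ∈ ball (0:V) d → ‖k‖ < d ∧ |t| < d := by
    intro t ht
    rw [mem_ball_zero_iff] at ht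
    have := decomp_norm_sq u hu k t
    constructor
    · apply lt_of_pow_lt_pow_left₀ 2 hd.le
      nlinarith [sq_nonneg t, norm_nonneg ((k : V) + t • u)]
    · apply lt_of_pow_lt_pow_left₀ 2 hd.le
      rw [sq_abs]
      nlinarith [sq_nonneg ‖k‖, norm_nonneg ((k : V) + t • u)]
  split_ifs with hk
  · have : {t : ℝ | (k : V) + t • u ∈ ball (0:V) d} ⊆ Ioo (-d) d := fun t ht => abs_lt.1 (hs t ht).2
    refine (measure_mono this).trans (le_of_eq ?_)
    rw [Real.volume_Ioo]; congr 1; ring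
  · refine le_of_eq ?_
    rw [measure_eq_zero_iff_ae_notMem]
    refine ae_of_all _ fun t ht => hk ?_
    simpa using (hs t ht).1

end
end Mf

namespace Mf
open InnerProductSpace Module
section
variable {V : Type*} [NormedAddCommGroup V] [InnerProductSpace ℝ V] [FiniteDimensional ℝ V]
  [MeasurableSpace V] [BorelSpace V]

lemma mid_lip {u : V} (hu : ‖u‖ = 1) {E : Set V} (hc : Convex ℝ E) (hE : IsCompact E)
    {r : ℝ} (hr : 0 < r) {ρ1 ρ2 : ℝ} (hρ1 : 0 < ρ1) {c0 : V} (hA2 : thickening r E ⊆ ball c0 ρ2)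
    {k k' : Ku u} (hk : ∃ s : ℝ, ball ((k : V) + s • u) ρ1 ⊆ thickening r E)
    (hk' : ∃ s : ℝ, ball ((k' : V) + s • u) ρ1 ⊆ thickening r E) :
    |mid u (thickening r E) k' - mid u (thickening r E) k| ≤ 2 * (4 * ρ2 / ρ1) * ‖k' - k‖ := by
  set A := thickening r E
  have main : ∀ k k' : Ku u, (∃ s : ℝ, ball ((k : V) + s • u) ρ1 ⊆ A) →
      (∃ s : ℝ, ball ((k' : V) + s • u) ρ1 ⊆ A) →
      hi u A k' - hi u A k ≤ (4 * ρ2 / ρ1) * ‖k' - k‖ ∧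
      lo u A k - lo u A k' ≤ (4 * ρ2 / ρ1) * ‖k' - k‖ := by
    rintro k k' ⟨s, hs⟩ ⟨s', hs'⟩
    obtain ⟨P, Q, hP, hQ, h1, h2, h3, h4, -⟩ := col_point hu hc hE hr hρ1 hA2 k hs
    have hne : (fib u A k').Nonempty := ⟨s', hs' (mem_ball_self hρ1)⟩
    have a1 := supergrad_hi hP h1 hne
    have a2 := supergrad_lo hu hQ h2 hne
    have n1 : ‖(k' : V) - k‖ = ‖k' - k‖ := rfl
    have b1 := abs_real_inner_le_norm ((k' : V) - k) P
    have b2 := abs_real_inner_le_norm ((k' : V) - k) Q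
    rw [n1] at b1 b2
    have c1 : ‖k' - k‖ * ‖P‖ ≤ ‖k' - k‖ * (4 * ρ2 / ρ1) := by gcongr
    have c2 : ‖k' - k‖ * ‖Q‖ ≤ ‖k' - k‖ * (4 * ρ2 / ρ1) := by gcongr
    have d1 := neg_abs_le (inner ℝ ((k' : V) - k) P)
    have d2 := neg_abs_le (inner ℝ ((k' : V) - k) Q)
    constructor <;> linarith
  have m1 := main k k' hk hk'
  have m2 := main k' k hk' hk
  rw [norm_sub_rev] at m2
  rw [abs_le]; simp only [mid]
  constructor <;> linarith [m1.1, m1.2, m2.1, m2.2]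

lemma mid_const {u : V} (hu : ‖u‖ = 1) {E : Set V} (hc : Convex ℝ E) (hE : IsCompact E)
    {r : ℝ} (hr : 0 < r) (h0 : volume (thickening r E) ≤ volume (thickening r (stn u E)))
    {k k' : Ku u} (hk : (fib u (thickening r E) k).Nonempty)
    (hk' : (fib u (thickening r E) k').Nonempty) :
    mid u (thickening r E) k = mid u (thickening r E) k' := by
  set A := thickening r E with hA
  have ho : IsOpen A := isOpen_thickening
  have hcA : Convex ℝ A := hc.thickening r
  obtain ⟨ρ2, hA2⟩ : ∃ ρ2, A ⊆ ball 0 ρ2 := (hE.isBounded.thickening).subset_ball 0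
  obtain ⟨s, hs⟩ := hk
  obtain ⟨s', hs'⟩ := hk'
  obtain ⟨e, he, hes⟩ := Metric.isOpen_iff.1 ho _ hs
  obtain ⟨e', he', hes'⟩ := Metric.isOpen_iff.1 ho _ hs'
  set ρ1 := min e e' / 2 with hρ
  have hρ1 : 0 < ρ1 := by positivity
  set I := interior {x | ball x ρ1 ⊆ A} with hI
  have hIo : IsOpen I := isOpen_interior
  have hIc : Convex ℝ I := by
    apply Convex.interior
    intro x hx y hy a b ha hb hab
    intro z hz
    have hz' : ‖z - (a • x + b • y)‖ < ρ1 := by simpa [dist_eq_norm] using hz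
    set w := z - (a • x + b • y) with hw
    have : z = a • (x + w) + b • (y + w) := by
      have : z = (a • x + b • y) + (a + b) • w := by rw [hab, one_smul, hw]; abel
      rw [this]; module
    rw [this]
    exact hcA (hx (by simpa [dist_eq_norm] using hz')) (hy (by simpa [dist_eq_norm] using hz')) ha hb hab
  have hmemI : ∀ x, ball x (2 * ρ1) ⊆ A → x ∈ I := by
    intro x hx
    rw [hI, mem_interior]
    refine ⟨ball x ρ1, ?_, isOpen_ball, mem_ball_self hρ1⟩
    intro y hy
    refine Subset.trans ?_ hx
    apply ball_subset_ball'
    have := mem_ball.1 hy; linarith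
  set D : Set (Ku u) := {k | ∃ s : ℝ, (k : V) + s • u ∈ I} with hD
  have hDo : IsOpen D := by
    have : D = ⋃ s : ℝ, (fun k : Ku u => (k : V) + s • u) ⁻¹' I := by ext; simp [hD]
    rw [this]
    exact isOpen_iUnion fun s => hIo.preimage (by fun_prop)
  have hDc : Convex ℝ D := by
    rintro x ⟨s, hs⟩ y ⟨t, ht⟩ a b ha hb hab
    refine ⟨a * s + b * t, ?_⟩
    have := hIc hs ht ha hb hab
    convert this using 1
    simp only [Submodule.coe_add, Submodule.coe_smul]; module
  have hDb : ∀ k ∈ D, ∃ s : ℝ, ball ((k : V) + s • u) ρ1 ⊆ A := by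
    rintro k ⟨s, hs⟩
    exact ⟨s, interior_subset hs⟩
  have hkD : k ∈ D := ⟨s, hmemI _ ((ball_subset_ball (by rw [hρ]; linarith [min_le_left e e'])).trans hes)⟩
  have hkD' : k' ∈ D := ⟨s', hmemI _ ((ball_subset_ball (by rw [hρ]; linarith [min_le_right e e'])).trans hes')⟩
  have hM : ∀ k ∈ D, ∀ k' ∈ D, ‖k' - k‖ ≤ 2 * ρ2 := by
    have hb : ∀ k ∈ D, ‖k‖ ≤ ρ2 := by
      intro k hk
      obtain ⟨s, hs⟩ := hDb k hk
      have h1 := hA2 (hs (mem_ball_self hρ1))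
      rw [mem_ball_zero_iff] at h1
      have h2 := decomp_norm_sq u hu k s
      apply le_of_lt
      apply lt_of_pow_lt_pow_left₀ 2 (le_trans (norm_nonneg _) h1.le)
      nlinarith [sq_nonneg s, norm_nonneg ((k : V) + s • u)]
    intro k hk k' hk'
    linarith [norm_sub_le k' k, hb k hk, hb k' hk']
  have hcol := col hu hc hE hr hρ1 hA2 hDc hDo.measurableSet hDb hM
  rw [tsub_eq_zero_of_le h0, mul_zero, mul_zero] at hcol
  by_contra hne
  have hcont : ContinuousOn (fun k : Ku u => mid u A k) D := by
    have : LipschitzOnWith (Real.toNNReal (2 * (4 * ρ2 / ρ1))) (fun k : Ku u => mid u A k) D := by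
      apply LipschitzOnWith.of_dist_le_mul
      intro x hx y hy
      rw [Real.dist_eq, dist_eq_norm]
      refine (mid_lip hu hc hE hr hρ1 hA2 (hDb y hy) (hDb x hx)).trans ?_
      gcongr
      exact Real.le_coe_toNNReal _
    exact this.continuousOn
  set dl := |mid u A k' - mid u A k| / 4 with hdl
  have hdl0 : 0 < dl := by
    have : 0 < |mid u A k' - mid u A k| := abs_pos.2 (sub_ne_zero.2 (Ne.symm hne))
    positivity
  have hn : ∀ x ∈ D, ∃ U : Set (Ku u), U ⊆ D ∧ volume U ≠ 0 ∧ MeasurableSet U ∧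
      ∀ y ∈ U, |mid u A y - mid u A x| < dl := by
    intro x hx
    have h1 : ContinuousAt (fun k : Ku u => mid u A k) x := hcont.continuousAt (hDo.mem_nhds hx)
    have h2 := Metric.continuousAt_iff.1 h1 dl hdl0
    obtain ⟨d1, hd1, h3⟩ := h2
    obtain ⟨d2, hd2, h4⟩ := Metric.isOpen_iff.1 hDo x hx
    refine ⟨ball x (min d1 d2), (ball_subset_ball (min_le_right _ _)).trans h4,
      (measure_ball_pos _ _ (by positivity)).ne', measurableSet_ball, fun y hy => ?_⟩
    have := h3 (lt_of_lt_of_le (mem_ball.1 hy) (min_le_left _ _))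
    rwa [Real.dist_eq] at this
  obtain ⟨U, hUD, hU0, hUm, hU⟩ := hn k hkD
  obtain ⟨U', hUD', hU0', hUm', hU'⟩ := hn k' hkD'
  have hge : ENNReal.ofReal (dl ^ 2) * volume U' * volume U ≤ 0 := by
    refine le_trans ?_ hcol
    calc _ = ∫⁻ x in U, ∫⁻ y in U', ENNReal.ofReal (dl ^ 2) := by
          rw [setLIntegral_const, setLIntegral_const]
      _ ≤ ∫⁻ x in U, ∫⁻ y in U', ENNReal.ofReal ((mid u A y - mid u A x) ^ 2) := by
          refine setLIntegral_mono' hUm fun x hx => setLIntegral_mono' hUm' fun y hy => ?_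
          apply ENNReal.ofReal_le_ofReal
          rw [← sq_abs (mid u A y - mid u A x)]
          have := hU x hx
          have := hU' y hy
          have h5 : |mid u A k' - mid u A k| ≤ |mid u A y - mid u A k'| +
              |mid u A y - mid u A x| + |mid u A x - mid u A k| := by
            rw [abs_sub_comm (mid u A y) (mid u A k')]
            calc _ = |(mid u A k' - mid u A y) + (mid u A y - mid u A x) + (mid u A x - mid u A k)| := by
                  congr 1; ring
              _ ≤ _ := abs_add_three _ _ _
          gcongr
          linarith
      _ ≤ ∫⁻ x in D, ∫⁻ y in D, ENNReal.ofReal ((mid u A y - mid u A x) ^ 2) := by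
          refine (lintegral_mono fun x => lintegral_mono_set hUD').trans ?_
          exact lintegral_mono_set hUD
  have h6 : ENNReal.ofReal (dl ^ 2) ≠ 0 := by
    simp only [ne_eq, ENNReal.ofReal_eq_zero, not_le]; positivity
  simp [h6, hU0, hU0'] at hge

lemma refl_sym {u : V} (hu : ‖u‖ = 1) {E : Set V} (hc : Convex ℝ E) (hE : IsCompact E)
    {r : ℝ} (hr : 0 < r) (h0 : volume (thickening r E) ≤ volume (thickening r (stn u E)))  :
    ∃ β : ℝ, ∀ x ∈ thickening r E, x + (β - 2 * inner ℝ x u) • u ∈ thickening r E := by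
  set A := thickening r E with hA
  have ho : IsOpen A := isOpen_thickening
  have hcA : Convex ℝ A := hc.thickening r
  have hbA : IsBounded A := hE.isBounded.thickening
  rcases A.eq_empty_or_nonempty with h | ⟨x0, hx0⟩
  · simp [h]
  obtain ⟨k0, t0, hx0e, -⟩ := decomp u hu x0
  have hne0 : (fib u A k0).Nonempty := ⟨t0, by rw [mem_fib, ← hx0e]; exact hx0⟩
  refine ⟨mid u A k0, fun x hx => ?_⟩
  obtain ⟨k, t, hxe, hti⟩ := decomp u hu x
  have ht : t ∈ fib u A k := by rw [mem_fib, ← hxe]; exact hx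
  have hm := mid_const hu hc hE hr h0 hne0 ⟨t, ht⟩
  have hIoo := fib_eq_Ioo hu hbA hcA ho ⟨t, ht⟩
  have : mid u A k0 - t ∈ fib u A k := by
    rw [hIoo] at ht ⊢
    rw [hm, mid]
    constructor <;> linarith [ht.1, ht.2]
  rw [mem_fib] at this
  rw [← hti, hxe]
  convert this using 1
  module

/-- centroid -/
def ctr (A : Set V) : V := (volume A).toReal⁻¹ • ∫ x in A, x

lemma ctr_inner {A : Set V} (hA : IsBounded A) (hm : MeasurableSet A) (h0 : volume A ≠ 0) (u : V) :
    ∫ x in A, inner ℝ x u = (volume A).toReal * inner ℝ (ctr A) u := by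
  have hfin : volume A ≠ ⊤ := hA.measure_lt_top.ne
  have hi : IntegrableOn (fun x : V => x) A := by
    obtain ⟨C, hC⟩ := hA.exists_norm_le
    apply Measure.integrableOn_of_bounded (M := C) hfin (by fun_prop)
    filter_upwards [ae_restrict_mem hm] with x hx using hC x hx
  have hp : (volume A).toReal ≠ 0 := ENNReal.toReal_ne_zero.2 ⟨h0, hfin⟩
  simp_rw [real_inner_comm u]
  rw [integral_inner hi u, ctr, inner_smul_right, mul_inv_cancel_left₀ hp]

lemma ctr_of_sym {u : V} (hu : ‖u‖ = 1) {A : Set V} (hA : IsBounded A) (hm : MeasurableSet A)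
    (h0 : volume A ≠ 0) {β : ℝ} (hs : ∀ x ∈ A, x + (β - 2 * inner ℝ x u) • u ∈ A) :
    2 * inner ℝ (ctr A) u = β := by
  set τ : V → V := fun x => x + (β - 2 * inner ℝ x u) • u with hτ
  have hτi : ∀ x, inner ℝ (τ x) u = β - inner ℝ x u := by
    intro x
    simp only [hτ, inner_add_left, inner_smul_left, real_inner_self_eq_norm_sq, hu]
    simp; ring
  have hττ : ∀ x, τ (τ x) = x := by
    intro x
    have := hτi x
    change τ x + (β - 2 * inner ℝ (τ x) u) • u = x
    rw [this]
    simp only [hτ]; module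
  have hpre : τ ⁻¹' A = A := by
    ext x; constructor
    · intro h; have := hs _ h; rw [← hττ x]; exact this
    · intro h; exact hs _ h
  have hmp : MeasurePreserving τ := by
    have : τ = fun x => β • u + (sg u) x := by
      ext x; simp only [hτ]; rw [sg_apply hu]; module
    rw [this]
    exact (measurePreserving_add_left volume (β • u)).comp (sg u).measurePreserving
  have hemb : MeasurableEmbedding τ := by
    have hc : Continuous τ := by fun_prop
    let h : V ≃ₜ V := ⟨⟨τ, τ, hττ, hττ⟩, hc, hc⟩
    exact h.measurableEmbedding
  have key := hmp.setIntegral_preimage_emb hemb (fun x => inner ℝ x u) A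
  rw [hpre] at key
  simp_rw [hτi] at key
  have hfin : volume A ≠ ⊤ := hA.measure_lt_top.ne
  have hIntg : IntegrableOn (fun x : V => inner ℝ x u) A := by
    obtain ⟨C, hC⟩ := hA.exists_norm_le
    apply Measure.integrableOn_of_bounded (M := C) hfin (by fun_prop)
    filter_upwards [ae_restrict_mem hm] with x hx
    have := norm_inner_le_norm (𝕜 := ℝ) x u
    rw [hu, mul_one] at this
    exact this.trans (hC x hx)
  have hcst : IntegrableOn (fun _ : V => β) A := integrableOn_const hfin
  rw [integral_sub (by exact hcst) hIntg, setIntegral_const, ctr_inner hA hm h0] at key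
  have hp : (volume A).toReal ≠ 0 := ENNReal.toReal_ne_zero.2 ⟨h0, hfin⟩
  simp only [Measure.real, smul_eq_mul] at key
  apply mul_left_cancel₀ hp
  linarith

end
end Mf

namespace Mf
open InnerProductSpace Module TopologicalSpace
section
variable {V : Type*} [NormedAddCommGroup V] [InnerProductSpace ℝ V] [FiniteDimensional ℝ V]
  [MeasurableSpace V] [BorelSpace V]

lemma sym_ball [Nontrivial V] {A : Set V} (hc : Convex ℝ A) {c : V}
    (h : ∀ u : V, ‖u‖ = 1 → ∀ x ∈ A, x + (2 * inner ℝ c u - 2 * inner ℝ x u) • u ∈ A)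
    {x y : V} (hx : x ∈ A) (hxy : ‖y - c‖ ≤ ‖x - c‖) : y ∈ A := by
  have key : ∀ y, ‖y - c‖ = ‖x - c‖ → y ∈ A := by
    intro y hy
    by_cases hne : x = y
    · exact hne ▸ hx
    have hd : ‖x - y‖ ≠ 0 := norm_ne_zero_iff.2 (sub_ne_zero.2 hne)
    set u := (‖x - y‖)⁻¹ • (x - y) with hu
    have hu1 : ‖u‖ = 1 := by rw [hu, norm_smul, norm_inv, norm_norm, inv_mul_cancel₀ hd]
    have := h u hu1 x hx
    convert this using 1
    have e1 : 2 * inner ℝ (x - c) (x - y) = ‖x - y‖ ^ 2 := by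
      have h1 : ‖y - c‖ ^ 2 = ‖(x - c) - (x - y)‖ ^ 2 := by congr 2; abel
      rw [hy, norm_sub_sq_real (x - c) (x - y)] at h1
      linarith
    have e2 : 2 * inner ℝ c u - 2 * inner ℝ x u = - ‖x - y‖ := by
      rw [← mul_sub, ← inner_sub_left, hu, inner_smul_right]
      have : inner ℝ (c - x) (x - y) = - inner ℝ (x - c) (x - y) := by
        rw [← inner_neg_left]; congr 1; abel
      rw [this]
      field_simp
      linarith
    rw [e2, hu, smul_smul]
    rw [neg_mul, mul_inv_cancel₀ hd]; module
  obtain ⟨e, he, hye⟩ : ∃ e : V, ‖e‖ = 1 ∧ y - c = ‖y - c‖ • e := by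
    by_cases h0 : y - c = 0
    · obtain ⟨e, he⟩ := exists_norm_eq V zero_le_one
      exact ⟨e, he, by simp [h0]⟩
    · refine ⟨(‖y - c‖)⁻¹ • (y - c), ?_, ?_⟩
      · rw [norm_smul, norm_inv, norm_norm, inv_mul_cancel₀ (norm_ne_zero_iff.2 h0)]
      · rw [smul_smul, mul_inv_cancel₀ (norm_ne_zero_iff.2 h0), one_smul]
  by_cases hd : ‖x - c‖ = 0
  · exact key y (by have := norm_nonneg (y - c); linarith)
  have hdp : 0 < ‖x - c‖ := lt_of_le_of_ne (norm_nonneg _) (Ne.symm hd)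
  have h1 : c + ‖x - c‖ • e ∈ A := key _ (by simp [norm_smul, he])
  have h2 : c - ‖x - c‖ • e ∈ A := key _ (by simp [norm_smul, he])
  set d := ‖x - c‖
  set s := ‖y - c‖
  have := hc h1 h2 (a := (1 + s / d) / 2) (b := (1 - s / d) / 2) (by positivity)
    (by have : s / d ≤ 1 := (div_le_one hdp).2 hxy
        linarith) (by ring)
  convert this using 1
  have : y = c + s • e := by rw [← hye]; abel
  rw [this]
  have h3 : s • e = ((s / d) * d) • e := by rw [div_mul_cancel₀ _ hd]
  rw [h3]; module

lemma zero_gain_ball [Nontrivial V] {E : Set V} (hc : Convex ℝ E) (hE : IsCompact E) (hne : E.Nonempty)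
    {r : ℝ} (hr : 0 < r)
    (h0 : ∀ u : V, ‖u‖ = 1 → volume (thickening r E) ≤ volume (thickening r (stn u E))) :
    ∃ c M, 0 ≤ M ∧ thickening r E = ball c (M + r) ∧ E ⊆ closedBall c M := by
  set A := thickening r E with hA
  have ho : IsOpen A := isOpen_thickening
  have hcA : Convex ℝ A := hc.thickening r
  have hbA : IsBounded A := hE.isBounded.thickening
  have hEA : E ⊆ A := self_subset_thickening hr E
  have hv : volume A ≠ 0 := (ho.measure_pos volume (hne.mono hEA)).ne'
  have hs : ∀ u : V, ‖u‖ = 1 → ∀ x ∈ A, x + (2 * inner ℝ (ctr A) u - 2 * inner ℝ x u) • u ∈ A := by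
    intro u hu
    obtain ⟨β, hβ⟩ := refl_sym hu hc hE hr (h0 u hu)
    rw [ctr_of_sym hu hbA ho.measurableSet hv hβ]
    exact hβ
  set c := ctr A
  obtain ⟨xM, hxM, hmax⟩ := hE.exists_isMaxOn hne (f := fun x => ‖x - c‖) (by fun_prop)
  have hmax' : ∀ x ∈ E, ‖x - c‖ ≤ ‖xM - c‖ := fun x hx => hmax hx
  refine ⟨c, ‖xM - c‖, norm_nonneg _, ?_, fun x hx => by simpa [dist_eq_norm] using hmax' x hx⟩
  ext y
  constructor
  · intro hy
    obtain ⟨p, hp, hyp⟩ := mem_thickening_iff.1 hy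
    rw [mem_ball]
    have := hmax' p hp
    have h2 := dist_triangle y p c
    rw [dist_eq_norm p c] at h2
    linarith
  · intro hy
    rw [mem_ball, dist_eq_norm] at hy
    obtain ⟨e, he, hye⟩ : ∃ e : V, ‖e‖ = 1 ∧ xM - c = ‖xM - c‖ • e := by
      by_cases h0 : xM - c = 0
      · obtain ⟨e, he⟩ := exists_norm_eq V zero_le_one
        exact ⟨e, he, by simp [h0]⟩
      · refine ⟨(‖xM - c‖)⁻¹ • (xM - c), ?_, ?_⟩
        · rw [norm_smul, norm_inv, norm_norm, inv_mul_cancel₀ (norm_ne_zero_iff.2 h0)]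
        · rw [smul_smul, mul_inv_cancel₀ (norm_ne_zero_iff.2 h0), one_smul]
    set s := max 0 (‖y - c‖ - ‖xM - c‖) with hsd
    have hs0 : 0 ≤ s := le_max_left _ _
    have hsr : s < r := max_lt hr (by linarith)
    have hx : xM + s • e ∈ A := by
      rw [hA, mem_thickening_iff]
      exact ⟨xM, hxM, by simp [dist_eq_norm, norm_smul, he, abs_of_nonneg hs0, hsr]⟩
    refine sym_ball hcA hs hx ?_
    have : xM + s • e - c = (‖xM - c‖ + s) • e := by
      rw [add_smul, ← hye]; abel
    rw [this, norm_smul, he, mul_one, Real.norm_eq_abs, abs_of_nonneg (by positivity)]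
    have := le_max_right 0 (‖y - c‖ - ‖xM - c‖)
    linarith

lemma vol_th_le {G : Set V} {r : ℝ} {L : ℝ≥0∞}
    (h : ∀ e > 0, volume (thickening (r - e) G) ≤ L) : volume (thickening r G) ≤ L := by
  have : thickening r G = ⋃ n : ℕ, thickening (r - 1 / ((n : ℝ) + 1)) G := by
    ext x; simp only [mem_thickening_iff, mem_iUnion]
    constructor
    · rintro ⟨z, hz, hxz⟩
      obtain ⟨n, hn⟩ := exists_nat_one_div_lt (sub_pos.2 hxz)
      exact ⟨n, z, hz, by linarith⟩
    · rintro ⟨n, z, hz, hxz⟩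
      have : 0 < 1 / ((n : ℝ) + 1) := by positivity
      exact ⟨z, hz, by linarith⟩
  rw [this, Monotone.measure_iUnion]
  · exact iSup_le fun n => h _ (by positivity)
  · intro m n hmn
    apply thickening_mono
    have : 1 / ((n : ℝ) + 1) ≤ 1 / ((m : ℝ) + 1) := by gcongr
    linarith

lemma nc_close {F G : NonemptyCompacts V} {e : ℝ} (h : dist F G < e) :
    (F : Set V) ⊆ thickening e G ∧ (G : Set V) ⊆ thickening e F := by
  have hne : hausdorffEDist (F : Set V) G ≠ ⊤ :=
    hausdorffEDist_ne_top_of_nonempty_of_bounded F.nonempty G.nonempty F.isCompact.isBounded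
      G.isCompact.isBounded
  rw [NonemptyCompacts.dist_eq] at h
  constructor
  · intro x hx
    obtain ⟨y, hy, hxy⟩ := exists_dist_lt_of_hausdorffDist_lt hx h hne
    exact mem_thickening_iff.2 ⟨y, hy, hxy⟩
  · intro x hx
    obtain ⟨y, hy, hxy⟩ := exists_dist_lt_of_hausdorffDist_lt' hx h hne
    exact mem_thickening_iff.2 ⟨y, hy, by rwa [dist_comm]⟩

lemma cpt {C r : ℝ} {m0 : ℝ≥0∞} (F : ℕ → NonemptyCompacts V)
    (hsub : ∀ k, (F k : Set V) ⊆ closedBall 0 C) (hconv : ∀ k, Convex ℝ (F k : Set V))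
    (hvol : ∀ k, m0 ≤ volume (F k : Set V)) {L : ℕ → ℝ≥0∞} {L0 : ℝ≥0∞}
    (hL : Tendsto L atTop (nhds L0)) (hFL : ∀ k, volume (thickening r (F k : Set V)) ≤ L k) :
    ∃ G : NonemptyCompacts V, ∃ φ : ℕ → ℕ, StrictMono φ ∧ Tendsto (F ∘ φ) atTop (nhds G) ∧
      (G : Set V) ⊆ closedBall 0 C ∧ Convex ℝ (G : Set V) ∧ m0 ≤ volume (G : Set V) ∧
      volume (thickening r (G : Set V)) ≤ L0 := by
  have hcpt := NonemptyCompacts.isCompact_subsets_of_isCompact (isCompact_closedBall (0:V) C)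
  obtain ⟨G, hG, φ, hφ, hlim⟩ := hcpt.tendsto_subseq (x := F) (fun k => hsub k)
  have hev : ∀ e > 0, ∀ᶠ k in atTop, (F (φ k) : Set V) ⊆ thickening e G ∧
      (G : Set V) ⊆ thickening e (F (φ k) : Set V) := by
    intro e he
    filter_upwards [Metric.tendsto_nhds.1 hlim e he] with k hk using nc_close hk
  refine ⟨G, φ, hφ, hlim, hG, ?_, ?_, ?_⟩
  · intro x hx y hy a b ha hb hab
    have hcl : closure (G : Set V) = G := G.isCompact.isClosed.closure_eq
    rw [← hcl, Metric.mem_closure_iff]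
    intro e he
    obtain ⟨k, h1, h2⟩ := (hev (e / 2) (by positivity)).exists
    have h3 := ((hconv (φ k)).thickening (e / 2)) (h2 hx) (h2 hy) ha hb hab
    have h4 : thickening (e/2) (F (φ k) : Set V) ⊆ thickening e G := by
      refine (thickening_subset_of_subset _ h1).trans ?_
      refine (thickening_thickening_subset _ _ _).trans (thickening_mono (by linarith) _)
    obtain ⟨z, hz, hxz⟩ := mem_thickening_iff.1 (h4 h3)
    exact ⟨z, hz, hxz⟩
  · have ht := tendsto_measure_thickening_of_isClosed (μ := volume) (s := (G : Set V))
      ⟨1, one_pos, (G.isCompact.isBounded.thickening).measure_lt_top.ne⟩ G.isCompact.isClosed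
    refine ge_of_tendsto ht ?_
    filter_upwards [self_mem_nhdsWithin] with e he
    obtain ⟨k, h1, -⟩ := (hev e he).exists
    exact (hvol _).trans (measure_mono h1)
  · apply vol_th_le
    intro e he
    have hL' := hL.comp hφ.tendsto_atTop
    refine ge_of_tendsto hL' ?_
    filter_upwards [hev e he] with k hk
    refine le_trans (measure_mono ?_) (hFL (φ k))
    refine (thickening_subset_of_subset _ hk.2).trans ?_
    refine (thickening_thickening_subset _ _ _).trans (thickening_mono (by linarith) _)

end
end Mf

namespace Mf
open InnerProductSpace Module TopologicalSpace
section
variable {V : Type*} [NormedAddCommGroup V] [InnerProductSpace ℝ V] [FiniteDimensional ℝ V]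
  [MeasurableSpace V] [BorelSpace V]

lemma vol_ball_lt [Nontrivial V] {a b : ℝ} (hb : 0 ≤ b) (c c' : V) (h : volume (ball c a) ≤ volume (closedBall c' b)) :
    a ≤ b := by
  by_contra hlt
  push Not at hlt
  have ha : 0 < a := by linarith
  rw [Measure.addHaar_ball _ _ ha.le, Measure.addHaar_closedBall _ _ hb] at h
  have hp : volume (ball (0:V) 1) ≠ 0 := (measure_ball_pos _ _ one_pos).ne'
  have hf : volume (ball (0:V) 1) ≠ ⊤ := measure_ball_lt_top.ne
  rw [ENNReal.mul_le_mul_iff_left hp hf, ENNReal.ofReal_le_ofReal_iff (by positivity)] at h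
  have : b ^ finrank ℝ V < a ^ finrank ℝ V := pow_lt_pow_left₀ hlt hb finrank_pos.ne'
  linarith

/-- Brunn-Minkowski with a ball. -/
lemma bm [Nontrivial V] {E : Set V} (hc : Convex ℝ E) (hE : IsCompact E) (hne : E.Nonempty)
    {r ρ0 : ℝ} (hr : 0 < r) (hv : volume (ball (0:V) ρ0) ≤ volume E) :
    volume (ball (0:V) (ρ0 + r)) ≤ volume (thickening r E) := by
  obtain ⟨C, hC⟩ := hE.isBounded.subset_closedBall 0
  set S : Set ℝ≥0∞ := {v | ∃ F : NonemptyCompacts V, (F : Set V) ⊆ closedBall 0 C ∧ Convex ℝ (F : Set V) ∧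
    volume (ball (0:V) ρ0) ≤ volume (F : Set V) ∧ volume (thickening r (F : Set V)) = v} with hS
  have hES : volume (thickening r E) ∈ S := ⟨⟨⟨E, hE⟩, hne⟩, hC, hc, hv, rfl⟩
  obtain ⟨v, -, hvt, hvS⟩ := exists_seq_tendsto_sInf ⟨_, hES⟩ (OrderBot.bddBelow S)
  choose F h1 h2 h3 h4 using hvS
  obtain ⟨G, φ, -, -, g1, g2, g3, g4⟩ := cpt F h1 h2 h3 hvt (fun k => (h4 k).le)
  refine le_trans (le_trans ?_ g4) (sInf_le hES)
  obtain ⟨c, M, hM, hb, hsub⟩ := zero_gain_ball g2 G.isCompact G.nonempty hr (by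
    intro u hu
    refine g4.trans (sInf_le ?_)
    refine ⟨⟨⟨stn u G, stn_compact u G.isCompact⟩, stn_nonempty u G.nonempty⟩, stn_subset u g1,
      stn_convex u g2, ?_, rfl⟩
    change _ ≤ volume (stn u (G : Set V))
    rw [stn_volume hu g2 G.isCompact]
    exact g3)
  have hρ : ρ0 ≤ M := vol_ball_lt hM 0 c (g3.trans (measure_mono hsub))
  rw [hb, Measure.addHaar_ball_center volume c]
  exact measure_mono (ball_subset_ball (by linarith))

lemma ball_cancel {A : Set V} (ho : IsOpen A) (hc : Convex ℝ A) {c : V} {ρ e : ℝ}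
    (he : 0 < e) (h : ball c ρ ⊆ thickening e A) : ball c (ρ - e) ⊆ A := by
  intro y hy
  by_contra hyA
  obtain ⟨f, hf⟩ := geometric_hahn_banach_open_point hc ho hyA
  set w := (toDual ℝ V).symm f with hw
  have hfw : ∀ x, f x = inner ℝ w x := fun x => by rw [hw, toDual_symm_apply]
  by_cases hw0 : w = 0
  · have hyb : y ∈ thickening e A := h (ball_subset_ball (by linarith) hy)
    obtain ⟨z, hz, -⟩ := mem_thickening_iff.1 hyb
    have := hf z hz
    simp [hfw, hw0] at this
  have hn : 0 < ‖w‖ := norm_pos_iff.2 hw0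
  set x := y + (e / ‖w‖) • w with hx
  have hxb : x ∈ ball c ρ := by
    rw [mem_ball] at hy ⊢
    have h1 : dist x y = e := by
      rw [dist_eq_norm, hx]; simp only [add_sub_cancel_left, norm_smul, Real.norm_eq_abs, abs_div, abs_norm]
      rw [abs_of_pos he]; field_simp
    linarith [dist_triangle x y c]
  obtain ⟨z, hz, hxz⟩ := mem_thickening_iff.1 (h hxb)
  have h1 := hf z hz
  rw [hfw, hfw] at h1
  have h2 : inner ℝ w x = inner ℝ w y + e * ‖w‖ := by
    rw [hx, inner_add_right, inner_smul_right, real_inner_self_eq_norm_sq]; field_simp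
  have h3 : inner ℝ w (x - z) ≤ ‖w‖ * ‖x - z‖ := real_inner_le_norm _ _
  rw [inner_sub_right, ← dist_eq_norm] at h3
  nlinarith

lemma coarse [Nontrivial V] {r R C e : ℝ} (hr : 0 < r) (hR : 0 < R) (he : 0 < e) :
    ∃ δ : ℝ, 0 < δ ∧ ∀ E : Set V, Convex ℝ E → IsCompact E → E.Nonempty → E ⊆ closedBall 0 C →
      volume (ball (0:V) R) ≤ volume E →
      volume (thickening r E) ≤ volume (ball (0:V) (R + r)) + ENNReal.ofReal δ →
      ∃ c, ball c (R + r - e) ⊆ thickening r E ∧ thickening r E ⊆ ball c (R + r + e) := by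
  by_contra hcon
  push Not at hcon
  have hk : ∀ k : ℕ, (0:ℝ) < 1 / ((k:ℝ) + 1) := fun k => by positivity
  choose E h1 h2 h3 h4 h5 h6 h7 using fun k : ℕ => hcon (1 / ((k:ℝ) + 1)) (hk k)
  have hL : Tendsto (fun k : ℕ => volume (ball (0:V) (R + r)) + ENNReal.ofReal (1 / ((k:ℝ) + 1)))
      atTop (nhds (volume (ball (0:V) (R + r)))) := by
    have : Tendsto (fun k : ℕ => ENNReal.ofReal (1 / ((k:ℝ) + 1))) atTop (nhds 0) := by
      rw [← ENNReal.ofReal_zero]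
      exact (ENNReal.continuous_ofReal.tendsto 0).comp tendsto_one_div_add_atTop_nhds_zero_nat
    simpa using tendsto_const_nhds.add this
  obtain ⟨G, φ, hφ, hlim, g1, g2, g3, g4⟩ := cpt (fun k => ⟨⟨E k, h2 k⟩, h3 k⟩) h4 h1 h5 hL h6
  obtain ⟨c, M, hM, hb, hsub⟩ := zero_gain_ball g2 G.isCompact G.nonempty hr (by
    intro u hu
    refine g4.trans ?_
    apply bm (stn_convex u g2) (stn_compact u G.isCompact) (stn_nonempty u G.nonempty) hr
    rw [stn_volume hu g2 G.isCompact]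
    exact g3)
  have hρ : R ≤ M := vol_ball_lt hM 0 c (g3.trans (measure_mono hsub))
  have hρ' : M ≤ R := by
    have : M + r ≤ R + r := by
      apply vol_ball_lt (by positivity) c 0
      rw [← hb]; exact g4.trans (measure_mono ball_subset_closedBall)
    linarith
  have hMR : M = R := le_antisymm hρ' hρ
  subst hMR
  obtain ⟨k, hk⟩ := (Metric.tendsto_nhds.1 hlim e he).exists
  obtain ⟨a1, a2⟩ := nc_close hk
  change E (φ k) ⊆ _ at a1
  change (G : Set V) ⊆ thickening e (E (φ k)) at a2
  refine h7 (φ k) c ?_ ?_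
  · apply ball_cancel isOpen_thickening ((h1 _).thickening r) he
    rw [← hb]
    refine (thickening_subset_of_subset _ a2).trans ?_
    rw [thickening_thickening hr he, thickening_thickening he hr, add_comm]
  · refine (thickening_subset_of_subset _ a1).trans ?_
    rw [thickening_thickening hr he]
    intro x hx
    rw [add_comm r e, ← thickening_thickening he hr, hb] at hx
    obtain ⟨z, hz, hxz⟩ := mem_thickening_iff.1 hx
    rw [mem_ball] at hz ⊢
    linarith [dist_triangle x z c]

end
end Mf

namespace Mf
open InnerProductSpace Module TopologicalSpace
section
variable {V : Type*} [NormedAddCommGroup V] [InnerProductSpace ℝ V] [FiniteDimensional ℝ V]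
  [MeasurableSpace V] [BorelSpace V]

lemma vol_lip_image {f : V → V} {s : Set V} {K : ℝ≥0} (h : LipschitzOnWith K f s) :
    volume (f '' s) ≤ (K : ℝ≥0∞) ^ finrank ℝ V * volume s := by
  have e : (volume : Measure V) = Measure.addHaarScalarFactor (volume : Measure V) (Measure.hausdorffMeasure (finrank ℝ V : ℝ)) •
      (Measure.hausdorffMeasure (finrank ℝ V : ℝ) : Measure V) :=
    Measure.isAddLeftInvariant_eq_smul _ _
  have h1 := h.hausdorffMeasure_image_le (d := (finrank ℝ V : ℝ)) (by positivity)
  rw [ENNReal.rpow_natCast] at h1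
  rw [e]
  simp only [Measure.smul_apply, ENNReal.smul_def, smul_eq_mul]
  rw [mul_left_comm]
  gcongr

lemma int_pow {n : ℕ} (hn : 1 ≤ n) {a b : ℝ} (ha : 0 ≤ a) (hab : a ≤ b) :
    ∫⁻ t in Ioo a b, ENNReal.ofReal (n * t ^ (n - 1)) = ENNReal.ofReal (b ^ n - a ^ n) := by
  rw [Measure.restrict_congr_set Ioo_ae_eq_Ioc, ← ofReal_integral_eq_lintegral_ofReal]
  · rw [← intervalIntegral.integral_of_le hab, intervalIntegral.integral_const_mul, integral_pow]
    congr 1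
    have : n - 1 + 1 = n := by omega
    rw [this]
    have h2 : ((n - 1 : ℕ) : ℝ) + 1 = n := by exact_mod_cast this
    rw [h2]
    have : (n:ℝ) ≠ 0 := by positivity
    field_simp
  · exact (Continuous.intervalIntegrable (by fun_prop) a b).1
  · filter_upwards [ae_restrict_mem measurableSet_Ioc] with t ht
    have : 0 ≤ t := ha.trans ht.1.le
    positivity

/-- normalization -/
def ht (y : V) : V := ‖y‖⁻¹ • y

lemma ht_norm {y : V} (hy : y ≠ 0) : ‖ht y‖ = 1 := by
  rw [ht, norm_smul, norm_inv, norm_norm, inv_mul_cancel₀ (norm_ne_zero_iff.2 hy)]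

lemma ht_smul_norm (y : V) : ‖y‖ • ht y = y := by
  by_cases hy : y = 0
  · simp [hy]
  rw [ht, smul_smul, mul_inv_cancel₀ (norm_ne_zero_iff.2 hy), one_smul]

lemma ht_meas : Measurable (ht : V → V) := by unfold ht; fun_prop

lemma ht_smul {t : ℝ} (h : 0 < t) (y : V) : ht (t • y) = ht y := by
  simp only [ht]
  rw [norm_smul, Real.norm_of_nonneg h.le, smul_smul]
  congr 1
  field_simp

lemma ht_unit {y : V} (hy : ‖y‖ = 1) : ht y = y := by simp [ht, hy]

lemma polar0 [Nontrivial V] (H : V → ℝ≥0∞) (hH : Measurable H) :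
    ∫⁻ x, H x = ∫⁻ w : sphere (0:V) 1, ∫⁻ t in Ioi (0:ℝ),
      ENNReal.ofReal (t ^ (finrank ℝ V - 1)) * H (t • (w : V)) ∂volume ∂(Measure.toSphere volume) := by
  have h1 : ∫⁻ x, H x = ∫⁻ x : ({(0:V)}ᶜ : Set V), H (x:V) ∂(Measure.comap Subtype.val volume) := by
    rw [lintegral_subtype_comap (measurableSet_singleton _).compl, restrict_compl_singleton]
  have hmp := Measure.measurePreserving_homeomorphUnitSphereProd (volume : Measure V)
  have h2 : ∫⁻ x : ({(0:V)}ᶜ : Set V), H (x:V) ∂(Measure.comap Subtype.val volume) =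
      ∫⁻ p : sphere (0:V) 1 × Ioi (0:ℝ), H ((p.2 : ℝ) • (p.1 : V))
        ∂((Measure.toSphere volume).prod (Measure.volumeIoiPow (finrank ℝ V - 1))) := by
    rw [← hmp.lintegral_comp_emb (Homeomorph.measurableEmbedding _)]
    congr 1
    ext x
    congr 1
    have := (homeomorphUnitSphereProd V).symm_apply_apply x
    conv_lhs => rw [← this]
    rfl
  have hm : Measurable (fun p : sphere (0:V) 1 × Ioi (0:ℝ) => H ((p.2 : ℝ) • (p.1 : V))) := by fun_prop
  rw [h1, h2, lintegral_prod _ hm.aemeasurable]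
  congr 1
  ext w
  rw [Measure.volumeIoiPow, lintegral_withDensity_eq_lintegral_mul _ (by fun_prop) (by fun_prop)]
  exact lintegral_subtype_comap measurableSet_Ioi (fun t : ℝ => ENNReal.ofReal (t ^ (finrank ℝ V - 1)) * H (t • (w : V)))

lemma polar1 [Nontrivial V] (ψ : V → ℝ≥0∞) (hψ : Measurable ψ) :
    finrank ℝ V * ∫⁻ y in ball (0:V) 1, ψ (ht y) = ∫⁻ w : sphere (0:V) 1, ψ w ∂(Measure.toSphere volume) := by
  have hn : 1 ≤ finrank ℝ V := finrank_pos
  rw [← lintegral_indicator measurableSet_ball,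
    polar0 _ ((show Measurable (fun y => ψ (ht y)) from hψ.comp ht_meas).indicator measurableSet_ball), ← lintegral_const_mul' _ _ (by simp)]
  congr 1
  ext w
  have hw : ‖(w : V)‖ = 1 := by simpa using w.2
  have : ∀ t ∈ Ioi (0:ℝ), ENNReal.ofReal (t ^ (finrank ℝ V - 1)) *
      (ball (0:V) 1).indicator (fun y => ψ (ht y)) (t • (w : V)) =
      (Ioo (0:ℝ) 1).indicator (fun t => ENNReal.ofReal (t ^ (finrank ℝ V - 1)) * ψ w) t := by
    intro t ht0
    have hb : t • (w : V) ∈ ball (0:V) 1 ↔ t ∈ Ioo (0:ℝ) 1 := by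
      rw [mem_ball_zero_iff, norm_smul, hw, mul_one, Real.norm_of_nonneg (le_of_lt ht0)]
      exact ⟨fun h => ⟨ht0, h⟩, fun h => h.2⟩
    by_cases h : t ∈ Ioo (0:ℝ) 1
    · rw [indicator_of_mem h, indicator_of_mem (hb.2 h), ht_smul ht0, ht_unit hw]
    · rw [indicator_of_notMem h, indicator_of_notMem (fun h' => h (hb.1 h')), mul_zero]
  rw [setLIntegral_congr_fun measurableSet_Ioi this, setLIntegral_indicator measurableSet_Ioo,
    inter_eq_self_of_subset_left Ioo_subset_Ioi_self, lintegral_mul_const _ (by fun_prop), ← mul_assoc]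
  have h3 := int_pow hn le_rfl (zero_le_one (α := ℝ))
  have h4 : ∫⁻ t in Ioo (0:ℝ) 1, ENNReal.ofReal (finrank ℝ V * t ^ (finrank ℝ V - 1)) =
      finrank ℝ V * ∫⁻ t in Ioo (0:ℝ) 1, ENNReal.ofReal (t ^ (finrank ℝ V - 1)) := by
    rw [← lintegral_const_mul' _ _ (by simp)]
    congr 1; ext t
    rw [ENNReal.ofReal_mul (by positivity), ENNReal.ofReal_natCast]
  rw [← h4, h3]
  rw [zero_pow (by omega)]; simp

lemma polar [Nontrivial V] (H : V → ℝ≥0∞) (hH : Measurable H) :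
    ∫⁻ x, H x = ∫⁻ y in ball (0:V) 1, ∫⁻ t in Ioi (0:ℝ),
      ENNReal.ofReal (finrank ℝ V * t ^ (finrank ℝ V - 1)) * H (t • ht y) := by
  have hm : Measurable (fun y : V => ∫⁻ t in Ioi (0:ℝ), ENNReal.ofReal (t ^ (finrank ℝ V - 1)) * H (t • y)) := by
    apply Measurable.lintegral_prod_right' (f := fun p : V × ℝ => ENNReal.ofReal (p.2 ^ (finrank ℝ V - 1)) * H (p.2 • p.1))
    fun_prop
  rw [polar0 H hH, ← polar1 _ hm, ← lintegral_const_mul' _ _ (by simp)]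
  congr 1; ext y
  rw [← lintegral_const_mul' _ _ (by simp)]
  congr 1; ext t
  rw [ENNReal.ofReal_mul (by positivity), ENNReal.ofReal_natCast, mul_assoc]

end
end Mf

namespace Mf
open InnerProductSpace Module TopologicalSpace
section
variable {V : Type*} [NormedAddCommGroup V] [InnerProductSpace ℝ V] [FiniteDimensional ℝ V]
  [MeasurableSpace V] [BorelSpace V]

/-- radial function -/
def rad (A : Set V) (x : V) : ℝ := ‖x‖ / gauge A x

variable {A : Set V} {a b : ℝ}

lemma gauge_up (ha : 0 < a) (h1 : ball (0:V) a ⊆ A) (x : V) : gauge A x ≤ ‖x‖ / a := by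
  have := gauge_mono (absorbent_ball_zero ha) h1 x
  rwa [gauge_ball ha.le] at this

lemma gauge_dn (ha : 0 < a) (h1 : ball (0:V) a ⊆ A) (hb : 0 < b) (h2 : A ⊆ ball (0:V) b) (x : V) :
    ‖x‖ / b ≤ gauge A x := by
  have := gauge_mono ((absorbent_ball_zero ha).mono h1) h2 x
  rwa [gauge_ball hb.le] at this

lemma gauge_pos' (ha : 0 < a) (h1 : ball (0:V) a ⊆ A) (hb : 0 < b) (h2 : A ⊆ ball (0:V) b) {x : V}
    (hx : x ≠ 0) : 0 < gauge A x :=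
  lt_of_lt_of_le (by have := norm_pos_iff.2 hx; positivity) (gauge_dn ha h1 hb h2 x)

lemma rad_lb (ha : 0 < a) (h1 : ball (0:V) a ⊆ A) (hb : 0 < b) (h2 : A ⊆ ball (0:V) b) {x : V}
    (hx : x ≠ 0) : a ≤ rad A x := by
  have g := gauge_pos' ha h1 hb h2 hx
  have := gauge_up ha h1 x
  rw [le_div_iff₀ ha] at this
  rw [rad, le_div_iff₀ g]; linarith

lemma rad_ub (ha : 0 < a) (h1 : ball (0:V) a ⊆ A) (hb : 0 < b) (h2 : A ⊆ ball (0:V) b) (x : V) :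
    rad A x ≤ b := by
  by_cases hx : x = 0
  · simp [hx, rad, hb.le]
  have g := gauge_pos' ha h1 hb h2 hx
  have := gauge_dn ha h1 hb h2 x
  rw [div_le_iff₀ hb] at this
  rw [rad, div_le_iff₀ g]; linarith

lemma rad_nonneg (x : V) : 0 ≤ rad A x := div_nonneg (norm_nonneg _) (gauge_nonneg _)

lemma rad_smul {t : ℝ} (ht0 : 0 < t) (x : V) : rad A (t • x) = rad A x := by
  rw [rad, rad, norm_smul, gauge_smul_of_nonneg ht0.le, Real.norm_of_nonneg ht0.le, smul_eq_mul,
    mul_div_mul_left _ _ ht0.ne']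

lemma rad_ht {x : V} (hx : x ≠ 0) : rad A (ht x) = rad A x :=
  rad_smul (inv_pos.2 (norm_pos_iff.2 hx)) x

lemma ht_ne {x : V} (hx : x ≠ 0) : ht x ≠ 0 := by
  intro h; have := ht_norm hx; rw [h] at this; simp at this

lemma mem_iff_gauge (hA : IsOpen A) (hc : Convex ℝ A) (ha : 0 < a) (h1 : ball (0:V) a ⊆ A) (x : V) :
    x ∈ A ↔ gauge A x < 1 := by
  have := gauge_lt_one_eq_self_of_isOpen hc (h1 (mem_ball_self ha)) hA
  conv_lhs => rw [← this]
  rfl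

lemma mem_iff_rad (hA : IsOpen A) (hc : Convex ℝ A) (ha : 0 < a) (h1 : ball (0:V) a ⊆ A) (hb : 0 < b)
    (h2 : A ⊆ ball (0:V) b) {x : V} (hx : x ≠ 0) {t : ℝ} (ht0 : 0 < t) :
    t • ht x ∈ A ↔ t < rad A x := by
  rw [mem_iff_gauge hA hc ha h1, gauge_smul_of_nonneg ht0.le, ← rad_ht hx, rad, ht_norm hx, smul_eq_mul,
    lt_div_iff₀ (gauge_pos' ha h1 hb h2 (ht_ne hx))]

lemma rad_meas (hc : Convex ℝ A) (ha : 0 < a) (h1 : ball (0:V) a ⊆ A) : Measurable (rad A) := by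
  have : Continuous (gauge A) := continuous_gauge hc (mem_of_superset (ball_mem_nhds _ ha) h1)
  unfold rad
  exact (measurable_norm).div this.measurable

lemma ae_ne0 [Nontrivial V] (s : Set V) : ∀ᵐ y ∂(volume.restrict s), y ≠ (0:V) :=
  ae_restrict_of_ae (compl_mem_ae_iff.2 (measure_singleton _))

/-- polar integration over a set given radially -/
lemma polarS [Nontrivial V] {S : Set V} (hS : MeasurableSet S) (p q : V → ℝ) (hp : ∀ x, 0 ≤ p x)
    (hpq : ∀ x, x ≠ 0 → ∀ t, 0 < t → (t • ht x ∈ S ↔ t ∈ Ico (p x) (q x)))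
    (H : V → ℝ≥0∞) (hH : Measurable H) :
    ∫⁻ x in S, H x = ∫⁻ y in ball (0:V) 1, ∫⁻ t in Ioo (p y) (q y),
      ENNReal.ofReal (finrank ℝ V * t ^ (finrank ℝ V - 1)) * H (t • ht y) := by
  rw [← lintegral_indicator hS, polar _ (hH.indicator hS)]
  apply lintegral_congr_ae
  filter_upwards [ae_ne0 (ball (0:V) 1)] with y hy
  have : ∀ t ∈ Ioi (0:ℝ), ENNReal.ofReal (finrank ℝ V * t ^ (finrank ℝ V - 1)) * S.indicator H (t • ht y) =
      (Ico (p y) (q y)).indicator (fun t => ENNReal.ofReal (finrank ℝ V * t ^ (finrank ℝ V - 1)) * H (t • ht y)) t := by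
    intro t ht0
    have hb := hpq y hy t ht0
    by_cases h : t ∈ Ico (p y) (q y)
    · rw [indicator_of_mem h, indicator_of_mem (hb.2 h)]
    · rw [indicator_of_notMem h, indicator_of_notMem (fun h' => h (hb.1 h')), mul_zero]
  rw [setLIntegral_congr_fun measurableSet_Ioi this, setLIntegral_indicator measurableSet_Ico]
  have e : (Ico (p y) (q y) ∩ Ioi 0 : Set ℝ) =ᵐ[volume] Ioo (p y) (q y) := by
    have e1 : (Ico (p y) (q y) ∩ Ioi 0 : Set ℝ) =ᵐ[volume] (Ioo (p y) (q y) ∩ Ioi 0 : Set ℝ) :=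
      Ioo_ae_eq_Ico.symm.inter (ae_eq_refl _)
    have e2 : (Ioo (p y) (q y) ∩ Ioi 0 : Set ℝ) = Ioo (p y) (q y) :=
      inter_eq_self_of_subset_left (fun t h => lt_of_le_of_lt (hp y) h.1)
    rwa [e2] at e1
  rw [Measure.restrict_congr_set e]

lemma int_pow' {n : ℕ} (hn : 1 ≤ n) {a b : ℝ} (ha : 0 ≤ a) (hb : 0 ≤ b) :
    ∫⁻ t in Ioo a b, ENNReal.ofReal (n * t ^ (n - 1)) = ENNReal.ofReal (b ^ n - a ^ n) := by
  rcases le_total a b with h | h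
  · exact int_pow hn ha h
  · rw [Ioo_eq_empty (not_lt.2 h)]
    simp only [Measure.restrict_empty, lintegral_zero_measure]
    rw [ENNReal.ofReal_of_nonpos]
    have := pow_le_pow_left₀ hb h n
    linarith

lemma volS [Nontrivial V] {S : Set V} (hS : MeasurableSet S) (p q : V → ℝ) (hp : ∀ x, 0 ≤ p x) (hq : ∀ x, 0 ≤ q x)
    (hpq : ∀ x, x ≠ 0 → ∀ t, 0 < t → (t • ht x ∈ S ↔ t ∈ Ico (p x) (q x))) :
    volume S = ∫⁻ y in ball (0:V) 1, ENNReal.ofReal (q y ^ finrank ℝ V - p y ^ finrank ℝ V) := by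
  have h := polarS hS p q hp hpq (fun _ => 1) measurable_const
  simp only [lintegral_const, one_mul, Measure.restrict_apply_univ, mul_one] at h
  rw [h]
  congr 1; ext y
  exact int_pow' finrank_pos (hp y) (hq y)

end
end Mf

namespace Mf
open InnerProductSpace Module TopologicalSpace
section
variable {V : Type*} [NormedAddCommGroup V] [InnerProductSpace ℝ V] [FiniteDimensional ℝ V]
  [MeasurableSpace V] [BorelSpace V]
variable {A : Set V} {a b ρ : ℝ}

/-- power of the radial function -/
def ff (A : Set V) (x : V) : ℝ := rad A x ^ finrank ℝ V

lemma ff_nonneg (x : V) : 0 ≤ ff A x := pow_nonneg (rad_nonneg x) _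

lemma ff_meas (hc : Convex ℝ A) (ha : 0 < a) (h1 : ball (0:V) a ⊆ A) : Measurable (ff A) :=
  (rad_meas hc ha h1).pow_const _

lemma ff_ub (ha : 0 < a) (h1 : ball (0:V) a ⊆ A) (hb : 0 < b) (h2 : A ⊆ ball (0:V) b) (x : V) :
    ff A x ≤ b ^ finrank ℝ V := pow_le_pow_left₀ (rad_nonneg x) (rad_ub ha h1 hb h2 x) _

lemma vol_ff [Nontrivial V] (hA : IsOpen A) (hc : Convex ℝ A) (ha : 0 < a) (h1 : ball (0:V) a ⊆ A) (hb : 0 < b)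
    (h2 : A ⊆ ball (0:V) b) : volume A = ∫⁻ y in ball (0:V) 1, ENNReal.ofReal (ff A y) := by
  rw [volS hA.measurableSet (fun _ => 0) (rad A) (fun _ => le_rfl) (fun x => rad_nonneg x)]
  · simp only [zero_pow (finrank_pos (R := ℝ) (M := V)).ne', sub_zero]; rfl
  · intro x hx t ht0
    rw [mem_iff_rad hA hc ha h1 hb h2 hx ht0]
    exact ⟨fun h => ⟨ht0.le, h⟩, fun h => h.2⟩

lemma ball_iff {x : V} (hx : x ≠ 0) {t : ℝ} (ht0 : 0 < t) : t • ht x ∈ ball (0:V) ρ ↔ t < ρ := by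
  rw [mem_ball_zero_iff, norm_smul, ht_norm hx, mul_one, Real.norm_of_nonneg ht0.le]

lemma AB_iff (hA : IsOpen A) (hc : Convex ℝ A) (ha : 0 < a) (h1 : ball (0:V) a ⊆ A) (hb : 0 < b)
    (h2 : A ⊆ ball (0:V) b) (x : V) (hx : x ≠ 0) (t : ℝ) (ht0 : 0 < t) :
    t • ht x ∈ A \ ball (0:V) ρ ↔ t ∈ Ico ρ (rad A x) := by
  rw [mem_diff, ball_iff hx ht0, mem_iff_rad hA hc ha h1 hb h2 hx ht0, mem_Ico]
  constructor <;> rintro ⟨h, h'⟩ <;> constructor <;> linarith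

lemma BA_iff (hA : IsOpen A) (hc : Convex ℝ A) (ha : 0 < a) (h1 : ball (0:V) a ⊆ A) (hb : 0 < b)
    (h2 : A ⊆ ball (0:V) b) (x : V) (hx : x ≠ 0) (t : ℝ) (ht0 : 0 < t) :
    t • ht x ∈ ball (0:V) ρ \ A ↔ t ∈ Ico (rad A x) ρ := by
  rw [mem_diff, ball_iff hx ht0, mem_iff_rad hA hc ha h1 hb h2 hx ht0, mem_Ico]
  constructor <;> rintro ⟨h, h'⟩ <;> constructor <;> linarith

lemma vol_sd [Nontrivial V] (hA : IsOpen A) (hc : Convex ℝ A) (ha : 0 < a) (h1 : ball (0:V) a ⊆ A) (hb : 0 < b)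
    (h2 : A ⊆ ball (0:V) b) (hρ : 0 < ρ) :
    volume (A \ ball (0:V) ρ) + volume (ball (0:V) ρ \ A) =
      ∫⁻ y in ball (0:V) 1, ENNReal.ofReal |ff A y - ρ ^ finrank ℝ V| := by
  rw [volS (hA.measurableSet.diff measurableSet_ball) (fun _ => ρ) (rad A) (fun _ => hρ.le) (fun x => rad_nonneg x)
      (AB_iff hA hc ha h1 hb h2),
    volS (measurableSet_ball.diff hA.measurableSet) (rad A) (fun _ => ρ) (fun x => rad_nonneg x) (fun _ => hρ.le)
      (BA_iff hA hc ha h1 hb h2), ← lintegral_add_left]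
  · congr 1; ext y
    change ENNReal.ofReal (ff A y - _) + ENNReal.ofReal (_ - ff A y) = _
    rcases le_total (ff A y) (ρ ^ finrank ℝ V) with h | h
    · rw [ENNReal.ofReal_of_nonpos (by linarith), zero_add, abs_of_nonpos (by linarith)]; congr 1; ring
    · rw [ENNReal.ofReal_of_nonpos (p := ρ ^ finrank ℝ V - _) (by linarith), add_zero, abs_of_nonneg (by linarith)]
  · have := rad_meas hc ha h1
    fun_prop

/-- weighted symmetric difference with centered ball -/
def Wd (E : Set V) (R : ℝ) : ℝ≥0∞ :=
  (∫⁻ x in E \ ball (0:V) R, ENNReal.ofReal (‖x‖ - R)) + ∫⁻ x in ball (0:V) R \ E, ENNReal.ofReal (R - ‖x‖)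

lemma W_le [Nontrivial V] (hA : IsOpen A) (hc : Convex ℝ A) (ha : 0 < a) (h1 : ball (0:V) a ⊆ A) (hb : 0 < b)
    (h2 : A ⊆ ball (0:V) b) (hρ : 0 < ρ) :
    Wd A ρ ≤ ENNReal.ofReal ((ρ ^ (finrank ℝ V - 1))⁻¹) *
      ∫⁻ y in ball (0:V) 1, ENNReal.ofReal ((ff A y - ρ ^ finrank ℝ V) ^ 2) := by
  have hn : 1 ≤ finrank ℝ V := finrank_pos
  obtain ⟨n, hnn⟩ : ∃ n, finrank ℝ V = n + 1 := ⟨finrank ℝ V - 1, by omega⟩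
  rw [Wd, polarS (hA.measurableSet.diff measurableSet_ball) (fun _ => ρ) (rad A) (fun _ => hρ.le)
      (AB_iff hA hc ha h1 hb h2) _ (by fun_prop),
    polarS (measurableSet_ball.diff hA.measurableSet) (rad A) (fun _ => ρ) (fun x => rad_nonneg x)
      (BA_iff hA hc ha h1 hb h2) _ (by fun_prop), ← lintegral_const_mul' _ _ (by simp)]
  have hrm := rad_meas hc ha h1
  have i1 : ∀ y : V, y ≠ 0 → ∫⁻ t in Ioo ρ (rad A y), ENNReal.ofReal (finrank ℝ V * t ^ (finrank ℝ V - 1)) *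
      ENNReal.ofReal (‖t • ht y‖ - ρ) ≤ ENNReal.ofReal (rad A y - ρ) * ENNReal.ofReal (ff A y - ρ ^ finrank ℝ V) := by
    intro y hy
    rw [ff, ← int_pow' hn hρ.le (rad_nonneg y), ← lintegral_const_mul' _ _ (by simp)]
    apply setLIntegral_mono (by fun_prop)
    intro t htt
    rw [mul_comm]
    gcongr
    rw [norm_smul, ht_norm hy, mul_one, Real.norm_of_nonneg (hρ.le.trans htt.1.le)]
    exact htt.2.le
  have i2 : ∀ y : V, y ≠ 0 → ∫⁻ t in Ioo (rad A y) ρ, ENNReal.ofReal (finrank ℝ V * t ^ (finrank ℝ V - 1)) *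
      ENNReal.ofReal (ρ - ‖t • ht y‖) ≤ ENNReal.ofReal (ρ - rad A y) * ENNReal.ofReal (ρ ^ finrank ℝ V - ff A y) := by
    intro y hy
    rw [ff, ← int_pow' hn (rad_nonneg y) hρ.le, ← lintegral_const_mul' _ _ (by simp)]
    apply setLIntegral_mono (by fun_prop)
    intro t htt
    rw [mul_comm]
    gcongr
    rw [norm_smul, ht_norm hy, mul_one, Real.norm_of_nonneg ((rad_nonneg y).trans htt.1.le)]
    exact htt.1.le
  have fm := ff_meas hc ha h1
  calc _ ≤ (∫⁻ y in ball (0:V) 1, ENNReal.ofReal (rad A y - ρ) * ENNReal.ofReal (ff A y - ρ ^ finrank ℝ V)) +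
        ∫⁻ y in ball (0:V) 1, ENNReal.ofReal (ρ - rad A y) * ENNReal.ofReal (ρ ^ finrank ℝ V - ff A y) := by
        refine add_le_add (lintegral_mono_ae ?_) (lintegral_mono_ae ?_)
        · filter_upwards [ae_ne0 (ball (0:V) 1)] with y hy using i1 y hy
        · filter_upwards [ae_ne0 (ball (0:V) 1)] with y hy using i2 y hy
    _ ≤ _ := by
        rw [← lintegral_add_left (by fun_prop)]
        apply lintegral_mono
        intro y
        simp only
        have hq := rad_nonneg (A := A) y
        rw [ff, hnn]
        simp only [Nat.add_sub_cancel]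
        set q := rad A y
        rcases le_total q ρ with h | h
        · rw [ENNReal.ofReal_of_nonpos (p := q - ρ) (by linarith), zero_mul, zero_add,
            ← ENNReal.ofReal_mul (by linarith), ← ENNReal.ofReal_mul (by positivity)]
          apply ENNReal.ofReal_le_ofReal
          rw [inv_mul_eq_div, le_div_iff₀ (by positivity)]
          have h3 : q ^ n ≤ ρ ^ n := pow_le_pow_left₀ hq h n
          have h4 : q ^ (n+1) ≤ q * ρ ^ n := by rw [pow_succ']; gcongr
          have h5 : q ^ (n+1) ≤ ρ ^ (n+1) := pow_le_pow_left₀ hq h _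
          have h6 : (ρ - q) * ρ ^ n ≤ ρ ^ (n+1) - q^(n+1) := by rw [pow_succ' ρ]; linarith
          nlinarith
        · rw [ENNReal.ofReal_of_nonpos (p := ρ - q) (by linarith), zero_mul, add_zero,
            ← ENNReal.ofReal_mul (by linarith), ← ENNReal.ofReal_mul (by positivity)]
          apply ENNReal.ofReal_le_ofReal
          rw [inv_mul_eq_div, le_div_iff₀ (by positivity)]
          have h3 : ρ ^ n ≤ q ^ n := pow_le_pow_left₀ hρ.le h n
          have h4 : q * ρ ^ n ≤ q ^ (n+1) := by rw [pow_succ']; gcongr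
          have h5 : ρ ^ (n+1) ≤ q ^ (n+1) := pow_le_pow_left₀ hρ.le h _
          have h6 : (q - ρ) * ρ ^ n ≤ q ^ (n+1) - ρ^(n+1) := by rw [pow_succ' ρ]; linarith
          nlinarith

lemma pow_mid {q q' : ℝ} (h : 0 ≤ q) (h' : 0 ≤ q') (n : ℕ) : ((q + q') / 2) ^ n ≤ (q ^ n + q' ^ n) / 2 := by
  have := (convexOn_pow n).2 (show q ∈ Ici (0:ℝ) from h) (show q' ∈ Ici (0:ℝ) from h')
    (show (0:ℝ) ≤ 1/2 by norm_num) (show (0:ℝ) ≤ 1/2 by norm_num) (by norm_num)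
  simp only [smul_eq_mul] at this
  calc _ = (1 / 2 * q + 1 / 2 * q') ^ n := by ring
    _ ≤ _ := this
    _ = _ := by ring

lemma pow_diff {q q' b : ℝ} (h' : 0 ≤ q') (h : q' ≤ q) (hb : q ≤ b) (n : ℕ) (hn : 1 ≤ n) :
    q ^ n - q' ^ n ≤ n * b ^ (n-1) * (q - q') := by
  rw [← Commute.geom_sum₂_mul (Commute.all q q') n]
  apply mul_le_mul_of_nonneg_right _ (by linarith)
  calc _ ≤ ∑ i ∈ Finset.range n, b ^ (n-1) := by
        apply Finset.sum_le_sum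
        intro i hi
        rw [Finset.mem_range] at hi
        have : n - 1 = i + (n - 1 - i) := by omega
        conv_rhs => rw [this, pow_add]
        have hb0 : 0 ≤ b := by linarith
        gcongr <;> linarith
    _ = _ := by simp

lemma theta_lb [Nontrivial V] (hA : IsOpen A) (hc : Convex ℝ A) (ha : 0 < a) (h1 : ball (0:V) a ⊆ A) (hb : 0 < b)
    (h2 : A ⊆ ball (0:V) b) {u : V} (η : ℝ) :
    ∫⁻ y in ball (0:V) 1, {x : V | η * ‖x‖ ≤ |inner ℝ x u|}.indicator
        (fun y => ENNReal.ofReal ((max (ff A y - ff A (sg u y)) 0) ^ 2)) y ≤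
      ENNReal.ofReal (4 * finrank ℝ V * b ^ finrank ℝ V) *
      ∫⁻ x in A, {x : V | η * ‖x‖ ≤ |inner ℝ x u|}.indicator
        (fun x => ENNReal.ofReal (gauge A (sg u x) - 1)) x := by
  have hn : 1 ≤ finrank ℝ V := finrank_pos
  have hgc : Continuous (gauge A) := continuous_gauge hc (mem_of_superset (ball_mem_nhds _ ha) h1)
  have hCm : MeasurableSet {x : V | η * ‖x‖ ≤ |inner ℝ x u|} :=
    measurableSet_le (by fun_prop) (by fun_prop)
  have hHm : Measurable ({x : V | η * ‖x‖ ≤ |inner ℝ x u|}.indicator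
        (fun x => ENNReal.ofReal (gauge A (sg u x) - 1))) := by
    apply Measurable.indicator _ hCm
    have : Continuous (fun x => gauge A (sg u x)) := hgc.comp (sg u).continuous
    exact (this.measurable.sub_const 1).ennreal_ofReal
  rw [polarS hA.measurableSet (fun _ => 0) (rad A) (fun _ => le_rfl) (fun x hx t ht0 => by
    rw [mem_iff_rad hA hc ha h1 hb h2 hx ht0]
    exact ⟨fun h => ⟨ht0.le, h⟩, fun h => h.2⟩) _ hHm, ← lintegral_const_mul' _ _ ENNReal.ofReal_ne_top]
  apply lintegral_mono_ae
  filter_upwards [ae_ne0 (ball (0:V) 1)] with y hy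
  by_cases hC : y ∈ {x : V | η * ‖x‖ ≤ |inner ℝ x u|}
  swap
  · rw [indicator_of_notMem hC]; exact zero_le
  rw [indicator_of_mem hC]
  have hσy : sg u y ≠ 0 := by
    intro h; exact hy (by simpa using congrArg (sg u) h)
  set q := rad A y with hq
  set q' := rad A (sg u y) with hq'
  rcases le_total q q' with hle | hle
  · have : ff A y - ff A (sg u y) ≤ 0 := by
      have := pow_le_pow_left₀ (rad_nonneg y) hle (finrank ℝ V)
      simp only [ff]; linarith
    rw [max_eq_right this]; simp
  have hq0 : 0 < q' := lt_of_lt_of_le ha (rad_lb ha h1 hb h2 hσy)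
  have hqb : q ≤ b := rad_ub ha h1 hb h2 y
  have hmono : Ioo ((q+q')/2) q ⊆ Ioo 0 q := Ioo_subset_Ioo_left (by linarith)
  have hg : gauge A (sg u (ht y)) = 1 / q' := by
    have : ht y = ‖y‖⁻¹ • y := rfl
    rw [this, map_smul, gauge_smul_of_nonneg (by positivity), hq', rad, (sg u).norm_map, smul_eq_mul]
    field_simp
  have key : ENNReal.ofReal ((q - q') / (2 * b)) * ENNReal.ofReal (q ^ finrank ℝ V - ((q+q')/2) ^ finrank ℝ V) ≤
      ∫⁻ t in Ioo 0 q, ENNReal.ofReal (finrank ℝ V * t ^ (finrank ℝ V - 1)) *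
        {x : V | η * ‖x‖ ≤ |inner ℝ x u|}.indicator
        (fun x => ENNReal.ofReal (gauge A (sg u x) - 1)) (t • ht y) := by
    refine le_trans ?_ (lintegral_mono_set hmono)
    rw [← int_pow' hn (by linarith) (by linarith), ← lintegral_const_mul' _ _ (by simp)]
    apply setLIntegral_mono' measurableSet_Ioo
    intro t htt
    have ht0 : 0 < t := by linarith [htt.1]
    have hm : t • ht y ∈ {x : V | η * ‖x‖ ≤ |inner ℝ x u|} := by
      simp only [mem_setOf_eq] at hC ⊢
      rw [ht, smul_smul, norm_smul, inner_smul_left, abs_mul]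
      have : 0 < t * ‖y‖⁻¹ := by have := norm_pos_iff.2 hy; positivity
      simp only [conj_trivial]
      rw [Real.norm_of_nonneg this.le, abs_of_pos this]
      nlinarith
    rw [indicator_of_mem hm, mul_comm]
    gcongr
    rw [map_smul, gauge_smul_of_nonneg ht0.le, hg, smul_eq_mul]
    rw [div_le_iff₀ (by positivity)]
    have e : t * (1/q') - 1 = (t - q') / q' := by field_simp
    rw [e, div_mul_eq_mul_div, le_div_iff₀ hq0]
    nlinarith [htt.1]
  refine le_trans ?_ (mul_le_mul_right key _)
  have hd : q' ^ finrank ℝ V ≤ q ^ finrank ℝ V := pow_le_pow_left₀ hq0.le hle _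
  have hpm := pow_mid (hq0.le.trans hle) hq0.le (finrank ℝ V)
  have hpd := pow_diff hq0.le hle hqb (finrank ℝ V) hn
  rw [← ENNReal.ofReal_mul (by apply div_nonneg <;> linarith), ← ENNReal.ofReal_mul (by positivity)]
  apply ENNReal.ofReal_le_ofReal
  have e1 : ff A y - ff A (sg u y) = q ^ finrank ℝ V - q' ^ finrank ℝ V := rfl
  rw [e1, max_eq_left (by linarith)]
  have e2 : b ^ finrank ℝ V = b * b ^ (finrank ℝ V - 1) := by
    rw [← pow_succ']; congr 1; omega
  have e3 : 4 * (finrank ℝ V : ℝ) * b ^ finrank ℝ V * ((q - q') / (2 * b) * (q ^ finrank ℝ V - ((q + q') / 2) ^ finrank ℝ V))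
      = (finrank ℝ V * b ^ (finrank ℝ V - 1) * (q - q')) * (2 * (q ^ finrank ℝ V - ((q + q') / 2) ^ finrank ℝ V)) := by
    rw [e2]; field_simp; ring
  rw [e3, sq]
  apply mul_le_mul hpd (by linarith) (by linarith)
  have : 0 ≤ q - q' := by linarith
  positivity

end
end Mf

namespace Mf
open InnerProductSpace Module TopologicalSpace

lemma int_sq_le {X : Type*} [MeasurableSpace X] (μ : Measure X) [IsFiniteMeasure μ] {g : X → ℝ}
    (hg : Measurable g) {M : ℝ} (hM : ∀ x, |g x| ≤ M) :
    (∫ x, g x ∂μ) ^ 2 ≤ (μ univ).toReal * ∫ x, g x ^ 2 ∂μ := by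
  have i1 : Integrable g μ := Integrable.of_bound hg.aestronglyMeasurable M (Eventually.of_forall hM)
  have i2 : Integrable (fun x => g x ^ 2) μ := Integrable.of_bound (hg.pow_const 2).aestronglyMeasurable (M^2)
    (Eventually.of_forall (fun x => by
      rw [Real.norm_of_nonneg (sq_nonneg _), ← sq_abs]; exact pow_le_pow_left₀ (abs_nonneg _) (hM x) 2))
  set s := ∫ x, g x ∂μ
  set v := (μ univ).toReal with hv
  have h := integral_nonneg (μ := μ) (f := fun x => (v * g x - s)^2) (fun x => sq_nonneg _)
  have e : ∫ x, (v * g x - s)^2 ∂μ = v^2 * ∫ x, g x ^ 2 ∂μ - 2 * v * s * s + s^2 * v := by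
    have : ∀ x, (v * g x - s)^2 = v^2 * g x ^ 2 - 2 * v * s * g x + s^2 := fun x => by ring
    simp_rw [this]
    have i5 : Integrable (fun x => v^2 * g x ^ 2 - 2 * v * s * g x) μ := (i2.const_mul _).sub (i1.const_mul _)
    rw [integral_add i5 (integrable_const _),
      integral_sub (i2.const_mul _) (i1.const_mul _), integral_const_mul, integral_const_mul, integral_const]
    simp only [Measure.real, smul_eq_mul, ← hv]
    ring
  rw [e] at h
  have hv0 : 0 ≤ v := ENNReal.toReal_nonneg
  rcases hv0.eq_or_lt with h0 | h0
  · have : μ = 0 := by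
      rw [← Measure.measure_univ_eq_zero]
      rw [hv, eq_comm, ENNReal.toReal_eq_zero_iff] at h0
      simpa [measure_ne_top] using h0
    simp [s, this]
  · nlinarith

lemma wmean {X : Type*} [MeasurableSpace X] (μ : Measure X) [IsFiniteMeasure μ] {l b : X → ℝ}
    (hl : Measurable l) (hb : Measurable b) {L M : ℝ} (hL : ∀ x, |l x| ≤ L) (hM : ∀ x, |b x| ≤ M) :
    ENNReal.ofReal ((∫ x, l x ∂μ) ^ 2) * ∫⁻ x, ENNReal.ofReal (b x ^ 2) ∂μ ≤
      ENNReal.ofReal (2 * L ^ 2) * μ univ * (∫⁻ x, ∫⁻ y, ENNReal.ofReal ((b y - b x) ^ 2) ∂μ ∂μ) +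
      ENNReal.ofReal (2 * (∫ x, l x * b x ∂μ) ^ 2) * μ univ := by
  have hL0 : ∀ x : X, 0 ≤ L := fun x => (abs_nonneg _).trans (hL x)
  have hM0 : ∀ x : X, 0 ≤ M := fun x => (abs_nonneg _).trans (hM x)
  have key : ∀ x, ENNReal.ofReal ((∫ x, l x ∂μ) ^ 2) * ENNReal.ofReal (b x ^ 2) ≤
      ENNReal.ofReal (2 * L ^ 2) * μ univ * (∫⁻ y, ENNReal.ofReal ((b y - b x) ^ 2) ∂μ) +
      ENNReal.ofReal (2 * (∫ x, l x * b x ∂μ) ^ 2) := by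
    intro x
    have bd : ∀ y, |b y - b x| ≤ 2 * M := fun y => (abs_sub _ _).trans (by linarith [hM x, hM y])
    have bl : ∀ y, |l y * (b y - b x)| ≤ L * (2 * M) := fun y => by
      rw [abs_mul]; exact mul_le_mul (hL y) (bd y) (abs_nonneg _) (hL0 y)
    have i1 : Integrable l μ := Integrable.of_bound hl.aestronglyMeasurable L (Eventually.of_forall hL)
    have i2 : Integrable (fun y => l y * b y) μ := Integrable.of_bound (hl.mul hb).aestronglyMeasurable (L * M)
      (Eventually.of_forall (fun y => by
        rw [Real.norm_eq_abs, abs_mul]; exact mul_le_mul (hL y) (hM y) (abs_nonneg _) (hL0 y)))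
    have i3 : Integrable (fun y => (b y - b x) ^ 2) μ := Integrable.of_bound
      ((hb.sub_const _).pow_const 2).aestronglyMeasurable ((2 * M)^2) (Eventually.of_forall (fun y => by
        rw [Real.norm_of_nonneg (sq_nonneg _), ← sq_abs]; exact pow_le_pow_left₀ (abs_nonneg _) (bd y) 2))
    have e1 : ∫ y, l y * (b y - b x) ∂μ = (∫ y, l y * b y ∂μ) - (∫ y, l y ∂μ) * b x := by
      rw [← integral_mul_const, ← integral_sub i2 (i1.mul_const _)]
      congr 1; ext y; ring
    have e2 := int_sq_le μ (g := fun y => l y * (b y - b x)) (by fun_prop) bl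
    have e3 : ∫ y, (l y * (b y - b x)) ^ 2 ∂μ ≤ L ^ 2 * ∫ y, (b y - b x)^2 ∂μ := by
      rw [← integral_const_mul]
      apply integral_mono_of_nonneg (Eventually.of_forall (fun y => sq_nonneg _)) (i3.const_mul _)
      refine Eventually.of_forall (fun y => ?_)
      simp only
      rw [mul_pow]
      apply mul_le_mul_of_nonneg_right _ (sq_nonneg _)
      rw [← sq_abs]; exact pow_le_pow_left₀ (abs_nonneg _) (hL y) 2
    have e4 : ((∫ y, l y ∂μ) * b x)^2 ≤ 2 * L^2 * (μ univ).toReal * (∫ y, (b y - b x)^2 ∂μ) +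
        2 * (∫ y, l y * b y ∂μ)^2 := by
      have := mul_le_mul_of_nonneg_left e3 (ENNReal.toReal_nonneg (a := μ univ))
      rw [e1] at e2
      nlinarith [sq_nonneg (2 * (∫ y, l y * b y ∂μ) - (∫ y, l y ∂μ) * b x)]
    rw [← ofReal_integral_eq_lintegral_ofReal i3 (Eventually.of_forall (fun y => sq_nonneg _)),
      ← ENNReal.ofReal_toReal (measure_ne_top μ univ), ← ENNReal.ofReal_mul (by positivity),
      ← ENNReal.ofReal_mul (by positivity), ← ENNReal.ofReal_mul (by positivity), ← ENNReal.ofReal_add _ (by positivity)]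
    · apply ENNReal.ofReal_le_ofReal; rw [← mul_pow]; exact e4
    · exact mul_nonneg (by positivity) (integral_nonneg (fun y => sq_nonneg _))
  rw [← lintegral_const_mul' _ _ (by simp)]
  refine (lintegral_mono key).trans ?_
  rw [lintegral_add_right _ measurable_const, lintegral_const, lintegral_const_mul']
  exact ENNReal.mul_ne_top ENNReal.ofReal_ne_top (measure_ne_top _ _)

section
variable {V : Type*} [NormedAddCommGroup V] [InnerProductSpace ℝ V] [FiniteDimensional ℝ V]
  [MeasurableSpace V] [BorelSpace V]
variable {A : Set V} {a b ρ : ℝ}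

lemma hi_meas {u : V} (hu : ‖u‖ = 1) (hA : IsOpen A) (hb : IsBounded A) : Measurable (hi u A) := by
  apply measurable_of_Ioi
  intro s
  have ho : IsOpen {k : V | ∃ t, s < t ∧ k + t • u ∈ A} := by
    have : {k : V | ∃ t, s < t ∧ k + t • u ∈ A} = ⋃ t ∈ Ioi s, (fun k : V => k + t • u) ⁻¹' A := by
      ext k; simp
    rw [this]
    exact isOpen_biUnion (fun t _ => hA.preimage (by fun_prop))
  have ho2 : IsOpen {k : V | (fib u A k).Nonempty} := by
    have : {k : V | (fib u A k).Nonempty} = ⋃ t : ℝ, (fun k : V => k + t • u) ⁻¹' A := by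
      ext k; simp [Set.Nonempty, mem_fib]
    rw [this]
    exact isOpen_iUnion (fun t => hA.preimage (by fun_prop))
  have e : hi u A ⁻¹' Ioi s = {k : V | ∃ t, s < t ∧ k + t • u ∈ A} ∪ ({k : V | (fib u A k).Nonempty}ᶜ ∩ {_k : V | s < 0}) := by
    ext k
    simp only [mem_preimage, mem_Ioi, mem_union, mem_setOf_eq, mem_inter_iff, mem_compl_iff]
    by_cases hne : (fib u A k).Nonempty
    · simp only [hne, not_true, false_and, or_false]
      rw [hi, lt_csSup_iff (fib_bddAbove hu hb k) hne]
      exact ⟨fun ⟨t, h1, h2⟩ => ⟨t, h2, h1⟩, fun ⟨t, h1, h2⟩ => ⟨t, h2, h1⟩⟩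
    · simp only [hne, not_false_eq_true, true_and]
      have h0 : hi u A k = 0 := by rw [hi, not_nonempty_iff_eq_empty.1 hne, Real.sSup_empty]
      rw [h0]
      constructor
      · exact fun h => Or.inr h
      · rintro (⟨t, _, h⟩ | h)
        · exact absurd ⟨t, h⟩ hne
        · exact h
  rw [e]
  exact ho.measurableSet.union (ho2.measurableSet.compl.inter (MeasurableSet.const _))

lemma lo_meas {u : V} (hu : ‖u‖ = 1) (hA : IsOpen A) (hb : IsBounded A) : Measurable (lo u A) := by
  unfold lo; exact (hi_meas (by rwa [norm_neg]) hA hb).neg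

lemma fib_abs {u : V} (hu : ‖u‖ = 1) (h2 : A ⊆ ball (0:V) b) {k : Ku u} {t : ℝ} (h : t ∈ fib u A k) : |t| < b := by
  have h3 := h2 h
  rw [mem_ball_zero_iff] at h3
  have := decomp_norm_sq u hu k t
  refine lt_of_le_of_lt ?_ h3
  apply abs_le_of_sq_le_sq _ (norm_nonneg _)
  nlinarith [sq_nonneg ‖(k:V)‖]

lemma hi_abs {u : V} (hu : ‖u‖ = 1) (hb : 0 < b) (h2 : A ⊆ ball (0:V) b) (k : Ku u) : |hi u A k| ≤ b := by
  by_cases hne : (fib u A k).Nonempty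
  · obtain ⟨t, htt⟩ := hne
    rw [abs_le]
    constructor
    · have := (abs_lt.1 (fib_abs hu h2 htt)).1
      exact this.le.trans (le_csSup (fib_bddAbove hu (isBounded_ball.subset h2) k) htt)
    · exact csSup_le ⟨t, htt⟩ (fun s hs => (abs_lt.1 (fib_abs hu h2 hs)).2.le)
  · rw [hi, not_nonempty_iff_eq_empty.1 hne, Real.sSup_empty]; simpa using hb.le

lemma lo_abs {u : V} (hu : ‖u‖ = 1) (hb : 0 < b) (h2 : A ⊆ ball (0:V) b) (k : Ku u) : |lo u A k| ≤ b := by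
  by_cases hne : (fib u A k).Nonempty
  · obtain ⟨t, htt⟩ := hne
    rw [lo_eq, abs_le]
    constructor
    · exact le_csInf ⟨t, htt⟩ (fun s hs => (abs_lt.1 (fib_abs hu h2 hs)).1.le)
    · have := (abs_lt.1 (fib_abs hu h2 htt)).2
      exact (csInf_le (fib_bddBelow hu (isBounded_ball.subset h2) k) htt).trans this.le
  · rw [lo_eq, not_nonempty_iff_eq_empty.1 hne, Real.sInf_empty]; simpa using hb.le

lemma slice_integral {u : V} (hu : ‖u‖ = 1) {F : V → ℝ} (hF : Integrable F) :
    ∫ x, F x = ∫ k : Ku u, ∫ t : ℝ, F ((k : V) + t • u) := by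
  have hmp := slice_mp u hu
  have h1 : Integrable (F ∘ (fun p : Ku u × ℝ => (p.1 : V) + p.2 • u)) (volume.prod volume) :=
    hmp.integrable_comp_of_integrable hF
  rw [← hmp.map_eq, integral_map hmp.measurable.aemeasurable (by rw [hmp.map_eq]; exact hF.1)]
  exact integral_prod _ h1

end
end Mf

namespace Mf
open InnerProductSpace Module TopologicalSpace
section
variable {V : Type*} [NormedAddCommGroup V] [InnerProductSpace ℝ V] [FiniteDimensional ℝ V]
  [MeasurableSpace V] [BorelSpace V]
variable {A : Set V} {a b ρ d : ℝ}

/-- cylinder -/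
def cyl (u : V) (d : ℝ) : Set V := {x | ‖x - (inner ℝ x u) • u‖ ≤ d}

lemma cyl_meas (u : V) (d : ℝ) : MeasurableSet (cyl u d) :=
  measurableSet_le (by fun_prop) (by fun_prop)

lemma cyl_iff {u : V} (hu : ‖u‖ = 1) (k : Ku u) (t : ℝ) : (k : V) + t • u ∈ cyl u d ↔ k ∈ closedBall (0 : Ku u) d := by
  have := decomp_inner u hu k t
  simp only [cyl, mem_setOf_eq]
  rw [this]
  simp

lemma int_inner_on {S : Set V} (hS : IsBounded S) (hm : MeasurableSet S) (u : V) :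
    IntegrableOn (fun x => inner ℝ x u) S := by
  obtain ⟨C, hC⟩ := hS.subset_closedBall 0
  exact ((by fun_prop : Continuous fun x : V => inner ℝ x u).continuousOn.integrableOn_compact
    (isCompact_closedBall (0:V) C)).mono_set hC

lemma cen1 {u : V} (hu : ‖u‖ = 1) (hA : IsOpen A) (hc : Convex ℝ A) (h1 : ball (0:V) a ⊆ A)
    (h2 : A ⊆ ball (0:V) b) (hd : d < a) :
    ∫ k in closedBall (0 : Ku u) d, (hi u A k - lo u A k) * mid u A k =
      2 * ∫ x in A ∩ cyl u d, inner ℝ x u := by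
  have hbd : IsBounded A := isBounded_ball.subset h2
  have hm : MeasurableSet (A ∩ cyl u d) := hA.measurableSet.inter (cyl_meas u d)
  have hI := int_inner_on (hbd.subset (inter_subset_left (t := cyl u d))) hm u
  rw [← integral_indicator hm, slice_integral hu (hI.integrable_indicator hm), ← integral_const_mul,
    ← integral_indicator measurableSet_closedBall]
  congr 1; ext k
  by_cases hk : k ∈ closedBall (0 : Ku u) d
  · rw [indicator_of_mem hk]
    have hne : (fib u A k).Nonempty := by
      refine ⟨0, ?_⟩
      rw [mem_fib, zero_smul, add_zero]
      apply h1
      rw [mem_ball_zero_iff]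
      rw [mem_closedBall_zero_iff] at hk
      exact lt_of_le_of_lt hk hd
    have hf := fib_eq_Ioo hu hbd hc hA hne
    have hle : lo u A k ≤ hi u A k := by
      obtain ⟨t, htt⟩ := hne
      rw [hf] at htt; exact (htt.1.trans htt.2).le
    have e : ∀ t : ℝ, (A ∩ cyl u d).indicator (fun x => inner ℝ x u) ((k : V) + t • u) =
        (Ioo (lo u A k) (hi u A k)).indicator (fun t => t) t := by
      intro t
      by_cases htt : t ∈ Ioo (lo u A k) (hi u A k)
      · rw [indicator_of_mem htt, indicator_of_mem, decomp_inner u hu]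
        exact ⟨by rw [← hf] at htt; exact htt, (cyl_iff hu k t).2 hk⟩
      · rw [indicator_of_notMem htt, indicator_of_notMem]
        rw [← hf] at htt; exact fun h => htt h.1
    simp_rw [e]
    rw [integral_indicator measurableSet_Ioo, Measure.restrict_congr_set Ioo_ae_eq_Ioc,
      ← intervalIntegral.integral_of_le hle, integral_id, mid]
    ring
  · rw [indicator_of_notMem hk]
    have e : ∀ t : ℝ, (A ∩ cyl u d).indicator (fun x => inner ℝ x u) ((k : V) + t • u) = 0 := by
      intro t
      rw [indicator_of_notMem]
      exact fun h => hk ((cyl_iff hu k t).1 h.2)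
    simp_rw [e]; simp

lemma cen2 {u : V} (hu : ‖u‖ = 1) (hA : IsOpen A)
    (h2 : A ⊆ ball (0:V) b) (hρ : ρ ≤ b) (hd0 : 0 ≤ d) (h0 : ∫ x in A, inner ℝ x u = 0) :
    |∫ x in A ∩ cyl u d, inner ℝ x u| ≤ √(b^2 - d^2) *
      (volume (A \ ball (0:V) ρ) + volume (ball (0:V) ρ \ A)).toReal := by
  have hbd : IsBounded A := isBounded_ball.subset h2
  set B := ball (0:V) ρ with hB
  set Q := (cyl u d)ᶜ with hQ
  have mA := hA.measurableSet
  have mB : MeasurableSet B := measurableSet_ball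
  have mQ : MeasurableSet Q := (cyl_meas u d).compl
  have bB : IsBounded B := isBounded_ball
  have I : ∀ S : Set V, IsBounded S → MeasurableSet S → IntegrableOn (fun x => inner ℝ x u) S :=
    fun S h m => int_inner_on h m u
  have s1 : (∫ x in A ∩ cyl u d, inner ℝ x u) + ∫ x in A ∩ Q, inner ℝ x u = 0 := by
    rw [← h0]
    exact integral_inter_add_diff (cyl_meas u d) (I A hbd mA)
  have s2 : ∫ x in B ∩ Q, inner ℝ x u = 0 := by
    have e : ∫ x in B ∩ Q, inner ℝ x u = ∫ x in B ∩ Q, inner ℝ (-x) u := by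
      rw [← integral_indicator (mB.inter mQ), ← integral_indicator (mB.inter mQ), ← integral_neg_eq_self]
      congr 1; ext x
      have hx : -x ∈ B ∩ Q ↔ x ∈ B ∩ Q := by
        simp only [hB, hQ, cyl, mem_inter_iff, mem_ball_zero_iff, norm_neg, mem_compl_iff, mem_setOf_eq, inner_neg_left]
        rw [neg_smul, ← neg_add', norm_neg, ← sub_eq_add_neg]
      by_cases h : x ∈ B ∩ Q
      · rw [indicator_of_mem h, indicator_of_mem (hx.2 h)]
      · rw [indicator_of_notMem h, indicator_of_notMem (fun h' => h (hx.1 h'))]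
    simp only [inner_neg_left, integral_neg] at e
    linarith
  have s3 : (∫ x in A ∩ Q ∩ B, inner ℝ x u) + ∫ x in (A ∩ Q) \ B, inner ℝ x u = ∫ x in A ∩ Q, inner ℝ x u :=
    integral_inter_add_diff mB (I _ (hbd.subset inter_subset_left) (mA.inter mQ))
  have s4 : (∫ x in B ∩ Q ∩ A, inner ℝ x u) + ∫ x in (B ∩ Q) \ A, inner ℝ x u = ∫ x in B ∩ Q, inner ℝ x u :=
    integral_inter_add_diff mA (I _ (bB.subset inter_subset_left) (mB.inter mQ))
  have e5 : A ∩ Q ∩ B = B ∩ Q ∩ A := by ext x; simp only [mem_inter_iff]; tauto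
  rw [e5] at s3
  have bnd : ∀ x ∈ ball (0:V) b, x ∈ Q → ‖(inner ℝ x u : ℝ)‖ ≤ √(b^2-d^2) := by
    intro x hx hxQ
    obtain ⟨k, t, rfl, htt⟩ := decomp u hu x
    rw [← htt, Real.norm_eq_abs]
    apply Real.abs_le_sqrt
    rw [hQ, mem_compl_iff, cyl_iff hu, mem_closedBall_zero_iff, not_le] at hxQ
    have := decomp_norm_sq u hu k t
    rw [mem_ball_zero_iff] at hx
    have hk : d < ‖(k:V)‖ := hxQ
    have h6 : ‖(k : V) + t • u‖^2 ≤ b^2 := pow_le_pow_left₀ (norm_nonneg _) hx.le 2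
    nlinarith
  have n1 : ‖∫ x in (A ∩ Q) \ B, inner ℝ x u‖ ≤ √(b^2-d^2) * (volume (A \ B)).toReal := by
    refine (norm_setIntegral_le_of_norm_le_const (C := √(b^2-d^2)) ?_ ?_).trans ?_
    · exact (hbd.subset (diff_subset.trans inter_subset_left)).measure_lt_top
    · exact fun x hx => bnd x (h2 hx.1.1) hx.1.2
    · apply mul_le_mul_of_nonneg_left _ (Real.sqrt_nonneg _)
      apply ENNReal.toReal_mono (hbd.subset diff_subset).measure_lt_top.ne
      exact measure_mono (fun x hx => ⟨hx.1.1, hx.2⟩)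
  have n2 : ‖∫ x in (B ∩ Q) \ A, inner ℝ x u‖ ≤ √(b^2-d^2) * (volume (B \ A)).toReal := by
    refine (norm_setIntegral_le_of_norm_le_const (C := √(b^2-d^2)) ?_ ?_).trans ?_
    · exact (bB.subset (diff_subset.trans inter_subset_left)).measure_lt_top
    · exact fun x hx => bnd x (ball_subset_ball hρ hx.1.1) hx.1.2
    · apply mul_le_mul_of_nonneg_left _ (Real.sqrt_nonneg _)
      apply ENNReal.toReal_mono (bB.subset diff_subset).measure_lt_top.ne
      exact measure_mono (fun x hx => ⟨hx.1.1, hx.2⟩)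
  rw [ENNReal.toReal_add (hbd.subset diff_subset).measure_lt_top.ne (bB.subset diff_subset).measure_lt_top.ne]
  rw [Real.norm_eq_abs] at n1 n2
  have e6 : ∫ x in A ∩ cyl u d, inner ℝ x u = (∫ x in (B ∩ Q) \ A, inner ℝ x u) - ∫ x in (A ∩ Q) \ B, inner ℝ x u := by
    linarith
  rw [e6, mul_add]
  refine (abs_sub _ _).trans ?_
  linarith

lemma lam_lb {u : V} (hu : ‖u‖ = 1) (hA : IsOpen A) (hc : Convex ℝ A) (ha : 0 < a) (h1 : ball (0:V) a ⊆ A)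
    (hb : 0 < b) (h2 : A ⊆ ball (0:V) b) (hd : a / 2 ≤ d) :
    a * (volume (closedBall (0 : Ku u) (a/2))).toReal ≤ ∫ k in closedBall (0 : Ku u) d, (hi u A k - lo u A k) := by
  have hbd : IsBounded A := isBounded_ball.subset h2
  have hhm : Measurable (fun k : Ku u => hi u A k - lo u A k) :=
    ((hi_meas hu hA hbd).comp measurable_subtype_coe).sub ((lo_meas hu hA hbd).comp measurable_subtype_coe)
  have hi0 : IntegrableOn (fun k : Ku u => hi u A k - lo u A k) (closedBall (0 : Ku u) d) := by
    apply Measure.integrableOn_of_bounded (M := 2 * b) measure_closedBall_lt_top.ne hhm.aestronglyMeasurable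
    refine Eventually.of_forall (fun k => ?_)
    rw [Real.norm_eq_abs]
    exact (abs_sub _ _).trans (by linarith [hi_abs hu hb h2 k, lo_abs hu hb h2 k])
  have hnn : ∀ k : Ku u, 0 ≤ hi u A k - lo u A k := by
    intro k
    by_cases hne : (fib u A k).Nonempty
    · have hf := fib_eq_Ioo hu hbd hc hA hne
      obtain ⟨t, htt⟩ := hne
      rw [hf] at htt; linarith [htt.1.trans htt.2]
    · rw [lo_eq, hi, not_nonempty_iff_eq_empty.1 hne, Real.sInf_empty, Real.sSup_empty]; simp
  have hlb : ∀ k ∈ closedBall (0 : Ku u) (a/2), a ≤ hi u A k - lo u A k := by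
    intro k hk
    rw [mem_closedBall_zero_iff] at hk
    have hk' : ‖(k:V)‖ ≤ a / 2 := hk
    have hin : ∀ t : ℝ, |t| < a / 2 → t ∈ fib u A k := by
      intro t htt
      apply h1
      rw [mem_ball_zero_iff]
      refine lt_of_le_of_lt (norm_add_le _ _) ?_
      rw [norm_smul, hu, mul_one, Real.norm_eq_abs]; linarith
    have hne : (fib u A k).Nonempty := ⟨0, hin 0 (by simpa using ha)⟩
    have hf := fib_eq_Ioo hu hbd hc hA hne
    have x1 : a / 2 ≤ hi u A k := by
      apply le_of_forall_lt_imp_le_of_dense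
      intro t htt
      by_cases h0 : 0 ≤ t
      · have := hin t (by rwa [abs_of_nonneg h0])
        rw [hf] at this; exact this.2.le
      · have := hin 0 (by simpa using ha)
        rw [hf] at this; linarith [this.2]
    have x2 : lo u A k ≤ - (a/2) := by
      apply le_of_forall_gt_imp_ge_of_dense
      intro t htt
      by_cases h0 : t ≤ 0
      · have := hin t (by rw [abs_of_nonpos h0]; linarith)
        rw [hf] at this; exact this.1.le
      · have := hin 0 (by simpa using ha)
        rw [hf] at this; linarith [this.1]
    linarith
  calc _ = ∫ k in closedBall (0 : Ku u) (a/2), a := by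
        rw [setIntegral_const, smul_eq_mul, mul_comm]; rfl
    _ ≤ ∫ k in closedBall (0 : Ku u) (a/2), (hi u A k - lo u A k) := by
        apply setIntegral_mono_on (by simp [measure_closedBall_lt_top]) (hi0.mono_set (closedBall_subset_closedBall hd)) measurableSet_closedBall
        exact hlb
    _ ≤ _ := by
        apply setIntegral_mono_set hi0 (Eventually.of_forall hnn)
        exact (closedBall_subset_closedBall hd).eventuallyLE

lemma step1 {u : V} (hu : ‖u‖ = 1) (hA : IsOpen A) (hc : Convex ℝ A) (ha : 0 < a) (h1 : ball (0:V) a ⊆ A)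
    (hb : 0 < b) (h2 : A ⊆ ball (0:V) b) (hρ : ρ ≤ b) (hd : a / 2 ≤ d) (hda : d < a)
    (h0 : ∫ x in A, inner ℝ x u = 0) :
    ENNReal.ofReal ((a * (volume (closedBall (0 : Ku u) (a/2))).toReal) ^ 2) *
      ∫⁻ k in closedBall (0 : Ku u) d, ENNReal.ofReal (mid u A k ^ 2) ≤
    ENNReal.ofReal (8 * b ^ 2) * volume (closedBall (0 : Ku u) d) *
      (∫⁻ k in closedBall (0 : Ku u) d, ∫⁻ k' in closedBall (0 : Ku u) d, ENNReal.ofReal ((mid u A k' - mid u A k) ^ 2)) +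
    ENNReal.ofReal (8 * (b^2 - d^2) * (volume (A \ ball (0:V) ρ) + volume (ball (0:V) ρ \ A)).toReal ^ 2) *
      volume (closedBall (0 : Ku u) d) := by
  have hbd : IsBounded A := isBounded_ball.subset h2
  have hh := (hi_meas hu hA hbd).comp (measurable_subtype_coe (p := fun x => x ∈ Ku u))
  have hl := (lo_meas hu hA hbd).comp (measurable_subtype_coe (p := fun x => x ∈ Ku u))
  haveI : IsFiniteMeasure (volume.restrict (closedBall (0 : Ku u) d)) :=
    ⟨by rw [Measure.restrict_apply_univ]; exact measure_closedBall_lt_top⟩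
  have w := wmean (volume.restrict (closedBall (0 : Ku u) d)) (l := fun k => hi u A k - lo u A k)
    (b := fun k => mid u A k) (hh.sub hl) (hh.add hl) (L := 2 * b) (M := 2 * b)
    (fun k => (abs_sub _ _).trans (by linarith [hi_abs hu hb h2 k, lo_abs hu hb h2 k]))
    (fun k => (abs_add_le _ _).trans (by linarith [hi_abs hu hb h2 k, lo_abs hu hb h2 k]))
  rw [cen1 hu hA hc h1 h2 hda, Measure.restrict_apply_univ] at w
  have c2 := cen2 hu hA h2 hρ (by linarith) h0 (d := d)
  have l1 := lam_lb hu hA hc ha h1 hb h2 hd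
  have hab : a ≤ b := by
    by_contra hlt
    push Not at hlt
    have hv : b • u ∈ ball (0:V) a := by
      rw [mem_ball_zero_iff, norm_smul, hu, mul_one, Real.norm_of_nonneg hb.le]; exact hlt
    have := h2 (h1 hv)
    rw [mem_ball_zero_iff, norm_smul, hu, mul_one, Real.norm_of_nonneg hb.le] at this
    exact lt_irrefl _ this
  refine (mul_le_mul_left (ENNReal.ofReal_le_ofReal (pow_le_pow_left₀ (by positivity) l1 2)) _).trans (w.trans ?_)
  gcongr ?_ * _ * _ + ?_ * _
  · apply ENNReal.ofReal_le_ofReal; nlinarith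
  · apply ENNReal.ofReal_le_ofReal
    have hbd2 : 0 ≤ b^2 - d^2 := by nlinarith
    have := pow_le_pow_left₀ (abs_nonneg _) c2 2
    rw [sq_abs, mul_pow, Real.sq_sqrt hbd2] at this
    nlinarith

end
end Mf

namespace Mf
open InnerProductSpace Module TopologicalSpace
section
variable {V : Type*} [NormedAddCommGroup V] [InnerProductSpace ℝ V] [FiniteDimensional ℝ V]
  [MeasurableSpace V] [BorelSpace V]
variable {A : Set V} {a b ρ d : ℝ}

lemma gauge_cl (hA : IsOpen A) (hc : Convex ℝ A) (ha : 0 < a) (h1 : ball (0:V) a ⊆ A) {x : V} (hx : x ∈ closure A) :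
    gauge A x ≤ 1 := by
  have hgc : Continuous (gauge A) := continuous_gauge hc (mem_of_superset (ball_mem_nhds _ ha) h1)
  have : closure A ⊆ {x | gauge A x ≤ 1} :=
    closure_minimal (fun y hy => ((mem_iff_gauge hA hc ha h1 y).1 hy).le) (isClosed_le hgc continuous_const)
  exact this hx

lemma step2 {u : V} (hu : ‖u‖ = 1) (hA : IsOpen A) (hc : Convex ℝ A) (ha : 0 < a) (h1 : ball (0:V) a ⊆ A)
    (h2 : A ⊆ ball (0:V) b) {η : ℝ} (hη : 0 ≤ η) (hη1 : η ≤ 1) (hd0 : 0 ≤ d) (hd : (1 - η^2) * b^2 ≤ d^2) :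
    ∫⁻ x in A, {x : V | η * ‖x‖ ≤ |inner ℝ x u|}.indicator (fun x => ENNReal.ofReal (gauge A (sg u x) - 1)) x ≤
      ENNReal.ofReal a⁻¹ * ∫⁻ k in closedBall (0 : Ku u) d, ENNReal.ofReal (mid u A k ^ 2) := by
  have hbd : IsBounded A := isBounded_ball.subset h2
  have hgc : Continuous (gauge A) := continuous_gauge hc (mem_of_superset (ball_mem_nhds _ ha) h1)
  have hCm : MeasurableSet {x : V | η * ‖x‖ ≤ |inner ℝ x u|} :=
    measurableSet_le (by fun_prop) (by fun_prop)
  set C := {x : V | η * ‖x‖ ≤ |inner ℝ x u|} with hC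
  have hHm : Measurable (C.indicator (fun x => ENNReal.ofReal (gauge A (sg u x) - 1))) := by
    apply Measurable.indicator _ hCm
    have : Continuous (fun x => gauge A (sg u x)) := hgc.comp (sg u).continuous
    exact (this.measurable.sub_const 1).ennreal_ofReal
  rw [← lintegral_indicator hA.measurableSet, slice_lintegral u hu _ (hHm.indicator hA.measurableSet),
    ← lintegral_const_mul' _ _ ENNReal.ofReal_ne_top, ← lintegral_indicator measurableSet_closedBall]
  apply lintegral_mono
  intro k
  simp only
  have hsg : ∀ t : ℝ, sg u ((k : V) + t • u) = (k : V) + (-t) • u := by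
    intro t; rw [map_add, map_smul, sg_u hu, sg_Ku]; simp
  by_cases hk : k ∈ closedBall (0 : Ku u) d
  swap
  · rw [indicator_of_notMem hk]
    have e : ∀ t : ℝ, A.indicator (C.indicator (fun x => ENNReal.ofReal (gauge A (sg u x) - 1))) ((k : V) + t • u) = 0 := by
      intro t
      by_cases hxA : (k : V) + t • u ∈ A
      swap
      · rw [indicator_of_notMem hxA]
      rw [indicator_of_mem hxA]
      rw [indicator_of_notMem]
      intro hxC
      apply hk
      rw [mem_closedBall_zero_iff]
      have h3 := h2 hxA
      rw [mem_ball_zero_iff] at h3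
      simp only [hC, mem_setOf_eq] at hxC
      rw [decomp_inner u hu] at hxC
      have h4 := decomp_norm_sq u hu k t
      have h5 : (η * ‖(k : V) + t • u‖)^2 ≤ t^2 := by
        rw [← sq_abs t]; exact pow_le_pow_left₀ (by positivity) hxC 2
      have h6 : ‖(k : V) + t • u‖^2 ≤ b^2 := pow_le_pow_left₀ (norm_nonneg _) h3.le 2
      have h7 : (1 - η^2) * ‖(k : V) + t • u‖^2 ≤ (1 - η^2) * b^2 :=
        mul_le_mul_of_nonneg_left h6 (by nlinarith)
      have h8 : ‖k‖^2 ≤ d^2 := by nlinarith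
      exact abs_le_of_sq_le_sq' h8 hd0 |>.2
    simp_rw [e]; simp
  rw [indicator_of_mem hk]
  by_cases hne : (fib u A k).Nonempty
  swap
  · have e : ∀ t : ℝ, A.indicator (C.indicator (fun x => ENNReal.ofReal (gauge A (sg u x) - 1))) ((k : V) + t • u) = 0 := by
      intro t
      rw [indicator_of_notMem]
      exact fun h => hne ⟨t, h⟩
    simp_rw [e]; simp
  have hf := fib_eq_Ioo hu hbd hc hA hne
  set l := lo u A k with hl
  set h := hi u A k with hh
  have ghi : gauge A ((k:V) + h • u) ≤ 1 := gauge_cl hA hc ha h1 (hi_point_closure hu hbd hne)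
  have glo : gauge A ((k:V) + l • u) ≤ 1 := by
    have hne' : (fib (-u) A k).Nonempty := by
      obtain ⟨t, htt⟩ := hne
      exact ⟨-t, by rw [mem_fib_neg, neg_neg]; exact htt⟩
    have := gauge_cl hA hc ha h1 (hi_point_closure (by rwa [norm_neg]) hbd hne')
    rw [hl, lo]
    rwa [smul_neg, ← neg_smul] at this
  have gt : ∀ s t : ℝ, gauge A ((k:V) + s • u) ≤ 1 → gauge A ((k:V) + t • u) ≤ 1 + |t - s| / a := by
    intro s t hs
    have e : (k:V) + t • u = ((k:V) + s • u) + (t - s) • u := by rw [sub_smul]; abel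
    rw [e]
    refine (gauge_add_le hc ((absorbent_ball_zero ha).mono h1) _ _).trans ?_
    have := gauge_up ha h1 ((t - s) • u)
    rw [norm_smul, hu, mul_one, Real.norm_eq_abs] at this
    linarith
  have hm : mid u A k = h + l := rfl
  rw [hm]
  -- the bad set
  obtain ⟨p, q, hpq, hbad⟩ : ∃ p q : ℝ, q - p = |h + l| ∧ ∀ t ∈ Ioo l h, -t ∉ Ioo l h →
      t ∈ Icc p q ∧ gauge A ((k:V) + (-t) • u) - 1 ≤ |h + l| / a := by
    rcases le_total 0 (h + l) with hs | hs
    · refine ⟨-l, h, by rw [abs_of_nonneg hs]; ring, fun t h3 h4 => ?_⟩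
      have h5 : -l ≤ t := by
        by_contra h6; exact h4 ⟨by linarith, by linarith [h3.1]⟩
      refine ⟨⟨h5, h3.2.le⟩, ?_⟩
      have h6 := gt l (-t) glo
      have h7 : |-t - l| ≤ |h + l| := by
        rw [abs_of_nonpos (by linarith), abs_of_nonneg hs]; linarith [h3.2]
      have h8 : |-t - l| / a ≤ |h + l| / a := by gcongr
      linarith
    · refine ⟨l, -h, by rw [abs_of_nonpos hs]; ring, fun t h3 h4 => ?_⟩
      have h5 : t ≤ -h := by
        by_contra h6; exact h4 ⟨by linarith [h3.2], by linarith⟩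
      refine ⟨⟨h3.1.le, h5⟩, ?_⟩
      have h6 := gt h (-t) ghi
      have h7 : |-t - h| ≤ |h + l| := by
        rw [abs_of_nonneg (by linarith), abs_of_nonpos hs]; linarith [h3.1]
      have h8 : |-t - h| / a ≤ |h + l| / a := by gcongr
      linarith
  calc _ ≤ ∫⁻ t : ℝ, (Icc p q).indicator (fun _ => ENNReal.ofReal (|h + l| / a)) t := by
        apply lintegral_mono
        intro t
        simp only
        by_cases hxA : (k : V) + t • u ∈ A
        swap
        · rw [indicator_of_notMem hxA]; exact zero_le
        rw [indicator_of_mem hxA]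
        by_cases hxC : (k : V) + t • u ∈ C
        swap
        · rw [indicator_of_notMem hxC]; exact zero_le
        rw [indicator_of_mem hxC, hsg]
        have htI : t ∈ Ioo l h := by rw [← hf]; exact hxA
        by_cases hnt : -t ∈ Ioo l h
        · have hxA' : (k : V) + (-t) • u ∈ A := by rw [← hf] at hnt; exact hnt
          rw [mem_iff_gauge hA hc ha h1] at hxA'
          rw [ENNReal.ofReal_of_nonpos (by linarith)]; exact zero_le
        · obtain ⟨x1, x2⟩ := hbad t htI hnt
          rw [indicator_of_mem x1]
          exact ENNReal.ofReal_le_ofReal x2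
    _ = _ := by
        rw [lintegral_indicator_const measurableSet_Icc, Real.volume_Icc, hpq,
          ← ENNReal.ofReal_mul (by positivity), ← ENNReal.ofReal_mul (by positivity)]
        congr 1
        rw [← sq_abs (h + l)]; field_simp

end
end Mf

namespace Mf
open InnerProductSpace Module TopologicalSpace
section
variable {V : Type*} [NormedAddCommGroup V] [InnerProductSpace ℝ V] [FiniteDimensional ℝ V]
  [MeasurableSpace V] [BorelSpace V]

/-- reflection of `ω` in direction `u`, scaled -/
def Lam (w u : V) : V := ‖u‖ • w - (2 * inner ℝ u w) • ht u

lemma ht_lip {u v : V} (hu : u ≠ 0) (hv : v ≠ 0) : ‖v‖ * ‖ht u - ht v‖ ≤ 2 * ‖u - v‖ := by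
  have e : ‖v‖ • (ht u - ht v) = (‖v‖ - ‖u‖) • ht u + (u - v) := by
    rw [smul_sub, sub_smul, ht_smul_norm, ht_smul_norm]; abel
  have : ‖v‖ * ‖ht u - ht v‖ = ‖‖v‖ • (ht u - ht v)‖ := by rw [norm_smul, norm_norm]
  rw [this, e]
  refine (norm_add_le _ _).trans ?_
  rw [norm_smul, ht_norm hu, mul_one, Real.norm_eq_abs]
  have := abs_norm_sub_norm_le v u
  rw [norm_sub_rev v u] at this
  linarith

lemma Lam_lip {w : V} (hw : ‖w‖ = 1) {u v : V} (hu : u ≠ 0) (hv : v ≠ 0) :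
    ‖Lam w u - Lam w v‖ ≤ 7 * ‖u - v‖ := by
  have e : Lam w u - Lam w v = (‖u‖ - ‖v‖) • w - ((2 * inner ℝ (u - v) w) • ht u + (2 * inner ℝ v w) • (ht u - ht v)) := by
    simp only [Lam, inner_sub_left, sub_smul, mul_sub, smul_sub]; abel
  rw [e]
  refine (norm_sub_le _ _).trans ?_
  have a1 : ‖(‖u‖ - ‖v‖) • w‖ ≤ ‖u - v‖ := by
    rw [norm_smul, hw, mul_one, Real.norm_eq_abs]; exact abs_norm_sub_norm_le u v
  have a2 : ‖(2 * inner ℝ (u - v) w) • ht u‖ ≤ 2 * ‖u - v‖ := by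
    rw [norm_smul, ht_norm hu, mul_one, norm_mul]
    have := norm_inner_le_norm (𝕜 := ℝ) (u - v) w
    rw [hw, mul_one] at this
    simp only [Real.norm_ofNat]; linarith
  have a3 : ‖(2 * inner ℝ v w) • (ht u - ht v)‖ ≤ 4 * ‖u - v‖ := by
    rw [norm_smul, norm_mul]
    have := norm_inner_le_norm (𝕜 := ℝ) v w
    rw [hw, mul_one] at this
    have h2 := ht_lip hu hv
    simp only [Real.norm_ofNat]
    nlinarith [norm_nonneg (ht u - ht v)]
  have := norm_add_le ((2 * inner ℝ (u - v) w) • ht u) ((2 * inner ℝ v w) • (ht u - ht v))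
  linarith

lemma Lam_meas (w : V) : Measurable (Lam w) := by
  have := ht_meas (V := V)
  unfold Lam; fun_prop

lemma Lam_surj {w : V} (hw : ‖w‖ = 1) {η : ℝ} (hη : 0 < η) {z : V} (hz : z ≠ 0) (hf : 2 * η ≤ ‖ht z - w‖) :
    ∃ u : V, ‖u‖ = ‖z‖ ∧ η * ‖u‖ ≤ |inner ℝ u w| ∧ Lam w u = z := by
  have hz0 := norm_pos_iff.2 hz
  have hne : w - ht z ≠ 0 := by
    intro h
    rw [norm_sub_rev, h, norm_zero] at hf; linarith
  have hn0 := norm_pos_iff.2 hne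
  set v := ht (w - ht z) with hv
  have hv1 : ‖v‖ = 1 := ht_norm hne
  have hvw : inner ℝ v w = ‖w - ht z‖ / 2 := by
    rw [hv, ht, inner_smul_left]
    have h1 : ‖w - ht z‖^2 = 2 * inner ℝ (w - ht z) w := by
      rw [norm_sub_sq_real, inner_sub_left, real_inner_self_eq_norm_sq, hw, ht_norm hz, real_inner_comm]; ring
    simp only [conj_trivial]
    have h2 : inner ℝ (w - ht z) w = ‖w - ht z‖^2 / 2 := by linarith
    rw [h2]; field_simp
  have hun : ‖‖z‖ • v‖ = ‖z‖ := by rw [norm_smul, hv1, mul_one, norm_norm]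
  refine ⟨‖z‖ • v, hun, ?_, ?_⟩
  · rw [hun, inner_smul_left, hvw]
    simp only [conj_trivial]
    rw [abs_of_nonneg (by positivity)]
    rw [norm_sub_rev] at hf
    nlinarith
  · rw [Lam, hun, ht_smul hz0, ht_unit hv1, inner_smul_left, hvw]
    simp only [conj_trivial]
    have e : (2 * (‖z‖ * (‖w - ht z‖ / 2))) • v = ‖z‖ • (w - ht z) := by
      rw [← ht_smul_norm (w - ht z), ← hv, smul_smul]
      congr 1
      rw [ht_smul_norm]; ring
    rw [e, smul_sub, ht_smul_norm]; abel

lemma Lam_int [Nontrivial V] {w : V} (hw : ‖w‖ = 1) {η : ℝ} (hη : 0 < η) (φ : V → ℝ≥0∞) (hφ : Measurable φ) :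
    ∫⁻ z in ball (0:V) 1, {z : V | 2 * η ≤ ‖ht z - w‖}.indicator φ z ≤
      7 ^ finrank ℝ V * ∫⁻ u in ball (0:V) 1, {u : V | η * ‖u‖ ≤ |inner ℝ u w|}.indicator (fun u => φ (Lam w u)) u := by
  have hhm := ht_meas (V := V)
  have mF : MeasurableSet {z : V | 2 * η ≤ ‖ht z - w‖} := measurableSet_le measurable_const (by fun_prop)
  have mG : MeasurableSet {u : V | η * ‖u‖ ≤ |inner ℝ u w|} := measurableSet_le (by fun_prop) (by fun_prop)
  set F := {z : V | 2 * η ≤ ‖ht z - w‖}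
  set G := {u : V | η * ‖u‖ ≤ |inner ℝ u w|}
  rw [setLIntegral_indicator mF, setLIntegral_indicator mG]
  have hm : volume.restrict (F ∩ ball (0:V) 1) ≤ (7 ^ finrank ℝ V : ℝ≥0∞) • ((volume.restrict (G ∩ ball (0:V) 1)).map (Lam w)) := by
    rw [Measure.le_iff]
    intro S hS
    rw [Measure.restrict_apply hS, Measure.smul_apply, Measure.map_apply (Lam_meas w) hS,
      Measure.restrict_apply (Lam_meas w hS)]
    have h0 : volume (S ∩ (F ∩ ball (0:V) 1)) ≤ volume ((S ∩ (F ∩ ball (0:V) 1)) \ {0}) := by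
      rw [measure_diff_null (measure_singleton _)]
    refine h0.trans ?_
    have hsub : (S ∩ (F ∩ ball (0:V) 1)) \ {0} ⊆ Lam w '' ((Lam w ⁻¹' S ∩ (G ∩ ball (0:V) 1)) \ {0}) := by
      rintro z ⟨⟨hzS, hzF, hzb⟩, hz0⟩
      obtain ⟨u, hu1, hu2, hu3⟩ := Lam_surj hw hη hz0 hzF
      refine ⟨u, ⟨⟨?_, hu2, ?_⟩, ?_⟩, hu3⟩
      · rw [mem_preimage, hu3]; exact hzS
      · rw [mem_ball_zero_iff] at hzb ⊢; rw [hu1]; exact hzb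
      · simp only [mem_singleton_iff] at hz0 ⊢
        rw [← norm_eq_zero, hu1]; simpa using hz0
    refine (measure_mono hsub).trans ?_
    have hL : LipschitzOnWith 7 (Lam w) ((Lam w ⁻¹' S ∩ (G ∩ ball (0:V) 1)) \ {0}) := by
      apply LipschitzOnWith.of_dist_le_mul
      intro u hu v hv
      rw [dist_eq_norm, dist_eq_norm]
      exact Lam_lip hw hu.2 hv.2
    refine (vol_lip_image hL).trans ?_
    rw [smul_eq_mul]
    gcongr
    · simp
    · exact diff_subset
  calc _ ≤ ∫⁻ z, φ z ∂((7 ^ finrank ℝ V : ℝ≥0∞) • ((volume.restrict (G ∩ ball (0:V) 1)).map (Lam w))) :=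
        lintegral_mono' hm le_rfl
    _ = _ := by rw [lintegral_smul_measure, lintegral_map hφ (Lam_meas w), smul_eq_mul]

lemma step3 [Nontrivial V] {f : V → ℝ} (hf : Measurable f) (hh : ∀ t : ℝ, 0 < t → ∀ x, f (t • x) = f x)
    {η : ℝ} (hη : 0 < η) {K : ℝ≥0∞}
    (hK : ∀ u : V, ‖u‖ = 1 → ∫⁻ y in ball (0:V) 1, {x : V | η * ‖x‖ ≤ |inner ℝ x u|}.indicator
        (fun y => ENNReal.ofReal ((max (f y - f (sg u y)) 0) ^ 2)) y ≤ K) :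
    ∫⁻ y in ball (0:V) 1, ∫⁻ z in ball (0:V) 1, {z : V | 2 * η ≤ ‖ht z - ht y‖}.indicator
      (fun z => ENNReal.ofReal ((max (f y - f z) 0) ^ 2)) z ≤ 7 ^ finrank ℝ V * (K * volume (ball (0:V) 1)) := by
  have hhm := ht_meas (V := V)
  set g : V × V → V := fun p => p.2 - (2 * inner ℝ p.2 (ht p.1)) • ht p.1 with hg
  have gm : Measurable g := by rw [hg]; fun_prop
  set J : V × V → ℝ≥0∞ := {p : V × V | η * ‖p.2‖ ≤ |inner ℝ p.2 (ht p.1)|}.indicator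
    (fun p => ENNReal.ofReal ((max (f p.2 - f (g p)) 0) ^ 2)) with hJ
  have Jm : Measurable J := by
    apply Measurable.indicator
    · have : Measurable (fun p => f (g p)) := hf.comp gm
      fun_prop
    · exact measurableSet_le (by fun_prop) (by fun_prop)
  have s1 : ∫⁻ u in ball (0:V) 1, ∫⁻ y in ball (0:V) 1, J (u, y) ≤ K * volume (ball (0:V) 1) := by
    calc _ ≤ ∫⁻ u in ball (0:V) 1, K := by
          apply lintegral_mono_ae
          filter_upwards [ae_ne0 (ball (0:V) 1)] with u hu
          refine le_trans (le_of_eq ?_) (hK (ht u) (ht_norm hu))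
          congr 1; ext y
          simp only [hJ, hg, indicator, mem_setOf_eq, sg_apply (ht_norm hu)]
      _ = _ := by rw [setLIntegral_const]
  rw [lintegral_lintegral_swap (f := fun u y => J (u, y)) (by exact Jm.aemeasurable)] at s1
  refine le_trans ?_ (mul_le_mul_right s1 _)
  rw [← lintegral_const_mul' _ _ (by finiteness)]
  apply lintegral_mono_ae
  filter_upwards [ae_ne0 (ball (0:V) 1)] with y hy
  refine (Lam_int (ht_norm hy) hη (fun z => ENNReal.ofReal ((max (f y - f z) 0) ^ 2)) (by fun_prop)).trans ?_
  refine mul_le_mul_right ?_ _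
  apply lintegral_mono_ae
  filter_upwards [ae_ne0 (ball (0:V) 1)] with u hu
  have hy0 := norm_pos_iff.2 hy
  have hu0 := norm_pos_iff.2 hu
  have e1 : inner ℝ u (ht y) = ‖u‖ * inner ℝ (ht u) (ht y) := by
    conv_lhs => rw [← ht_smul_norm u, inner_smul_left]
    simp
  have e2 : inner ℝ y (ht u) = ‖y‖ * inner ℝ (ht u) (ht y) := by
    conv_lhs => rw [← ht_smul_norm y, inner_smul_left, real_inner_comm]
    simp
  have c : (u ∈ {u : V | η * ‖u‖ ≤ |inner ℝ u (ht y)|}) ↔ (u, y) ∈ {p : V × V | η * ‖p.2‖ ≤ |inner ℝ p.2 (ht p.1)|} := by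
    simp only [mem_setOf_eq]
    rw [e1, e2, abs_mul, abs_mul, abs_norm, abs_norm, mul_comm η, mul_comm η,
      mul_le_mul_iff_right₀ hu0, mul_le_mul_iff_right₀ hy0]
  have e3 : Lam (ht y) u = ‖u‖ • (ht y - (2 * inner ℝ (ht u) (ht y)) • ht u) := by
    rw [Lam, e1, smul_sub, smul_smul]; congr 2; ring
  have e4 : g (u, y) = ‖y‖ • (ht y - (2 * inner ℝ (ht u) (ht y)) • ht u) := by
    simp only [hg]
    rw [e2, smul_sub, ht_smul_norm, smul_smul]; congr 2; ring
  have e5 : f (Lam (ht y) u) = f (g (u, y)) := by rw [e3, e4, hh _ hu0, hh _ hy0]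
  rw [hJ]
  by_cases hc : (u, y) ∈ {p : V × V | η * ‖p.2‖ ≤ |inner ℝ p.2 (ht p.1)|}
  · rw [indicator_of_mem hc, indicator_of_mem (c.2 hc), e5]
  · rw [indicator_of_notMem hc, indicator_of_notMem (fun h => hc (c.1 h))]

end
end Mf

namespace Mf
open InnerProductSpace Module TopologicalSpace
section
variable {V : Type*} [NormedAddCommGroup V] [InnerProductSpace ℝ V] [FiniteDimensional ℝ V]
  [MeasurableSpace V] [BorelSpace V]

lemma exists_dir (h2 : 2 ≤ finrank ℝ V) {p q : V} (hp : ‖p‖ = 1) (hq : ‖q‖ = 1) :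
    ∃ w : V, ‖w‖ = 1 ∧ inner ℝ p w ≤ 3/4 ∧ inner ℝ q w ≤ 3/4 := by
  set B := stdOrthonormalBasis ℝ V
  set e1 := B ⟨0, by omega⟩ with he1
  set e2 := B ⟨1, by omega⟩ with he2
  have n1 : ‖e1‖ = 1 := B.norm_eq_one _
  have n2 : ‖e2‖ = 1 := B.norm_eq_one _
  have n12 : inner ℝ e1 e2 = 0 := B.inner_eq_zero (by simp)
  have key : ∀ p : V, ‖p‖ = 1 → (inner ℝ p e1)^2 + (inner ℝ p e2)^2 ≤ 1 := by
    intro p hp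
    have h0 := sq_nonneg ‖p - (inner ℝ p e1) • e1 - (inner ℝ p e2) • e2‖
    have : ‖p - (inner ℝ p e1) • e1 - (inner ℝ p e2) • e2‖^2 = 1 - (inner ℝ p e1)^2 - (inner ℝ p e2)^2 := by
      rw [norm_sub_sq_real, norm_sub_sq_real, inner_sub_left]
      simp only [inner_smul_right, inner_smul_left, norm_smul, n1, n2, n12, hp, mul_one, Real.norm_eq_abs, sq_abs,
        conj_trivial]
      ring
    linarith
  have kp := key p hp
  have kq := key q hq
  have hn1 : ‖-e1‖ = 1 := by rw [norm_neg, n1]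
  by_cases c1 : inner ℝ p e1 ≤ 3/4 ∧ inner ℝ q e1 ≤ 3/4
  · exact ⟨e1, n1, c1⟩
  by_cases c2 : inner ℝ p (-e1) ≤ 3/4 ∧ inner ℝ q (-e1) ≤ 3/4
  · exact ⟨-e1, hn1, c2⟩
  refine ⟨e2, n2, ?_, ?_⟩
  · by_contra hlt
    simp only [inner_neg_right, not_and_or, not_le] at c1 c2 hlt
    rcases c1 with h | h <;> rcases c2 with h' | h' <;> nlinarith
  · by_contra hlt
    simp only [inner_neg_right, not_and_or, not_le] at c1 c2 hlt
    rcases c1 with h | h <;> rcases c2 with h' | h' <;> nlinarith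

lemma dir_far {w p y : V} (hw : ‖w‖ = 1) (hp : ‖p‖ = 1) (h : inner ℝ p w ≤ 3/4)
    (hy : y ∈ ball ((1/2 : ℝ) • w) (1/16)) : y ∈ ball (0:V) 1 ∧ 2 * (1/5 : ℝ) ≤ ‖ht y - p‖ := by
  rw [mem_ball, dist_eq_norm] at hy
  have hw2 : ‖(1/2 : ℝ) • w‖ = 1/2 := by rw [norm_smul, hw]; norm_num
  have hb1 : ‖y‖ ≤ ‖y - (1/2 : ℝ) • w‖ + ‖(1/2 : ℝ) • w‖ := norm_le_norm_sub_add _ _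
  have hb2 : ‖(1/2 : ℝ) • w‖ ≤ ‖y - (1/2 : ℝ) • w‖ + ‖y‖ := by
    rw [norm_sub_rev]; exact norm_le_norm_sub_add _ _
  constructor
  · rw [mem_ball_zero_iff]; linarith
  have hy0 : y ≠ 0 := by intro h0; rw [h0, norm_zero] at hb2; rw [h0] at hy; linarith
  have hwne : (1/2 : ℝ) • w ≠ 0 := by intro h0; rw [h0, norm_zero] at hw2; linarith
  have hl := ht_lip hy0 hwne
  rw [hw2, ht_smul (by norm_num), ht_unit hw] at hl
  have hd : ‖p - w‖^2 = 2 - 2 * inner ℝ p w := by rw [norm_sub_sq_real, hp, hw]; ring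
  have hd2 : (7/10 : ℝ) ≤ ‖p - w‖ := by
    by_contra hlt
    push Not at hlt
    nlinarith [norm_nonneg (p - w)]
  have := norm_sub_le_norm_sub_add_norm_sub p (ht y) w
  rw [norm_sub_rev p (ht y)] at this
  linarith

lemma step4 [Nontrivial V] (h2 : 2 ≤ finrank ℝ V) {f : V → ℝ} (hf : Measurable f) :
    volume (ball (0:V) (1/16)) * ∫⁻ x in ball (0:V) 1, ∫⁻ z in ball (0:V) 1, ENNReal.ofReal ((f z - f x) ^ 2) ≤
    8 * volume (ball (0:V) 1) * ∫⁻ y in ball (0:V) 1, ∫⁻ z in ball (0:V) 1, {z : V | 2 * (1/5 : ℝ) ≤ ‖ht z - ht y‖}.indicator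
      (fun z => ENNReal.ofReal ((max (f y - f z) 0) ^ 2)) z := by
  have hhm := ht_meas (V := V)
  have mF : MeasurableSet {p : V × V | 2 * (1/5 : ℝ) ≤ ‖ht p.2 - ht p.1‖} := measurableSet_le measurable_const (by fun_prop)
  set N : V × V → ℝ≥0∞ := {p : V × V | 2 * (1/5 : ℝ) ≤ ‖ht p.2 - ht p.1‖}.indicator
    (fun p => ENNReal.ofReal ((max (f p.1 - f p.2) 0) ^ 2)) with hN
  have Nm : Measurable N := Measurable.indicator (by fun_prop) mF
  have mF1 : ∀ x, MeasurableSet {z : V | 2 * (1/5 : ℝ) ≤ ‖ht z - ht x‖} := fun x =>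
    measurableSet_le measurable_const (by fun_prop)
  set T := ∫⁻ y in ball (0:V) 1, ∫⁻ z in ball (0:V) 1, {z : V | 2 * (1/5 : ℝ) ≤ ‖ht z - ht y‖}.indicator
      (fun z => ENNReal.ofReal ((max (f y - f z) 0) ^ 2)) z with hT
  have T1 : T = ∫⁻ y in ball (0:V) 1, ∫⁻ z in ball (0:V) 1, N (y, z) := rfl
  have T2 : T = ∫⁻ y in ball (0:V) 1, ∫⁻ z in ball (0:V) 1, N (z, y) := by
    rw [T1, lintegral_lintegral_swap (f := fun y z => N (y, z)) (by exact Nm.aemeasurable)]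
  set G : V → ℝ≥0∞ := fun x => ∫⁻ y in ball (0:V) 1, (N (x, y) + N (y, x)) with hG
  have Gm : Measurable G :=
    Measurable.lintegral_prod_right' (f := fun p : V × V => N (p.1, p.2) + N (p.2, p.1)) (by fun_prop)
  have GT : ∫⁻ x in ball (0:V) 1, G x = 2 * T := by
    have : ∀ x, G x = (∫⁻ y in ball (0:V) 1, N (x, y)) + ∫⁻ y in ball (0:V) 1, N (y, x) := fun x => by
      rw [hG]; exact lintegral_add_left (by fun_prop) _
    simp_rw [this]
    rw [lintegral_add_left (Measurable.lintegral_prod_right' Nm), ← T1, ← T2, two_mul]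
  have hN2 : ∀ x y : V, 2 * (1/5 : ℝ) ≤ ‖ht y - ht x‖ → ENNReal.ofReal ((f x - f y)^2) ≤ N (x, y) + N (y, x) := by
    intro x y hxy
    have hxy' : 2 * (1/5 : ℝ) ≤ ‖ht x - ht y‖ := by rwa [norm_sub_rev]
    simp only [hN, indicator, mem_setOf_eq, hxy, hxy', if_true]
    rcases le_total (f x) (f y) with h | h
    · rw [max_eq_left (sub_nonneg.2 h)]
      refine le_add_left (le_of_eq ?_); congr 1; ring
    · rw [max_eq_left (sub_nonneg.2 h)]
      exact le_self_add
  have key : ∀ x z : V, x ≠ 0 → z ≠ 0 → volume (ball (0:V) (1/16)) * ENNReal.ofReal ((f z - f x)^2) ≤ 2 * G x + 2 * G z := by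
    intro x z hx hz
    obtain ⟨w, hw, hw1, hw2⟩ := exists_dir h2 (ht_norm hx) (ht_norm hz)
    have hsub : ball ((1/2 : ℝ) • w) (1/16) ⊆ ball (0:V) 1 := fun y hy => (dir_far hw (ht_norm hx) hw1 hy).1
    calc _ = ∫⁻ y in ball ((1/2 : ℝ) • w) (1/16), ENNReal.ofReal ((f z - f x)^2) := by
          rw [setLIntegral_const, mul_comm]; congr 1; exact (Measure.addHaar_ball_center _ _ _).symm
      _ ≤ ∫⁻ y in ball ((1/2 : ℝ) • w) (1/16), (2 * (N (x, y) + N (y, x)) + 2 * (N (z, y) + N (y, z))) := by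
          apply setLIntegral_mono' measurableSet_ball
          intro y hy
          have a1 := hN2 x y (dir_far hw (ht_norm hx) hw1 hy).2
          have a2 := hN2 z y (dir_far hw (ht_norm hz) hw2 hy).2
          refine le_trans ?_ (add_le_add (mul_le_mul_right a1 2) (mul_le_mul_right a2 2))
          rw [← ENNReal.ofReal_ofNat, ← ENNReal.ofReal_mul (by norm_num), ← ENNReal.ofReal_mul (by norm_num),
            ← ENNReal.ofReal_add (by positivity) (by positivity)]
          apply ENNReal.ofReal_le_ofReal
          nlinarith [sq_nonneg ((f z - f y) + (f x - f y))]
      _ ≤ ∫⁻ y in ball (0:V) 1, (2 * (N (x, y) + N (y, x)) + 2 * (N (z, y) + N (y, z))) := lintegral_mono_set hsub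
      _ = _ := by
          rw [lintegral_add_left (by fun_prop), lintegral_const_mul' _ _ (by simp), lintegral_const_mul' _ _ (by simp)]
  calc _ = ∫⁻ x in ball (0:V) 1, ∫⁻ z in ball (0:V) 1, volume (ball (0:V) (1/16)) * ENNReal.ofReal ((f z - f x) ^ 2) := by
        rw [← lintegral_const_mul' _ _ measure_ball_lt_top.ne]
        congr 1; ext x
        rw [lintegral_const_mul' _ _ measure_ball_lt_top.ne]
    _ ≤ ∫⁻ x in ball (0:V) 1, ∫⁻ z in ball (0:V) 1, (2 * G x + 2 * G z) := by
        apply lintegral_mono_ae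
        filter_upwards [ae_ne0 (ball (0:V) 1)] with x hx
        apply lintegral_mono_ae
        filter_upwards [ae_ne0 (ball (0:V) 1)] with z hz
        exact key x z hx hz
    _ = ∫⁻ x in ball (0:V) 1, (2 * volume (ball (0:V) 1) * G x + 2 * (2 * T)) := by
        congr 1; ext x
        rw [lintegral_add_left (by fun_prop), setLIntegral_const, lintegral_const_mul' _ _ (by simp), GT]
        ring
    _ = _ := by
        rw [lintegral_add_left (by fun_prop), setLIntegral_const,
          lintegral_const_mul' _ _ (ENNReal.mul_ne_top (by simp) measure_ball_lt_top.ne), GT]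
        ring

end
end Mf

namespace Mf
open InnerProductSpace Module TopologicalSpace
section
variable {V : Type*} [NormedAddCommGroup V] [InnerProductSpace ℝ V] [FiniteDimensional ℝ V]
  [MeasurableSpace V] [BorelSpace V]

lemma inv_move {x M y : ℝ≥0∞} (h0 : x ≠ 0) (ht : x ≠ ⊤) (h : x * M ≤ y) : M ≤ x⁻¹ * y := by
  calc M = x⁻¹ * (x * M) := by rw [← mul_assoc, ENNReal.inv_mul_cancel h0 ht, one_mul]
    _ ≤ _ := mul_le_mul_right h _

lemma gainu_le [Nontrivial V] {u : V} (hu : ‖u‖ = 1) {E : Set V} (hc : Convex ℝ E) (hE : IsCompact E) (hne : E.Nonempty)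
    {r R : ℝ} (hr : 0 < r) (hv : volume (ball (0:V) R) ≤ volume E) :
    volume (thickening r E) - volume (thickening r (stn u E)) ≤
      volume (thickening r E) - volume (ball (0:V) (R + r)) := by
  apply tsub_le_tsub_left
  apply bm (stn_convex u hc) (stn_compact u hE) (stn_nonempty u hne) hr
  rwa [stn_volume hu hc hE]

def Yq (A : Set V) (ρ : ℝ) : ℝ≥0∞ := ∫⁻ y in ball (0:V) 1, ENNReal.ofReal ((ff A y - ρ ^ finrank ℝ V) ^ 2)

lemma ff_abs {A : Set V} {a b ρ : ℝ} (ha : 0 < a) (h1 : ball (0:V) a ⊆ A) (hb : 0 < b) (h2 : A ⊆ ball (0:V) b) (hρ : 0 < ρ) (x : V) :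
    |ff A x - ρ ^ finrank ℝ V| ≤ b ^ finrank ℝ V + ρ ^ finrank ℝ V := by
  have := ff_ub ha h1 hb h2 x
  have := ff_nonneg (A := A) x
  have : 0 ≤ ρ ^ finrank ℝ V := by positivity
  rw [abs_le]; constructor <;> linarith

lemma sd_sq_le {A : Set V} {a b ρ : ℝ} (hc : Convex ℝ A) (ha : 0 < a) (h1 : ball (0:V) a ⊆ A) (hb : 0 < b)
    (h2 : A ⊆ ball (0:V) b) (hρ : 0 < ρ) :
    ENNReal.ofReal ((∫⁻ y in ball (0:V) 1, ENNReal.ofReal |ff A y - ρ ^ finrank ℝ V|).toReal ^ 2) ≤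
      volume (ball (0:V) 1) * Yq A ρ := by
  have hfm := ff_meas hc ha h1
  have hgm : Measurable (fun y => |ff A y - ρ ^ finrank ℝ V|) := (hfm.sub_const _).norm
  have hM := ff_abs ha h1 hb h2 hρ
  haveI : IsFiniteMeasure (volume.restrict (ball (0:V) 1)) := ⟨by simpa using measure_ball_lt_top⟩
  have := int_sq_le (volume.restrict (ball (0:V) 1)) hgm (M := b ^ finrank ℝ V + ρ ^ finrank ℝ V)
    (fun x => by rw [abs_abs]; exact hM x)
  have hi2 : Integrable (fun y => |ff A y - ρ ^ finrank ℝ V| ^ 2) (volume.restrict (ball (0:V) 1)) := by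
    apply Integrable.of_bound (hgm.pow_const 2).aestronglyMeasurable ((b ^ finrank ℝ V + ρ ^ finrank ℝ V)^2)
    filter_upwards with x
    rw [Real.norm_eq_abs, abs_pow, abs_abs]
    exact pow_le_pow_left₀ (abs_nonneg _) (hM x) 2
  rw [← integral_eq_lintegral_of_nonneg_ae (by filter_upwards with x using abs_nonneg _) hgm.aestronglyMeasurable]
  refine (ENNReal.ofReal_le_ofReal this).trans ?_
  rw [ENNReal.ofReal_mul ENNReal.toReal_nonneg, ENNReal.ofReal_toReal (by simpa using measure_ball_lt_top.ne),
    ofReal_integral_eq_lintegral_ofReal hi2 (by filter_upwards with x; positivity)]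
  simp only [sq_abs, Measure.restrict_apply_univ]
  exact le_rfl

lemma perU [Nontrivial V] {r ρ : ℝ} (hr : 0 < r) (hρ : r < ρ) :
    ∃ C2 : ℝ≥0∞, C2 ≠ ⊤ ∧ ∀ τ : ℝ, 0 < τ → τ ≤ 1/100 → ∃ C1 : ℝ≥0∞, C1 ≠ ⊤ ∧
      ∀ E : Set V, Convex ℝ E → IsCompact E → E.Nonempty → volume (ball (0:V) (ρ - r)) ≤ volume E →
      ball (0:V) (ρ * (1 - τ/2)) ⊆ thickening r E → thickening r E ⊆ ball (0:V) (ρ * (1 + τ/2)) →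
      (∀ u : V, ∫ x in thickening r E, inner ℝ x u = 0) → ∀ u : V, ‖u‖ = 1 →
      ∫⁻ y in ball (0:V) 1, {x : V | (1/5 : ℝ) * ‖x‖ ≤ |inner ℝ x u|}.indicator
        (fun y => ENNReal.ofReal ((max (ff (thickening r E) y - ff (thickening r E) (sg u y)) 0) ^ 2)) y ≤
      C1 * (volume (thickening r E) - volume (ball (0:V) ρ)) + C2 * ENNReal.ofReal τ * Yq (thickening r E) ρ := by
  have hρ0 : 0 < ρ := hr.trans hρ
  set n := finrank ℝ V with hn
  set c0 : ℝ≥0∞ := volume (ball (0:V) (ρ/4)) with hc0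
  have hc0p : c0 ≠ 0 := (measure_ball_pos _ _ (by positivity)).ne'
  have hc0t : c0 ≠ ⊤ := measure_ball_lt_top.ne
  set k0 : ℝ≥0∞ := (ENNReal.ofReal ρ)⁻¹ * volume (ball (0:V) (2*ρ)) with hk0
  have hρe : ENNReal.ofReal ρ ≠ 0 := by simpa using hρ0
  have hk0t : k0 ≠ ⊤ := ENNReal.mul_ne_top (ENNReal.inv_ne_top.2 hρe) measure_ball_lt_top.ne
  set P : ℝ≥0∞ := ENNReal.ofReal (4 * n * (2*ρ) ^ n) * (ENNReal.ofReal (ρ/2)⁻¹ * (c0^2)⁻¹) with hP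
  have hPt : P ≠ ⊤ := ENNReal.mul_ne_top ENNReal.ofReal_ne_top (ENNReal.mul_ne_top ENNReal.ofReal_ne_top
    (ENNReal.inv_ne_top.2 (pow_ne_zero _ hc0p)))
  refine ⟨P * (ENNReal.ofReal (32*ρ^2) * volume (ball (0:V) 1) * k0), ?_, ?_⟩
  · exact ENNReal.mul_ne_top hPt (ENNReal.mul_ne_top (ENNReal.mul_ne_top ENNReal.ofReal_ne_top measure_ball_lt_top.ne) hk0t)
  intro τ hτ hτ1
  set Q : ℝ≥0∞ := ENNReal.ofReal ((2*ρ) ^ 2 * (4 * (4 * (2*ρ) / (ρ*(τ/2))) ^ 3 / r)) with hQ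
  refine ⟨P * (ENNReal.ofReal (8*(2*ρ)^2) * k0 * (Q * (2^n * k0))), ?_, ?_⟩
  · refine ENNReal.mul_ne_top hPt (ENNReal.mul_ne_top (ENNReal.mul_ne_top ENNReal.ofReal_ne_top hk0t)
      (ENNReal.mul_ne_top ENNReal.ofReal_ne_top (ENNReal.mul_ne_top (by simp) hk0t)))
  intro E hc hE hne hv h1 h2 h0 u hu
  set A := thickening r E with hAdef
  have hA : IsOpen A := isOpen_thickening
  have hcA : Convex ℝ A := hc.thickening r
  set a := ρ * (1 - τ/2) with ha
  set b := ρ * (1 + τ/2) with hb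
  set d := ρ * (1 - τ) with hd
  have ha0 : 0 < a := by apply mul_pos hρ0; linarith
  have hb0 : 0 < b := by apply mul_pos hρ0; linarith
  have hd0 : 0 < d := by apply mul_pos hρ0; linarith
  have hb2 : b ≤ 2 * ρ := by rw [hb]; nlinarith
  have hd2 : ρ/2 ≤ d := by rw [hd]; nlinarith
  have ha2 : ρ/2 ≤ a := by rw [ha]; nlinarith
  have hdρ : d ≤ ρ := by rw [hd]; nlinarith
  have hda : d < a := by rw [hd, ha]; nlinarith
  have had : a/2 ≤ d := by rw [hd, ha]; nlinarith
  have hdd : (1 - (1/5:ℝ)^2) * b^2 ≤ d^2 := by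
    rw [hb, hd, mul_pow, mul_pow]
    have : (1 - (1/5:ℝ)^2) * (1+τ/2)^2 ≤ (1-τ)^2 := by nlinarith
    nlinarith [sq_nonneg ρ]
  set D := closedBall (0 : Ku u) d with hD
  have hκ : volume D ≤ k0 := by
    apply inv_move hρe ENNReal.ofReal_ne_top
    rw [mul_comm]
    calc volume D * ENNReal.ofReal ρ ≤ volume D * ENNReal.ofReal (2*d) :=
          mul_le_mul_right (ENNReal.ofReal_le_ofReal (by linarith)) _
      _ ≤ volume (ball (0:V) (2*d)) := volK hu hd0
      _ ≤ _ := measure_mono (ball_subset_ball (by linarith))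
  have hDt : volume (closedBall (0 : Ku u) (a/2)) ≠ ⊤ := measure_closedBall_lt_top.ne
  have hκ' : c0^2 ≤ ENNReal.ofReal ((a * (volume (closedBall (0 : Ku u) (a/2))).toReal) ^ 2) := by
    rw [ENNReal.ofReal_pow (by positivity)]
    apply pow_le_pow_left' 
    rw [ENNReal.ofReal_mul ha0.le, ENNReal.ofReal_toReal hDt]
    calc c0 ≤ volume (ball (0:V) (a/2)) := measure_mono (ball_subset_ball (by linarith))
      _ ≤ volume (ball (0 : Ku u) (a/2)) * ENNReal.ofReal (2*(a/2)) := volK' hu (by positivity)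
      _ ≤ volume (closedBall (0 : Ku u) (a/2)) * ENNReal.ofReal (2*(a/2)) := mul_le_mul_left (measure_mono ball_subset_closedBall) _
      _ = _ := by rw [mul_comm]; congr 2; ring
  have hcol := col hu hc hE hr (ρ1 := ρ*(τ/2)) (by positivity) (c0 := 0) h2 (D := D) (convex_closedBall _ _) measurableSet_closedBall
    (by
      intro k hk
      refine ⟨0, (ball_subset_ball' ?_).trans h1⟩
      have hk' : ‖(k:V)‖ ≤ d := by simpa [hD] using hk
      simp only [zero_smul, add_zero, dist_zero_right]
      rw [ha]; rw [hd] at hk'; nlinarith)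
    (M := 2*ρ) (by
      intro k hk k' hk'
      rw [hD, mem_closedBall_zero_iff] at hk hk'
      calc _ ≤ ‖k'‖ + ‖k‖ := norm_sub_le _ _
        _ ≤ _ := by linarith)
  have hgu := gainu_le hu hc hE hne hr hv
  rw [sub_add_cancel] at hgu
  set g := volume A - volume (ball (0:V) ρ) with hg
  have hfin : finrank ℝ (Ku u) ≤ n := Submodule.finrank_le _
  have hcol' : ∫⁻ k in D, ∫⁻ k' in D, ENNReal.ofReal ((mid u A k' - mid u A k) ^ 2) ≤ Q * (2^n * k0 * g) := by
    refine hcol.trans ?_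
    apply mul_le_mul' (ENNReal.ofReal_le_ofReal _) (mul_le_mul' (mul_le_mul' _ hκ) hgu)
    · have : (4 * b / (ρ * (τ/2))) ≤ (4 * (2*ρ) / (ρ * (τ/2))) := by gcongr
      have h3 : 0 ≤ 4 * b / (ρ * (τ/2)) := by positivity
      gcongr
    · exact pow_le_pow_right₀ (by norm_num) hfin
  have hs1 := step1 hu hA hcA ha0 h1 hb0 h2 (ρ := ρ) (by rw [hb]; nlinarith) had hda (h0 u)
  rw [vol_sd hA hcA ha0 h1 hb0 h2 hρ0] at hs1
  have hbd : 8 * (b^2 - d^2) ≤ 32*ρ^2*τ := by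
    rw [hb, hd]
    have : (1+τ/2)^2 - (1-τ)^2 ≤ 4 * τ := by nlinarith
    nlinarith [sq_nonneg ρ]
  have hbd0 : 0 ≤ b^2 - d^2 := by
    have : d ≤ b := by rw [hb, hd]; nlinarith
    nlinarith
  have hM2 : ∫⁻ k in D, ENNReal.ofReal (mid u A k ^ 2) ≤ (c0^2)⁻¹ *
      (ENNReal.ofReal (8*(2*ρ)^2) * k0 * (Q * (2^n * k0 * g)) +
        ENNReal.ofReal (32*ρ^2*τ) * (volume (ball (0:V) 1) * Yq A ρ) * k0) := by
    apply inv_move (pow_ne_zero _ hc0p) (ENNReal.pow_ne_top hc0t)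
    refine (mul_le_mul_left hκ' _).trans (hs1.trans ?_)
    apply add_le_add
    · exact mul_le_mul' (mul_le_mul' (ENNReal.ofReal_le_ofReal (by gcongr)) hκ) hcol'
    · rw [ENNReal.ofReal_mul (by positivity)]
      exact mul_le_mul' (mul_le_mul' (ENNReal.ofReal_le_ofReal hbd) (sd_sq_le hcA ha0 h1 hb0 h2 hρ0)) hκ
  refine (theta_lb hA hcA ha0 h1 hb0 h2 (1/5)).trans ?_
  calc _ ≤ ENNReal.ofReal (4 * n * (2*ρ) ^ n) * (ENNReal.ofReal (ρ/2)⁻¹ * ((c0^2)⁻¹ *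
      (ENNReal.ofReal (8*(2*ρ)^2) * k0 * (Q * (2^n * k0 * g)) +
        ENNReal.ofReal (32*ρ^2*τ) * (volume (ball (0:V) 1) * Yq A ρ) * k0))) := by
        apply mul_le_mul' (ENNReal.ofReal_le_ofReal (by gcongr))
        refine (step2 hu hA hcA ha0 h1 h2 (by norm_num) (by norm_num) hd0.le hdd).trans ?_
        exact mul_le_mul' (ENNReal.ofReal_le_ofReal (by gcongr)) hM2
    _ = _ := by
        rw [hP, ENNReal.ofReal_mul (p := 32*ρ^2) (by positivity)]; ring

end
end Mf

namespace Mf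
open InnerProductSpace Module TopologicalSpace
section
variable {V : Type*} [NormedAddCommGroup V] [InnerProductSpace ℝ V] [FiniteDimensional ℝ V]
  [MeasurableSpace V] [BorelSpace V]

lemma ff_smul (A : Set V) (t : ℝ) (ht0 : 0 < t) (x : V) : ff A (t • x) = ff A x := by
  unfold ff; rw [rad_smul ht0]

lemma Yq_lt_top {A : Set V} {a b ρ : ℝ} (ha : 0 < a) (h1 : ball (0:V) a ⊆ A) (hb : 0 < b)
    (h2 : A ⊆ ball (0:V) b) (hρ : 0 < ρ) : Yq A ρ ≠ ⊤ := by
  have : Yq A ρ ≤ ∫⁻ y in ball (0:V) 1, ENNReal.ofReal ((b ^ finrank ℝ V + ρ ^ finrank ℝ V)^2) := by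
    apply lintegral_mono
    intro y
    apply ENNReal.ofReal_le_ofReal
    rw [← sq_abs]
    exact pow_le_pow_left₀ (abs_nonneg _) (ff_abs ha h1 hb h2 hρ y) 2
  rw [setLIntegral_const] at this
  exact ne_top_of_le_ne_top (ENNReal.mul_ne_top ENNReal.ofReal_ne_top measure_ball_lt_top.ne) this

lemma vol_ball_pow [Nontrivial V] {ρ : ℝ} (hρ : 0 < ρ) : volume (ball (0:V) ρ) = ENNReal.ofReal (ρ ^ finrank ℝ V) * volume (ball (0:V) 1) := by
  rw [Measure.addHaar_ball _ _ hρ.le]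

lemma gain_eq [Nontrivial V] {A : Set V} {a b ρ : ℝ} (hA : IsOpen A) (hc : Convex ℝ A) (ha : 0 < a) (h1 : ball (0:V) a ⊆ A) (hb : 0 < b)
    (h2 : A ⊆ ball (0:V) b) (hρ : 0 < ρ) (hv : volume (ball (0:V) ρ) ≤ volume A) :
    ∫ y in ball (0:V) 1, (ff A y - ρ ^ finrank ℝ V) = (volume A - volume (ball (0:V) ρ)).toReal := by
  have hAt : volume A ≠ ⊤ := ne_top_of_le_ne_top measure_ball_lt_top.ne (measure_mono h2)
  have hfm := ff_meas hc ha h1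
  haveI : IsFiniteMeasure (volume.restrict (ball (0:V) 1)) := ⟨by simpa using measure_ball_lt_top⟩
  have hfi : Integrable (ff A) (volume.restrict (ball (0:V) 1)) := by
    apply Integrable.of_bound hfm.aestronglyMeasurable (b ^ finrank ℝ V)
    filter_upwards with x
    rw [Real.norm_eq_abs, abs_of_nonneg (ff_nonneg x)]
    exact ff_ub ha h1 hb h2 x
  rw [integral_sub hfi (integrable_const _), ENNReal.toReal_sub_of_le hv hAt, vol_ff hA hc ha h1 hb h2,
    vol_ball_pow hρ, integral_eq_lintegral_of_nonneg_ae (by filter_upwards with x using ff_nonneg x) hfm.aestronglyMeasurable]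
  congr 1
  simp [measureReal_def, ENNReal.toReal_mul, ENNReal.toReal_ofReal (pow_nonneg hρ.le _), mul_comm]

lemma absorb {Y x K : ℝ≥0∞} (hY : Y ≠ ⊤) (hK : K ≤ 1/2) (h : Y ≤ x + K * Y) : Y ≤ 2 * x := by
  have h1 : Y ≤ x + Y / 2 := h.trans (by
    gcongr
    rw [ENNReal.div_eq_inv_mul]; exact mul_le_mul_left (by simpa using hK) _)
  have h2 : Y / 2 ≤ x := by
    have : Y / 2 + Y / 2 ≤ x + Y / 2 := by rwa [ENNReal.add_halves]
    exact (ENNReal.add_le_add_iff_right (ENNReal.div_ne_top hY (by norm_num))).1 this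
  calc Y = 2 * (Y / 2) := by rw [ENNReal.mul_div_cancel (by norm_num) (by norm_num)]
    _ ≤ _ := mul_le_mul_right h2 _

lemma small_tau {C : ℝ≥0∞} (hC : C ≠ ⊤) : ∃ τ : ℝ, 0 < τ ∧ τ ≤ 1/100 ∧ C * ENNReal.ofReal τ ≤ 1/2 := by
  refine ⟨min (1/100) (1 / (2 * (C.toReal + 1))), by positivity, min_le_left _ _, ?_⟩
  have hp : 0 ≤ C.toReal := ENNReal.toReal_nonneg
  have h : C.toReal * min (1/100) (1 / (2 * (C.toReal + 1))) ≤ 1/2 := by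
    calc _ ≤ C.toReal * (1 / (2 * (C.toReal + 1))) := by gcongr; exact min_le_right _ _
      _ ≤ _ := by rw [mul_one_div, div_le_div_iff₀ (by positivity) (by norm_num)]; linarith
  calc C * _ = ENNReal.ofReal (C.toReal * min (1/100) (1 / (2 * (C.toReal + 1)))) := by
        rw [ENNReal.ofReal_mul hp, ENNReal.ofReal_toReal hC]
    _ ≤ ENNReal.ofReal (1/2) := ENNReal.ofReal_le_ofReal h
    _ = _ := by rw [ENNReal.ofReal_div_of_pos (by norm_num)]; simp

lemma quant [Nontrivial V] (hn2 : 2 ≤ finrank ℝ V) {r ρ : ℝ} (hr : 0 < r) (hρ : r < ρ) :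
    ∃ τ : ℝ, 0 < τ ∧ τ ≤ 1/100 ∧ ∃ C : ℝ≥0∞, C ≠ ⊤ ∧
      ∀ E : Set V, Convex ℝ E → IsCompact E → E.Nonempty → volume (ball (0:V) (ρ - r)) ≤ volume E →
      ball (0:V) (ρ * (1 - τ/2)) ⊆ thickening r E → thickening r E ⊆ ball (0:V) (ρ * (1 + τ/2)) →
      (∀ u : V, ∫ x in thickening r E, inner ℝ x u = 0) →
      Wd (thickening r E) ρ ≤ C * (volume (thickening r E) - volume (ball (0:V) ρ)) := by
  have hρ0 : 0 < ρ := hr.trans hρ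
  obtain ⟨C2, hC2, H⟩ := perU (V := V) hr hρ
  set n := finrank ℝ V with hn
  set U := volume (ball (0:V) 1) with hU
  set c := volume (ball (0:V) (1/16)) with hcc
  have hU0 : U ≠ 0 := (measure_ball_pos _ _ one_pos).ne'
  have hUt : U ≠ ⊤ := measure_ball_lt_top.ne
  have hc0 : c ≠ 0 := (measure_ball_pos _ _ (by norm_num)).ne'
  have hct : c ≠ ⊤ := measure_ball_lt_top.ne
  set G : ℝ≥0∞ := (U^2)⁻¹ * (2 * U * (c⁻¹ * (8 * U * (7^n * U)))) with hG
  have hGt : G ≠ ⊤ := by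
    refine ENNReal.mul_ne_top (ENNReal.inv_ne_top.2 (pow_ne_zero _ hU0)) (ENNReal.mul_ne_top (ENNReal.mul_ne_top (by simp) hUt)
      (ENNReal.mul_ne_top (ENNReal.inv_ne_top.2 hc0) (ENNReal.mul_ne_top (ENNReal.mul_ne_top (by simp) hUt) (ENNReal.mul_ne_top (by simp) hUt))))
  obtain ⟨τ, hτ, hτ1, hτ2⟩ := small_tau (ENNReal.mul_ne_top hGt hC2)
  obtain ⟨C1, hC1, H⟩ := H τ hτ hτ1
  set B2 := volume (ball (0:V) (2*ρ)) with hB2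
  have hB2t : B2 ≠ ⊤ := measure_ball_lt_top.ne
  refine ⟨τ, hτ, hτ1, ENNReal.ofReal ((ρ^(n-1))⁻¹) * (2 * (G * C1 + (U^2)⁻¹ * (2 * B2 * U))), ?_, ?_⟩
  · refine ENNReal.mul_ne_top ENNReal.ofReal_ne_top (ENNReal.mul_ne_top (by simp) (ENNReal.add_ne_top.2 ⟨ENNReal.mul_ne_top hGt hC1,
      ENNReal.mul_ne_top (ENNReal.inv_ne_top.2 (pow_ne_zero _ hU0)) (ENNReal.mul_ne_top (ENNReal.mul_ne_top (by simp) hB2t) hUt)⟩))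
  intro E hc hE hne hv h1 h2 h0
  have H := H E hc hE hne hv h1 h2 h0
  have hvA : volume (ball (0:V) ρ) ≤ volume (thickening r E) := by
    have := bm hc hE hne hr hv
    rwa [sub_add_cancel] at this
  set A := thickening r E with hAdef
  have hA : IsOpen A := isOpen_thickening
  have hcA : Convex ℝ A := hc.thickening r
  set a := ρ * (1 - τ/2) with ha
  set b := ρ * (1 + τ/2) with hb
  have ha0 : 0 < a := by apply mul_pos hρ0; linarith
  have hb0 : 0 < b := by apply mul_pos hρ0; linarith
  have hb2 : b ≤ 2 * ρ := by rw [hb]; nlinarith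
  have hfm := ff_meas hcA ha0 h1
  set g := volume A - volume (ball (0:V) ρ) with hg
  have hgB : g ≤ B2 := tsub_le_self.trans (measure_mono (h2.trans (ball_subset_ball hb2)))
  have hgt : g ≠ ⊤ := ne_top_of_le_ne_top hB2t hgB
  set K := C1 * g + C2 * ENNReal.ofReal τ * Yq A ρ with hK
  have s3 := step3 hfm (ff_smul A) (η := 1/5) (by norm_num) H
  have s4 := step4 hn2 hfm
  have hdbl := inv_move hc0 hct (s4.trans (mul_le_mul_right s3 _))
  haveI : IsFiniteMeasure (volume.restrict (ball (0:V) 1)) := ⟨by simpa using measure_ball_lt_top⟩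
  have w := wmean (volume.restrict (ball (0:V) 1)) (l := fun _ => 1) (b := fun y => ff A y - ρ ^ n) measurable_const
    (hfm.sub_const _) (L := 1) (M := b ^ n + ρ ^ n) (by simp) (ff_abs ha0 h1 hb0 h2 hρ0)
  have hge : ∫ y in ball (0:V) 1, (ff A y - ρ ^ n) = g.toReal := gain_eq hA hcA ha0 h1 hb0 h2 hρ0 hvA
  simp only [one_mul, sub_sub_sub_cancel_right, Measure.restrict_apply_univ] at w
  rw [hge] at w
  have hU2 : ENNReal.ofReal ((∫ x in ball (0:V) 1, (1:ℝ)) ^ 2) = U^2 := by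
    rw [ENNReal.ofReal_pow (by positivity)]
    simp only [integral_const, smul_eq_mul, mul_one, measureReal_def, Measure.restrict_apply_univ]
    rw [ENNReal.ofReal_toReal hUt]
  rw [hU2] at w
  have hg2 : ENNReal.ofReal (2 * g.toReal ^ 2) ≤ 2 * B2 * g := by
    rw [ENNReal.ofReal_mul (by norm_num), ENNReal.ofReal_pow ENNReal.toReal_nonneg, ENNReal.ofReal_toReal hgt, sq, mul_assoc]
    simp only [ENNReal.ofReal_ofNat]
    exact mul_le_mul_right (mul_le_mul_left hgB _) _
  have hY : Yq A ρ ≤ (U^2)⁻¹ * (2 * U * (c⁻¹ * (8 * U * (7^n * (K * U)))) + 2 * B2 * g * U) := by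
    apply inv_move (pow_ne_zero _ hU0) (ENNReal.pow_ne_top hUt)
    refine w.trans (add_le_add (mul_le_mul' (mul_le_mul_left (by norm_num) _) hdbl) (mul_le_mul_left hg2 _))
  have hY' : Yq A ρ ≤ (G * C1 + (U^2)⁻¹ * (2 * B2 * U)) * g + (G * C2 * ENNReal.ofReal τ) * Yq A ρ := by
    refine hY.trans (le_of_eq ?_)
    rw [hK, hG]; ring
  have := absorb (Yq_lt_top ha0 h1 hb0 h2 hρ0) hτ2 hY'
  refine (W_le hA hcA ha0 h1 hb0 h2 hρ0).trans ?_
  rw [mul_assoc]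
  refine mul_le_mul_right (this.trans (le_of_eq (by ring))) _

end
end Mf

namespace Mf
open InnerProductSpace Module TopologicalSpace
section
variable {V : Type*} [NormedAddCommGroup V] [InnerProductSpace ℝ V] [FiniteDimensional ℝ V]
  [MeasurableSpace V] [BorelSpace V]

lemma vol_expand {P Q : Set V} {T : V → V} (h : ∀ x ∈ P, T x ∈ Q) (he : ∀ x ∈ P, ∀ y ∈ P, dist x y ≤ dist (T x) (T y)) :
    volume P ≤ volume Q := by
  have hinj : InjOn T P := by
    intro x hx y hy hxy
    have := he x hx y hy
    rw [hxy, dist_self] at this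
    exact dist_le_zero.1 this
  set g := Function.invFunOn T P with hg
  have hgT : ∀ x ∈ P, g (T x) = x := fun x hx => hinj.leftInvOn_invFunOn hx
  have hl : LipschitzOnWith 1 g (T '' P) := by
    apply LipschitzOnWith.of_dist_le_mul
    rintro _ ⟨x, hx, rfl⟩ _ ⟨y, hy, rfl⟩
    rw [hgT x hx, hgT y hy]; simpa using he x hx y hy
  have hP : g '' (T '' P) = P := by
    rw [← image_comp]
    ext x; constructor
    · rintro ⟨y, hy, rfl⟩; simpa [hgT y hy] using hy
    · intro hx; exact ⟨x, hx, hgT x hx⟩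
  have := vol_lip_image hl
  rw [hP] at this
  simp only [ENNReal.coe_one, one_pow, one_mul] at this
  exact this.trans (measure_mono (by rintro _ ⟨x, hx, rfl⟩; exact h x hx))

lemma transport {S S' : Set V} (hS : MeasurableSet S) (hS' : MeasurableSet S') {w w' : V → ℝ} (hw : Measurable w) (hw' : Measurable w')
    (T : V → V) (hT : ∀ x ∈ S, T x ∈ S' ∧ w x ≤ w' (T x)) (he : ∀ x ∈ S, ∀ y ∈ S, dist x y ≤ dist (T x) (T y)) :
    ∫⁻ x in S, ENNReal.ofReal (w x) ≤ ∫⁻ x in S', ENNReal.ofReal (w' x) := by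
  have e : ∀ x, ENNReal.ofReal (w x) = ENNReal.ofReal (max (w x) 0) := fun x => by simp
  have e' : ∀ x, ENNReal.ofReal (w' x) = ENNReal.ofReal (max (w' x) 0) := fun x => by simp
  simp_rw [e, e']
  rw [lintegral_eq_lintegral_meas_lt _ (by filter_upwards with x using le_max_right _ _) (by fun_prop),
    lintegral_eq_lintegral_meas_lt _ (by filter_upwards with x using le_max_right _ _) (by fun_prop)]
  apply lintegral_mono
  intro t
  simp only []
  rw [Measure.restrict_apply' hS, Measure.restrict_apply' hS']
  apply vol_expand (T := T)
  · rintro x ⟨hx1, hx2⟩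
    exact ⟨lt_of_lt_of_le hx1 (max_le_max_right _ (hT x hx2).2), (hT x hx2).1⟩
  · intro x hx y hy
    exact he x hx.2 y hy.2

lemma expand {x y nx ny : V} {r : ℝ} (hr : 0 ≤ r) (h : 0 ≤ inner ℝ (x - y) (nx - ny)) :
    dist x y ≤ dist (x + r • nx) (y + r • ny) := by
  rw [dist_eq_norm, dist_eq_norm]
  have : x + r • nx - (y + r • ny) = (x - y) + r • (nx - ny) := by module
  rw [this]
  apply le_of_sq_le_sq _ (norm_nonneg _)
  rw [norm_add_sq_real, inner_smul_right]
  have := mul_nonneg hr h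
  nlinarith [sq_nonneg ‖r • (nx - ny)‖]

lemma mono_n {p q nx ny : V} {a b : ℝ} (ha : 0 ≤ a) (hb : 0 ≤ b) (hx : ‖nx‖ = 1) (hy : ‖ny‖ = 1)
    (h1 : 0 ≤ inner ℝ (p - q) nx) (h2 : inner ℝ (p - q) ny ≤ 0) :
    0 ≤ inner ℝ ((p + a • nx) - (q + b • ny)) (nx - ny) := by
  have e : (p + a • nx) - (q + b • ny) = (p - q) + (a • nx - b • ny) := by module
  have e2 : inner ℝ (a • nx - b • ny) (nx - ny) = (a + b) * (1 - inner ℝ nx ny) := by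
    rw [inner_sub_left, inner_smul_left, inner_smul_left, inner_sub_right, inner_sub_right,
      real_inner_self_eq_norm_sq, real_inner_self_eq_norm_sq, hx, hy, real_inner_comm nx ny]
    simp only [conj_trivial]; ring
  rw [e, inner_add_left, e2, inner_sub_right]
  have : inner ℝ nx ny ≤ 1 := by
    have := real_inner_le_norm nx ny
    rwa [hx, hy, one_mul] at this
  nlinarith

lemma W1 {E : Set V} (hc : Convex ℝ E) (hE : IsCompact E) {r R : ℝ} (hr : 0 < r) (hR : 0 < R) :
    ∫⁻ x in E \ ball (0:V) R, ENNReal.ofReal (‖x‖ - R) ≤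
    ∫⁻ x in thickening r E \ ball (0:V) (R + r), ENNReal.ofReal (‖x‖ - (R + r)) := by
  have hae : (interior E : Set V) =ᵐ[volume] E := interior_ae_eq_of_null_frontier (hc.addHaar_frontier _)
  have : (interior E \ ball (0:V) R : Set V) =ᵐ[volume] (E \ ball (0:V) R : Set V) := hae.diff (ae_eq_refl _)
  rw [← setLIntegral_congr this]
  have hne : ∀ x ∈ interior E \ ball (0:V) R, x ≠ 0 := by
    rintro x ⟨_, hx⟩ rfl; exact hx (mem_ball_self hR)
  apply transport (T := fun x => x + r • ht x) (isOpen_interior.measurableSet.diff measurableSet_ball)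
    (isOpen_thickening.measurableSet.diff measurableSet_ball) (by fun_prop) (by fun_prop)
  · intro x hx
    have hx0 := hne x hx
    have hxp : 0 < ‖x‖ := norm_pos_iff.2 hx0
    have hnorm : ‖x + r • ht x‖ = ‖x‖ + r := by
      have e : x + r • ht x = (‖x‖ + r) • ht x := by rw [add_smul, ht_smul_norm]
      rw [e, norm_smul, ht_norm hx0, mul_one, Real.norm_of_nonneg (by positivity)]
    refine ⟨⟨?_, ?_⟩, ?_⟩
    · obtain ⟨δ, hδ, hδE⟩ := Metric.isOpen_iff.1 isOpen_interior x hx.1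
      set s := min (δ/2) r with hs
      have hs0 : 0 < s := by positivity
      rw [mem_thickening_iff]
      refine ⟨x + s • ht x, interior_subset (hδE ?_), ?_⟩
      · rw [mem_ball, dist_eq_norm, add_sub_cancel_left, norm_smul, ht_norm hx0, mul_one, Real.norm_of_nonneg hs0.le]
        linarith [min_le_left (δ/2) r]
      · rw [dist_add_left, dist_eq_norm, ← sub_smul, norm_smul, ht_norm hx0, mul_one, Real.norm_of_nonneg]
        · linarith
        · linarith [min_le_right (δ/2) r]
    · have := hx.2
      rw [mem_ball_zero_iff, not_lt] at this ⊢
      rw [hnorm]; linarith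
    · rw [hnorm]; linarith
  · intro x hx y hy
    apply expand hr.le
    have h := mono_n (p := (0:V)) (q := 0) (norm_nonneg x) (norm_nonneg y) (ht_norm (hne x hx)) (ht_norm (hne y hy)) (by simp) (by simp)
    rwa [ht_smul_norm, ht_smul_norm, zero_add, zero_add] at h

lemma W2 {E : Set V} (hc : Convex ℝ E) (hE : IsCompact E) (hEn : E.Nonempty) {r R : ℝ} (hr : 0 < r) :
    ∫⁻ x in ball (0:V) R \ E, ENNReal.ofReal (R - ‖x‖) ≤
    ∫⁻ x in ball (0:V) (R + r) \ thickening r E, ENNReal.ofReal ((R + r) - ‖x‖) := by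
  have hp : ∀ x : V, ∃ p ∈ E, ∀ w ∈ E, inner ℝ (x - p) (w - p) ≤ 0 := by
    intro x
    obtain ⟨p, hp, h⟩ := exists_norm_eq_iInf_of_complete_convex hEn hE.isComplete hc x
    exact ⟨p, hp, (norm_eq_iInf_iff_real_inner_le_zero hc hp).1 h⟩
  choose p hpE hp using hp
  have hne : ∀ x ∈ ball (0:V) R \ E, x - p x ≠ 0 := by
    rintro x ⟨_, hx⟩ h
    rw [sub_eq_zero] at h; exact hx (h ▸ hpE x)
  have hh : ∀ x ∈ ball (0:V) R \ E, ∀ w ∈ E, inner ℝ (ht (x - p x)) (w - p x) ≤ 0 := by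
    intro x hx w hw
    unfold ht
    rw [inner_smul_left]
    exact mul_nonpos_of_nonneg_of_nonpos (by simp) (hp x w hw)
  apply transport (T := fun x => x + r • ht (x - p x)) (measurableSet_ball.diff hE.measurableSet)
    (measurableSet_ball.diff isOpen_thickening.measurableSet) (by fun_prop) (by fun_prop)
  · intro x hx
    have hx0 := hne x hx
    have hnorm : ‖x + r • ht (x - p x)‖ ≤ ‖x‖ + r := by
      refine (norm_add_le _ _).trans (le_of_eq ?_)
      rw [norm_smul, ht_norm hx0, mul_one, Real.norm_of_nonneg hr.le]
    refine ⟨⟨?_, ?_⟩, ?_⟩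
    · have := hx.1
      rw [mem_ball_zero_iff] at this ⊢
      linarith
    · intro h
      rw [mem_thickening_iff] at h
      obtain ⟨e, he, hd⟩ := h
      have h1 := hh x hx e he
      have h2 : inner ℝ (ht (x - p x)) (x + r • ht (x - p x) - e) ≤ ‖x + r • ht (x - p x) - e‖ := by
        have := real_inner_le_norm (ht (x - p x)) (x + r • ht (x - p x) - e)
        rwa [ht_norm hx0, one_mul] at this
      have h3 : x + r • ht (x - p x) - e = (‖x - p x‖ + r) • ht (x - p x) - (e - p x) := by
        rw [add_smul, ht_smul_norm]; abel
      rw [dist_eq_norm] at hd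
      rw [h3, inner_sub_right, inner_smul_right, real_inner_self_eq_norm_sq, ht_norm hx0, ← h3] at h2
      have := norm_nonneg (x - p x)
      nlinarith
    · linarith
  · intro x hx y hy
    apply expand hr.le
    have h := mono_n (p := p x) (q := p y) (norm_nonneg (x - p x)) (norm_nonneg (y - p y)) (ht_norm (hne x hx)) (ht_norm (hne y hy))
      (by have := hh x hx (p y) (hpE y)
          rw [real_inner_comm, ← neg_sub, inner_neg_left] at this; linarith)
      (by rw [real_inner_comm]; exact hh y hy (p x) (hpE x))
    rwa [ht_smul_norm, ht_smul_norm, add_sub_cancel, add_sub_cancel] at h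

lemma Wd_th {E : Set V} (hc : Convex ℝ E) (hE : IsCompact E) (hEn : E.Nonempty) {r R : ℝ} (hr : 0 < r) (hR : 0 < R) :
    Wd E R ≤ Wd (thickening r E) (R + r) := add_le_add (W1 hc hE hr hR) (W2 hc hE hEn hr)

end
end Mf

namespace Mf
open InnerProductSpace Module TopologicalSpace
section
variable {V : Type*} [NormedAddCommGroup V] [InnerProductSpace ℝ V] [FiniteDimensional ℝ V]
  [MeasurableSpace V] [BorelSpace V]

def tr (c : V) (E : Set V) : Set V := (fun x => x + c) ⁻¹' E

lemma tr_vol (c : V) (E : Set V) : volume (tr c E) = volume E := measure_preimage_add_right _ _ _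

lemma tr_convex (c : V) {E : Set V} (h : Convex ℝ E) : Convex ℝ (tr c E) := h.translate_preimage_left c

lemma tr_compact (c : V) {E : Set V} (h : IsCompact E) : IsCompact (tr c E) :=
  (Homeomorph.addRight c).isCompact_preimage.2 h

lemma tr_nonempty (c : V) {E : Set V} (h : E.Nonempty) : (tr c E).Nonempty := by
  obtain ⟨x, hx⟩ := h
  exact ⟨x - c, by simpa [tr] using hx⟩

lemma tr_th (c : V) (E : Set V) (r : ℝ) : thickening r (tr c E) = tr c (thickening r E) := by
  ext x
  simp only [tr, mem_thickening_iff, mem_preimage]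
  constructor
  · rintro ⟨z, hz, h⟩; exact ⟨z + c, hz, by rwa [dist_add_right]⟩
  · rintro ⟨z, hz, h⟩; exact ⟨z - c, by simpa using hz, by rwa [← dist_add_right _ _ c, sub_add_cancel]⟩

lemma tr_tr (c g : V) (E : Set V) : tr g (tr c E) = tr (g + c) E := by
  ext x; simp [tr, add_assoc]

lemma tr_sub {c x : V} {E : Set V} {a : ℝ} : ball x a ⊆ E → ball (x - c) a ⊆ tr c E := by
  intro h y hy
  apply h
  rw [mem_ball, dist_eq_norm] at hy ⊢
  simpa [sub_sub_eq_add_sub, add_sub_right_comm] using hy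

lemma tr_sup {c x : V} {E : Set V} {a : ℝ} : E ⊆ ball x a → tr c E ⊆ ball (x - c) a := by
  intro h y hy
  have := h hy
  rw [mem_ball, dist_eq_norm] at this ⊢
  simpa [sub_sub_eq_add_sub, add_sub_right_comm] using this

lemma ball_inner_zero (a : ℝ) (u : V) : ∫ x in ball (0:V) a, inner ℝ x u = 0 := by
  have h := (Measure.measurePreserving_neg (volume : Measure V)).setIntegral_preimage_emb
    (MeasurableEquiv.neg V).measurableEmbedding (fun x => inner ℝ x u) (ball (0:V) a)
  have e : (Neg.neg ⁻¹' ball (0:V) a) = ball (0:V) a := by ext x; simp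
  rw [e] at h
  simp only [inner_neg_left, integral_neg] at h
  linarith

lemma ctr_close {A : Set V} (hA : IsOpen A) {a b : ℝ} (ha : 0 < a) (hb : 0 < b)
    (h1 : ball (0:V) a ⊆ A) (h2 : A ⊆ ball (0:V) b) :
    ‖ctr A‖ * (volume A).toReal ≤ b * ((volume (ball (0:V) b)).toReal - (volume (ball (0:V) a)).toReal) := by
  have hbd : IsBounded A := isBounded_ball.subset h2
  have h0 : volume A ≠ 0 := (lt_of_lt_of_le (measure_ball_pos _ _ ha) (measure_mono h1)).ne'
  have hAt : volume A ≠ ⊤ := ne_top_of_le_ne_top measure_ball_lt_top.ne (measure_mono h2)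
  set v := ctr A with hv
  have e1 := ctr_inner hbd hA.measurableSet h0 v
  rw [← hv, real_inner_self_eq_norm_sq] at e1
  have hu : ball (0:V) a ∪ (A \ ball (0:V) a) = A := union_diff_cancel h1
  have e2 : ∫ x in A, inner ℝ x v = ∫ x in A \ ball (0:V) a, inner ℝ x v := by
    conv_lhs => rw [← hu]
    rw [setIntegral_union disjoint_sdiff_right (hA.measurableSet.diff measurableSet_ball)
      (int_inner_on isBounded_ball measurableSet_ball v) (int_inner_on (hbd.subset diff_subset) (hA.measurableSet.diff measurableSet_ball) v),
      ball_inner_zero, zero_add]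
  have hft : volume (A \ ball (0:V) a) < ⊤ := lt_of_le_of_lt (measure_mono diff_subset) hAt.lt_top
  have e3 : ‖∫ x in A \ ball (0:V) a, inner ℝ x v‖ ≤ (b * ‖v‖) * (volume (A \ ball (0:V) a)).toReal := by
    apply norm_setIntegral_le_of_norm_le_const hft
    intro x hx
    refine (norm_inner_le_norm x v).trans ?_
    have := h2 hx.1
    rw [mem_ball_zero_iff] at this
    gcongr
  have e4 : (volume (A \ ball (0:V) a)).toReal ≤ (volume (ball (0:V) b)).toReal - (volume (ball (0:V) a)).toReal := by
    rw [measure_diff h1 measurableSet_ball.nullMeasurableSet measure_ball_lt_top.ne, ENNReal.toReal_sub_of_le (measure_mono h1) hAt]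
    have := ENNReal.toReal_mono measure_ball_lt_top.ne (measure_mono h2 : volume A ≤ volume (ball (0:V) b))
    linarith
  rw [← e2, e1, Real.norm_of_nonneg (by positivity)] at e3
  rcases eq_or_lt_of_le (norm_nonneg v) with h | h
  · rw [← h, zero_mul]
    exact mul_nonneg hb.le (ENNReal.toReal_nonneg.trans e4)
  · have : (volume A).toReal * ‖v‖ ≤ b * (volume (A \ ball (0:V) a)).toReal := by
      apply le_of_mul_le_mul_right _ h
      nlinarith
    calc _ = (volume A).toReal * ‖v‖ := mul_comm _ _
      _ ≤ _ := this.trans (by gcongr)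

lemma diam_bd {E : Set V} (hc : Convex ℝ E) {r : ℝ} (hr : 0 < r) {x y : V} (hx : x ∈ E) (hy : y ∈ E) :
    volume (ball (0:V) r) * ENNReal.ofReal (dist x y) ≤ volume (thickening r E) * ENNReal.ofReal (2*r) := by
  rcases eq_or_ne x y with rfl | hne
  · simp
  have hs : x - y ≠ 0 := sub_ne_zero.2 hne
  set u := ht (x - y) with hu'
  have hu : ‖u‖ = 1 := ht_norm hs
  set L := ‖x - y‖ with hL
  have hxy : x = y + L • u := by rw [hu', ht_smul_norm]; abel
  obtain ⟨k0, t0, hk0, -⟩ := decomp u hu y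
  have hA : MeasurableSet (thickening r E) := isOpen_thickening.measurableSet
  have hfib : ∀ k ∈ ball k0 r, ENNReal.ofReal L ≤ volume {t : ℝ | (k : V) + t • u ∈ thickening r E} := by
    intro k hk
    have : Icc t0 (t0 + L) ⊆ {t : ℝ | (k : V) + t • u ∈ thickening r E} := by
      intro t ht'
      rw [mem_setOf_eq, mem_thickening_iff]
      refine ⟨(k0 : V) + t • u, ?_, ?_⟩
      · have hL0 : 0 < L := norm_pos_iff.2 hs
        have := hc hy hx (a := 1 - (t - t0)/L) (b := (t-t0)/L) (by
          rw [sub_nonneg, div_le_one hL0]; linarith [ht'.2]) (div_nonneg (by linarith [ht'.1]) hL0.le) (by ring)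
        convert this using 1
        rw [hxy, hk0]
        have e : ((t - t0)/L) • L • u = (t - t0) • u := by rw [smul_smul, div_mul_cancel₀ _ hL0.ne']
        rw [smul_add ((t-t0)/L) ((k0:V) + t0 • u), e]; module
      · rw [dist_add_right]; exact hk
    calc ENNReal.ofReal L = volume (Icc t0 (t0 + L)) := by simp
      _ ≤ _ := measure_mono this
  calc _ = volume (ball (0:V) r) * ENNReal.ofReal L := by rw [dist_eq_norm]
    _ ≤ volume (ball (0 : Ku u) r) * ENNReal.ofReal (2*r) * ENNReal.ofReal L := mul_le_mul_left (volK' hu hr) _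
    _ = (∫⁻ k in ball k0 r, ENNReal.ofReal L) * ENNReal.ofReal (2*r) := by
        rw [setLIntegral_const, Measure.addHaar_ball_center volume k0]; ring
    _ ≤ (∫⁻ k in ball k0 r, volume {t : ℝ | (k : V) + t • u ∈ thickening r E}) * ENNReal.ofReal (2*r) := by
        apply mul_le_mul_left
        exact setLIntegral_mono' measurableSet_ball hfib
    _ ≤ _ := by
        apply mul_le_mul_left
        rw [slice_volume u hu hA]
        exact setLIntegral_le_lintegral _ _

lemma exists_e {ρ σ : ℝ} (hρ : 0 < ρ) (hσ : 0 < σ) (n : ℕ) :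
    ∃ e : ℝ, 0 < e ∧ e < ρ ∧ e + (ρ + e) * ((ρ+e)^n - (ρ-e)^n) / ρ^n ≤ σ := by
  have hcont : Continuous (fun e : ℝ => e + (ρ + e) * ((ρ+e)^n - (ρ-e)^n) / ρ^n) := by fun_prop
  have ht : Tendsto (fun e : ℝ => e + (ρ + e) * ((ρ+e)^n - (ρ-e)^n) / ρ^n) (nhdsWithin 0 (Ioi 0)) (nhds 0) := by
    have := hcont.tendsto 0
    simp only [add_zero, sub_zero, sub_self, mul_zero, zero_div] at this
    exact this.mono_left nhdsWithin_le_nhds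
  have h1 := ht.eventually (ge_mem_nhds hσ)
  have h2 : ∀ᶠ e : ℝ in nhdsWithin 0 (Ioi 0), e < ρ := (eventually_lt_nhds hρ).filter_mono nhdsWithin_le_nhds
  have h3 : ∀ᶠ e : ℝ in nhdsWithin 0 (Ioi 0), 0 < e := self_mem_nhdsWithin
  obtain ⟨e, ha, hb, hc⟩ := (h1.and (h2.and h3)).exists
  exact ⟨e, hc, hb, ha⟩

end
end Mf

namespace Mf
open InnerProductSpace Module TopologicalSpace
section
variable {V : Type*} [NormedAddCommGroup V] [InnerProductSpace ℝ V] [FiniteDimensional ℝ V]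
  [MeasurableSpace V] [BorelSpace V]

lemma tr_int {A : Set V} (hA : IsOpen A) (hb : IsBounded A) (h0 : volume A ≠ 0) (u : V) :
    ∫ x in tr (ctr A) A, inner ℝ x u = 0 := by
  have h := (measurePreserving_add_right (volume : Measure V) (ctr A)).setIntegral_preimage_emb
    (MeasurableEquiv.addRight (ctr A)).measurableEmbedding (fun x => inner ℝ (x - ctr A) u) A
  simp only [add_sub_cancel_right] at h
  have hfin : volume A < ⊤ := hb.measure_lt_top
  haveI : IsFiniteMeasure (volume.restrict A) := ⟨by simpa using hfin⟩
  refine h.trans ?_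
  simp only [inner_sub_left]
  rw [integral_sub (int_inner_on hb hA.measurableSet u) (integrable_const _), ctr_inner hb hA.measurableSet h0]
  simp [measureReal_def]

lemma star [Nontrivial V] (hn2 : 2 ≤ finrank ℝ V) {r R : ℝ} (hr : 0 < r) (hR : 0 < R) :
    ∃ C : ℝ≥0∞, C ≠ ⊤ ∧ ∃ δ : ℝ, 0 < δ ∧ ∀ E : Set V, Convex ℝ E → IsCompact E → E.Nonempty →
      volume (ball (0:V) R) ≤ volume E →
      volume (thickening r E) ≤ volume (ball (0:V) (R + r)) + ENNReal.ofReal δ →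
      ∃ c, Wd (tr c E) R ≤ C * (volume (thickening r E) - volume (ball (0:V) (R + r))) := by
  set ρ := R + r with hρ
  have hrρ : r < ρ := by linarith
  have hρ0 : 0 < ρ := by linarith
  obtain ⟨τ, hτ, hτ1, C, hC, Q⟩ := quant hn2 hr hrρ
  obtain ⟨e, he, heρ, hes⟩ := exists_e hρ0 (show 0 < ρ * (τ/2) by positivity) (finrank ℝ V)
  set X : ℝ≥0∞ := (volume (ball (0:V) ρ) + ENNReal.ofReal 1) * ENNReal.ofReal (2*r) with hX
  set vr := volume (ball (0:V) r) with hvr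
  have hvr0 : vr ≠ 0 := (measure_ball_pos _ _ hr).ne'
  have hXt : vr⁻¹ * X ≠ ⊤ := ENNReal.mul_ne_top (ENNReal.inv_ne_top.2 hvr0) (ENNReal.mul_ne_top
    (ENNReal.add_ne_top.2 ⟨measure_ball_lt_top.ne, ENNReal.ofReal_ne_top⟩) ENNReal.ofReal_ne_top)
  obtain ⟨δ, hδ, co⟩ := coarse (V := V) (C := (vr⁻¹ * X).toReal) hr hR he
  refine ⟨C, hC, min δ 1, by positivity, ?_⟩
  intro E hc hE hne hv hg
  obtain ⟨x0, hx0⟩ := hne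
  -- first translation
  have hsub : tr x0 E ⊆ closedBall 0 (vr⁻¹ * X).toReal := by
    intro y hy
    rw [mem_closedBall_zero_iff]
    have h1 := diam_bd hc hr hy hx0
    simp only [dist_eq_norm, add_sub_cancel_right] at h1
    have h2 : vr * ENNReal.ofReal ‖y‖ ≤ X := h1.trans (mul_le_mul_left (hg.trans (by
      gcongr; exact min_le_right _ _)) _)
    have h3 := inv_move hvr0 measure_ball_lt_top.ne h2
    rw [← ENNReal.ofReal_le_iff_le_toReal hXt]; exact h3
  obtain ⟨c, hc1, hc2⟩ := co (tr x0 E) (tr_convex _ hc) (tr_compact _ hE) (tr_nonempty _ ⟨x0, hx0⟩) hsub (by rwa [tr_vol])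
    (by rw [tr_th, tr_vol]; exact hg.trans (by gcongr; exact min_le_left _ _))
  set E1 := tr (c + x0) E with hE1
  have hb1 : ball (0:V) (ρ - e) ⊆ thickening r E1 := by
    have := tr_sub (c := c) hc1
    rwa [sub_self, ← tr_th, tr_tr] at this
  have hb2 : thickening r E1 ⊆ ball (0:V) (ρ + e) := by
    have := tr_sup (c := c) hc2
    rwa [sub_self, ← tr_th, tr_tr] at this
  set A := thickening r E1 with hA
  have hAo : IsOpen A := isOpen_thickening
  have hAb : IsBounded A := isBounded_ball.subset hb2
  have ha0 : 0 < ρ - e := by linarith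
  have hA0 : volume A ≠ 0 := (lt_of_lt_of_le (measure_ball_pos _ _ ha0) (measure_mono hb1)).ne'
  have hcl := ctr_close hAo ha0 (by linarith : 0 < ρ + e) hb1 hb2
  have hvA : volume (ball (0:V) ρ) ≤ volume A :=
    bm (tr_convex _ hc) (tr_compact _ hE) (tr_nonempty _ ⟨x0, hx0⟩) hr (by rwa [tr_vol])
  set g := ctr A with hgdef
  have hgn : ‖g‖ ≤ (ρ + e) * ((ρ+e)^(finrank ℝ V) - (ρ-e)^(finrank ℝ V)) / ρ^(finrank ℝ V) := by
    have hω : 0 < (volume (ball (0:V) 1)).toReal := ENNReal.toReal_pos (measure_ball_pos _ _ one_pos).ne' measure_ball_lt_top.ne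
    have h5 : ‖g‖ * (volume (ball (0:V) ρ)).toReal ≤ (ρ+e) * ((volume (ball (0:V) (ρ+e))).toReal - (volume (ball (0:V) (ρ-e))).toReal) :=
      le_trans (mul_le_mul_of_nonneg_left (ENNReal.toReal_mono hAb.measure_lt_top.ne hvA) (norm_nonneg _)) hcl
    rw [vol_ball_pow hρ0, vol_ball_pow ha0, vol_ball_pow (by linarith : 0 < ρ + e), ENNReal.toReal_mul, ENNReal.toReal_mul, ENNReal.toReal_mul,
      ENNReal.toReal_ofReal (by positivity), ENNReal.toReal_ofReal (by positivity), ENNReal.toReal_ofReal (by positivity)] at h5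
    rw [le_div_iff₀ (by positivity)]
    apply le_of_mul_le_mul_right _ hω
    linarith
  refine ⟨g + (c + x0), ?_⟩
  rw [← tr_tr, ← hE1]
  have hcE : Convex ℝ (tr g E1) := tr_convex _ (tr_convex _ hc)
  have hkE : IsCompact (tr g E1) := tr_compact _ (tr_compact _ hE)
  have hnE : (tr g E1).Nonempty := tr_nonempty _ (tr_nonempty _ ⟨x0, hx0⟩)
  have q := Q (tr g E1) hcE hkE hnE (by rw [tr_vol, tr_vol, hρ, add_sub_cancel_right]; exact hv)
    (by
      rw [tr_th]
      refine Subset.trans ?_ (tr_sub (c := g) hb1)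
      apply ball_subset_ball'
      simp only [dist_zero_left, zero_sub, norm_neg]
      linarith)
    (by
      rw [tr_th]
      refine (tr_sup (c := g) hb2).trans ?_
      apply ball_subset_ball'
      simp only [dist_zero_right, zero_sub, norm_neg]
      linarith)
    (by
      intro u
      rw [tr_th]
      exact tr_int hAo hAb hA0 u)
  refine (Wd_th hcE hkE hnE hr hR).trans (q.trans (le_of_eq ?_))
  rw [tr_th, tr_vol, hE1, tr_th, tr_vol]

end
end Mf

namespace Mf
open InnerProductSpace Module TopologicalSpace
section
variable {V : Type*} [NormedAddCommGroup V] [InnerProductSpace ℝ V] [FiniteDimensional ℝ V]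
  [MeasurableSpace V] [BorelSpace V]

lemma dens_int {E : Set V} {x : V} (hx : x ∈ interior E) :
    Tendsto (fun ρ : ℝ => volume (E ∩ ball x ρ) / volume (ball x ρ)) (nhdsWithin 0 (Ioi 0)) (nhds 1) := by
  obtain ⟨δ, hδ, h⟩ := Metric.isOpen_iff.1 isOpen_interior x hx
  apply tendsto_const_nhds.congr'
  have h1 : ∀ᶠ e : ℝ in nhdsWithin 0 (Ioi 0), e < δ := (eventually_lt_nhds hδ).filter_mono nhdsWithin_le_nhds
  have h3 : ∀ᶠ e : ℝ in nhdsWithin 0 (Ioi 0), 0 < e := self_mem_nhdsWithin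
  filter_upwards [h1, h3] with e he he0
  rw [inter_eq_right.2 ((ball_subset_ball he.le).trans (h.trans interior_subset)),
    ENNReal.div_self (measure_ball_pos _ _ he0).ne' measure_ball_lt_top.ne]

lemma dens_cl {E : Set V} {x : V}
    (h : Tendsto (fun ρ : ℝ => volume (E ∩ ball x ρ) / volume (ball x ρ)) (nhdsWithin 0 (Ioi 0)) (nhds 1)) : x ∈ closure E := by
  by_contra hx
  obtain ⟨δ, hδ, hd⟩ := Metric.isOpen_iff.1 isClosed_closure.isOpen_compl x hx
  have h1 : ∀ᶠ e : ℝ in nhdsWithin 0 (Ioi 0), e < δ := (eventually_lt_nhds hδ).filter_mono nhdsWithin_le_nhds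
  have h0 : Tendsto (fun ρ : ℝ => volume (E ∩ ball x ρ) / volume (ball x ρ)) (nhdsWithin 0 (Ioi 0)) (nhds 0) := by
    apply tendsto_const_nhds.congr'
    filter_upwards [h1] with e he
    have : E ∩ ball x e = ∅ := by
      ext y; simp only [mem_inter_iff, mem_empty_iff_false, iff_false]
      rintro ⟨ha, hb⟩
      exact hd (ball_subset_ball he.le hb) (subset_closure ha)
    simp [this]
  exact zero_ne_one (tendsto_nhds_unique h0 h)

lemma frontier_mid {E D : Set V} (hc : Convex ℝ E) (hi : (interior E).Nonempty) (h1 : interior E ⊆ D) (h2 : D ⊆ closure E) :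
    frontier D = frontier E := by
  have hcl : closure D = closure E := by
    apply Subset.antisymm
    · exact closure_minimal h2 isClosed_closure
    · rw [← hc.closure_interior_eq_closure_of_nonempty_interior hi]; exact closure_mono h1
  have hin : interior D = interior E := by
    apply Subset.antisymm
    · rw [← hc.interior_closure_eq_interior_of_nonempty_interior hi]; exact interior_mono h2
    · exact interior_maximal h1 isOpen_interior
  rw [frontier, frontier, hcl, hin]

lemma exists_rad [Nontrivial V] {v : ℝ≥0∞} (hv : v ≠ ⊤) : ∃ s : ℝ, 0 ≤ s ∧ volume (ball (0:V) s) = v := by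
  have hω : 0 < (volume (ball (0:V) 1)).toReal := ENNReal.toReal_pos (measure_ball_pos _ _ one_pos).ne' measure_ball_lt_top.ne
  have hn : finrank ℝ V ≠ 0 := finrank_pos.ne'
  refine ⟨(v.toReal / (volume (ball (0:V) 1)).toReal) ^ ((finrank ℝ V : ℝ)⁻¹), by positivity, ?_⟩
  rw [Measure.addHaar_ball _ _ (by positivity), Real.rpow_inv_natCast_pow (by positivity) hn,
    ENNReal.ofReal_div_of_pos hω, ENNReal.ofReal_toReal hv, ENNReal.ofReal_toReal measure_ball_lt_top.ne,
    ENNReal.div_mul_cancel (measure_ball_pos _ _ one_pos).ne' measure_ball_lt_top.ne]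

lemma inner_vol [Nontrivial V] {E : Set V} (hc : Convex ℝ E) (hE : IsCompact E) {r R : ℝ} (hr : 0 < r) (hR : 0 < R)
    (hv : volume E = volume (ball (0:V) R)) :
    volume {x : V | ball x r ⊆ E} ≤ volume (ball (0:V) (R - r)) := by
  set I := {x : V | ball x r ⊆ E} with hI
  have hIE : thickening r I ⊆ E := by
    intro y hy
    obtain ⟨z, hz, hd⟩ := mem_thickening_iff.1 hy
    exact hz hd
  rcases I.eq_empty_or_nonempty with h | hne
  · rw [h]; simp
  have hI' : I = ⋂ v ∈ ball (0:V) r, (fun x => x + v) ⁻¹' E := by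
    ext x
    simp only [hI, mem_setOf_eq, mem_iInter, mem_preimage]
    constructor
    · intro h v hv
      apply h; rw [mem_ball_zero_iff] at hv; simpa [mem_ball, dist_eq_norm] using hv
    · intro h y hy
      have := h (y - x) (by rw [mem_ball_zero_iff]; simpa [dist_eq_norm] using hy)
      simpa using this
  have hIc : Convex ℝ I := by
    rw [hI']; exact convex_iInter₂ fun v _ => hc.translate_preimage_left v
  have hIcl : IsClosed I := by
    rw [hI']; exact isClosed_biInter fun v _ => hE.isClosed.preimage (by fun_prop)
  have hIk : IsCompact I := hE.of_isClosed_subset hIcl ((self_subset_thickening hr I).trans hIE)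
  obtain ⟨s, hs, hsv⟩ := exists_rad (V := V) (v := volume I) hIk.measure_lt_top.ne
  have h1 := (bm hIc hIk hne hr hsv.le).trans (measure_mono hIE)
  rw [hv] at h1
  have := vol_ball_lt hR.le 0 0 (h1.trans (measure_mono ball_subset_closedBall))
  rw [← hsv]
  exact measure_mono (ball_subset_ball (by linarith))

lemma perLow [Nontrivial V] {E : Set V} (hc : Convex ℝ E) (hE : IsCompact E) {r R : ℝ} (hr : 0 < r) (hR : 0 < R)
    (hv : volume E = volume (ball (0:V) R)) :
    volume (thickening r E) ≤ volume (⋃ x ∈ frontier E, ball x r) + volume (ball (0:V) (R - r)) := by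
  have hsub : thickening r E ⊆ (⋃ x ∈ frontier E, ball x r) ∪ {x : V | ball x r ⊆ E} := by
    intro x hx
    by_cases h : ball x r ⊆ E
    · exact Or.inr h
    · left
      obtain ⟨z, hz, hd⟩ := mem_thickening_iff.1 hx
      obtain ⟨y, hy, hyE⟩ := not_subset.1 h
      have hcn : IsPreconnected (ball x r) := (convex_ball x r).isPreconnected
      have hzb : z ∈ ball x r := by rwa [mem_ball, dist_comm]
      have : ∃ w ∈ ball x r, w ∈ frontier E := by
        by_contra! hno
        have hin : ∀ w ∈ ball x r, w ∈ E → w ∈ interior E := by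
          intro w hw hwE
          by_contra hwi
          exact hno w hw ⟨subset_closure hwE, hwi⟩
        obtain ⟨w, -, hw1, hw2⟩ := hcn (interior E) Eᶜ isOpen_interior hE.isClosed.isOpen_compl
          (fun w hw => by
            by_cases hwE : w ∈ E
            · exact Or.inl (hin w hw hwE)
            · exact Or.inr hwE) ⟨z, hzb, hin z hzb hz⟩ ⟨y, hy, hyE⟩
        exact hw2 (interior_subset hw1)
      obtain ⟨w, hw1, hw2⟩ := this
      simp only [mem_iUnion]
      exact ⟨w, hw2, by rwa [mem_ball, dist_comm]⟩
  refine (measure_mono hsub).trans ((measure_union_le _ _).trans ?_)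
  exact add_le_add le_rfl (inner_vol hc hE hr hR hv)

lemma perUp [Nontrivial V] {r R : ℝ} (hr : 0 < r) (hR : 0 < R) :
    volume (⋃ x ∈ frontier (ball (0:V) R), ball x r) + volume (ball (0:V) (R - r)) ≤ volume (ball (0:V) (R + r)) := by
  rw [frontier_ball _ hR.ne', ← measure_union _ measurableSet_ball]
  · apply measure_mono
    apply union_subset
    · simp only [iUnion_subset_iff]
      intro x hx
      apply ball_subset_ball'
      rw [mem_sphere] at hx; linarith
    · exact ball_subset_ball (by linarith)
  · rw [Set.disjoint_left]
    intro y hy hy2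
    simp only [mem_iUnion] at hy
    obtain ⟨x, hx, hxy⟩ := hy
    rw [mem_sphere_zero_iff_norm] at hx
    rw [mem_ball_zero_iff] at hy2
    rw [mem_ball, dist_eq_norm] at hxy
    have : ‖x‖ ≤ ‖y‖ + ‖y - x‖ := by
      have := norm_sub_le y (y - x); rwa [sub_sub_cancel] at this
    linarith

end
end Mf

namespace Mf
open InnerProductSpace Module TopologicalSpace
section
variable {V : Type*} [NormedAddCommGroup V] [InnerProductSpace ℝ V] [FiniteDimensional ℝ V]
  [MeasurableSpace V] [BorelSpace V]

def pot (β : ℝ) (S : Set V) (x : V) : ℝ≥0∞ := ∫⁻ z in S, edist x z ^ (-β)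

lemma ker_eq {x z : V} (h : x ≠ z) (β : ℝ) : edist x z ^ (-β) = ENNReal.ofReal (dist x z ^ (-β)) := by
  rw [edist_dist, ENNReal.ofReal_rpow_of_pos (dist_pos.2 h)]

lemma ker_meas (β : ℝ) : Measurable (fun p : V × V => edist p.1 p.2 ^ (-β)) :=
  (measurable_edist).pow_const _

lemma pot_meas (β : ℝ) (S : Set V) : Measurable (pot β S) := (ker_meas β).lintegral_prod_right'

lemma J_fin [Nontrivial V] {β : ℝ} (hβ : β < finrank ℝ V) : ∫⁻ w in ball (0:V) 1, edist (0:V) w ^ (-β) ≠ ⊤ := by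
  have h : IntegrableOn (fun x : V => ‖x‖ ^ (-β)) (ball (0:V) 1) volume := by
    rw [integrableOn_fun_norm_addHaar volume (f := fun y : ℝ => y ^ (-β))]
    have h2 : IntegrableOn (fun y : ℝ => y ^ ((finrank ℝ V : ℝ) - 1 - β)) (Ioo 0 1) :=
      (intervalIntegral.integrableOn_Ioo_rpow_iff one_pos).2 (by linarith)
    apply h2.congr_fun _ measurableSet_Ioo
    intro y hy
    simp only [smul_eq_mul]
    rw [← Real.rpow_natCast, ← Real.rpow_add hy.1]
    congr 1
    rw [Nat.cast_sub finrank_pos]; push_cast; ring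
  have h3 := h.lintegral_lt_top
  refine (ne_of_lt (lt_of_le_of_lt (le_of_eq ?_) h3))
  apply lintegral_congr_ae
  filter_upwards [ae_ne0 (ball (0:V) 1)] with w hw
  rw [ker_eq hw.symm, dist_zero_left]

lemma pot_bd [Nontrivial V] {β : ℝ} (hβ0 : 0 < β) (hβ : β < finrank ℝ V) :
    ∃ M : ℝ≥0∞, M ≠ ⊤ ∧ ∀ (S : Set V) (x : V), pot β S x ≤ M + volume S := by
  refine ⟨_, J_fin hβ, ?_⟩
  intro S x
  have h1 : ∀ z, edist x z ^ (-β) ≤ (ball x 1).indicator (fun z => edist x z ^ (-β)) z + 1 := by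
    intro z
    by_cases hz : z ∈ ball x 1
    · rw [indicator_of_mem hz]; exact le_self_add
    · rw [indicator_of_notMem hz, zero_add, ENNReal.rpow_neg, ENNReal.inv_le_one]
      apply ENNReal.one_le_rpow _ hβ0
      rw [edist_dist, ENNReal.one_le_ofReal]
      rwa [mem_ball, not_lt, dist_comm] at hz
  calc pot β S x ≤ ∫⁻ z in S, ((ball x 1).indicator (fun z => edist x z ^ (-β)) z + 1) := lintegral_mono h1
    _ = (∫⁻ z in S, (ball x 1).indicator (fun z => edist x z ^ (-β)) z) + volume S := by
        rw [lintegral_add_right _ measurable_const]; simp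
    _ ≤ (∫⁻ z, (ball x 1).indicator (fun z => edist x z ^ (-β)) z) + volume S := by
        gcongr; exact Measure.restrict_le_self
    _ = _ := by
        congr 1
        rw [lintegral_indicator measurableSet_ball]
        have h := (measurePreserving_add_right (volume : Measure V) x).setLIntegral_comp_preimage_emb
          (MeasurableEquiv.addRight x).measurableEmbedding (fun z => edist x z ^ (-β)) (ball x 1)
        rw [← h]
        have e : (fun z => z + x) ⁻¹' ball x 1 = ball (0:V) 1 := by ext z; simp [dist_eq_norm]
        rw [e]
        congr 1; ext z
        congr 1
        rw [edist_dist, edist_dist]; simp [dist_eq_norm]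

lemma tangent {a b α : ℝ} (ha : 0 < a) (hb : 0 < b) (hα : 0 < α) :
    a ^ (-α) ≤ b ^ (-α) + α * (b - a) * a ^ (-(α+1)) := by
  have hs : 0 < b / a := by positivity
  have h1 : 1 - α * (b / a - 1) ≤ (b/a) ^ (-α) := by
    rw [Real.rpow_def_of_pos hs]
    have h2 := Real.add_one_le_exp (Real.log (b/a) * -α)
    have h3 := Real.log_le_sub_one_of_pos hs
    nlinarith
  have hap : 0 < a ^ (-α) := Real.rpow_pos_of_pos ha _
  have e1 : (b/a) ^ (-α) * a ^ (-α) = b ^ (-α) := by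
    rw [← Real.mul_rpow hs.le ha.le, div_mul_cancel₀ _ ha.ne']
  have e2 : a ^ (-(α+1)) = a ^ (-α) / a := by
    rw [neg_add, ← sub_eq_add_neg, Real.rpow_sub_one ha.ne']
  have h4 := mul_le_mul_of_nonneg_right h1 hap.le
  rw [e1] at h4
  rw [e2]
  have : α * (b - a) * (a ^ (-α) / a) = α * (b/a - 1) * a ^ (-α) := by field_simp
  rw [this]; linarith

lemma pot_lip {α : ℝ} (hα : 0 < α) (S : Set V) (x y : V) [Nontrivial V] :
    pot α S x ≤ pot α S y + ENNReal.ofReal (α * dist x y) * pot (α+1) S x := by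
  unfold pot
  rw [← lintegral_const_mul' _ _ ENNReal.ofReal_ne_top, ← lintegral_add_left (by fun_prop)]
  apply lintegral_mono_ae
  have hx : ∀ᵐ z ∂(volume.restrict S), z ≠ x := ae_restrict_of_ae (Measure.ae_ne _ x)
  have hy : ∀ᵐ z ∂(volume.restrict S), z ≠ y := ae_restrict_of_ae (Measure.ae_ne _ y)
  filter_upwards [hx, hy] with z hzx hzy
  rw [ker_eq hzx.symm, ker_eq hzy.symm, ker_eq hzx.symm, ← ENNReal.ofReal_mul (by positivity), ← ENNReal.ofReal_add (by positivity) (by positivity)]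
  apply ENNReal.ofReal_le_ofReal
  have := tangent (dist_pos.2 hzx.symm) (dist_pos.2 hzy.symm) hα
  refine this.trans ?_
  gcongr
  have := dist_triangle y x z
  rw [dist_comm y x] at this; linarith

lemma pot_radial {α R : ℝ} {x y : V} (h : ‖x‖ = ‖y‖) : pot α (ball (0:V) R) x = pot α (ball (0:V) R) y := by
  set T : V ≃ₗᵢ[ℝ] V := (Submodule.span ℝ {x - y})ᗮ.reflection with hT
  have hxy : T x = y := Submodule.reflection_sub h
  have hmp := T.measurePreserving
  have h2 := hmp.setLIntegral_comp_preimage_emb T.toHomeomorph.measurableEmbedding (fun z => edist y z ^ (-α)) (ball (0:V) R)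
  unfold pot
  rw [← h2]
  have e : T ⁻¹' ball (0:V) R = ball (0:V) R := by ext z; simp
  rw [e]
  congr 1; ext z
  rw [← hxy, T.isometry.edist_eq]

end
end Mf

namespace Mf
open InnerProductSpace Module TopologicalSpace
section
variable {V : Type*} [NormedAddCommGroup V] [InnerProductSpace ℝ V] [FiniteDimensional ℝ V]
  [MeasurableSpace V] [BorelSpace V]

lemma near_sphere [Nontrivial V] (x : V) {R : ℝ} (hR : 0 < R) : ∃ y : V, ‖y‖ = R ∧ dist x y = |‖x‖ - R| := by
  by_cases hx : x = 0
  · obtain ⟨y, hy⟩ := exists_norm_eq V hR.le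
    refine ⟨y, hy, ?_⟩
    rw [hx, dist_zero_left, norm_zero, zero_sub, abs_neg, hy, abs_of_pos hR]
  · refine ⟨R • ht x, ?_, ?_⟩
    · rw [norm_smul, ht_norm hx, Real.norm_of_nonneg hR.le, mul_one]
    · have e : x - R • ht x = (‖x‖ - R) • ht x := by rw [sub_smul, ht_smul_norm]
      rw [dist_eq_norm, e, norm_smul, ht_norm hx, mul_one, Real.norm_eq_abs]

lemma pot_comp [Nontrivial V] {α : ℝ} (hα : 0 < α) (hα1 : α + 1 < finrank ℝ V) {R : ℝ} (hR : 0 < R) :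
    ∃ C : ℝ≥0∞, C ≠ ⊤ ∧ ∀ E : Set V, MeasurableSet E → volume E = volume (ball (0:V) R) →
      ∫⁻ x in ball (0:V) R, pot α (ball (0:V) R) x ≤ (∫⁻ x in E, pot α (ball (0:V) R) x) + C * Wd E R := by
  obtain ⟨M, hM, hMb⟩ := pot_bd (V := V) (by linarith : 0 < α + 1) hα1
  set B := ball (0:V) R with hB
  have hBf : volume B ≠ ⊤ := measure_ball_lt_top.ne
  refine ⟨ENNReal.ofReal α * (M + volume B), by finiteness, ?_⟩
  intro E hE hv
  set C := ENNReal.ofReal α * (M + volume B) with hC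
  obtain ⟨y0, hy0⟩ := exists_norm_eq V hR.le
  set v0 := pot α B y0 with hv0
  have hBm : MeasurableSet B := measurableSet_ball
  have key : ∀ x : V, pot α B x ≤ v0 + C * ENNReal.ofReal |‖x‖ - R| ∧ v0 ≤ pot α B x + C * ENNReal.ofReal |‖x‖ - R| := by
    intro x
    obtain ⟨y, hy, hd⟩ := near_sphere x hR
    have e : pot α B y = v0 := pot_radial (by rw [hy, hy0])
    have h1 := pot_lip hα B x y
    have h2 := pot_lip hα B y x
    rw [e] at h1 h2
    rw [dist_comm y x] at h2
    rw [hd, ENNReal.ofReal_mul hα.le] at h1 h2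
    have g : ∀ z : V, ENNReal.ofReal α * ENNReal.ofReal |‖x‖ - R| * pot (α+1) B z ≤ C * ENNReal.ofReal |‖x‖ - R| := by
      intro z
      calc _ ≤ ENNReal.ofReal α * ENNReal.ofReal |‖x‖ - R| * (M + volume B) := by gcongr; exact hMb B z
        _ = _ := by rw [hC]; ring
    exact ⟨h1.trans (add_le_add le_rfl (g x)), h2.trans (add_le_add le_rfl (g y))⟩
  have hd : volume (B \ E) = volume (E \ B) := by
    have a1 := measure_inter_add_diff (μ := volume) B hE
    have a2 := measure_inter_add_diff (μ := volume) E hBm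
    rw [inter_comm E B, hv, ← a1] at a2
    exact ((ENNReal.add_right_inj (measure_ne_top_of_subset inter_subset_left hBf)).1 a2).symm
  have s1 := lintegral_inter_add_diff (μ := volume) (pot α B) B hE
  have s2 := lintegral_inter_add_diff (μ := volume) (pot α B) E hBm
  rw [inter_comm E B] at s2
  have m1 : Measurable (fun x : V => ENNReal.ofReal (R - ‖x‖)) := by fun_prop
  have m2 : Measurable (fun x : V => ENNReal.ofReal (‖x‖ - R)) := by fun_prop
  have b1 : ∫⁻ x in B \ E, pot α B x ≤ v0 * volume (B \ E) + C * ∫⁻ x in B \ E, ENNReal.ofReal (R - ‖x‖) := by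
    calc _ ≤ ∫⁻ x in B \ E, (v0 + C * ENNReal.ofReal (R - ‖x‖)) := by
          apply setLIntegral_mono (by fun_prop)
          intro x hx
          have hx' : ‖x‖ < R := by simpa [hB] using hx.1
          have := (key x).1
          rwa [abs_sub_comm, abs_of_pos (by linarith)] at this
      _ = _ := by
          rw [lintegral_add_left measurable_const, lintegral_const_mul _ m1]; simp
  have b2 : v0 * volume (E \ B) ≤ (∫⁻ x in E \ B, pot α B x) + C * ∫⁻ x in E \ B, ENNReal.ofReal (‖x‖ - R) := by
    calc _ = ∫⁻ x in E \ B, v0 := by simp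
      _ ≤ ∫⁻ x in E \ B, (pot α B x + C * ENNReal.ofReal (‖x‖ - R)) := by
          apply setLIntegral_mono ((pot_meas α B).add (m2.const_mul _))
          intro x hx
          have hx' : R ≤ ‖x‖ := by simpa [hB] using hx.2
          have := (key x).2
          rwa [abs_of_nonneg (by linarith)] at this
      _ = _ := by
          rw [lintegral_add_left (pot_meas α B), lintegral_const_mul _ m2]
  rw [← s1, ← s2, Wd, mul_add]
  calc _ ≤ (∫⁻ x in B ∩ E, pot α B x) + (v0 * volume (E \ B) + C * ∫⁻ x in B \ E, ENNReal.ofReal (R - ‖x‖)) := by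
        rw [← hd]; gcongr
    _ ≤ (∫⁻ x in B ∩ E, pot α B x) + (((∫⁻ x in E \ B, pot α B x) + C * ∫⁻ x in E \ B, ENNReal.ofReal (‖x‖ - R)) + C * ∫⁻ x in B \ E, ENNReal.ofReal (R - ‖x‖)) := by
        gcongr
    _ = _ := by ring
end
end Mf

namespace Mf
open InnerProductSpace Module TopologicalSpace
section
variable {V : Type*} [NormedAddCommGroup V] [InnerProductSpace ℝ V] [FiniteDimensional ℝ V]
  [MeasurableSpace V] [BorelSpace V]

lemma two_ab (a b : ℝ≥0∞) : 2 * (a * b) ≤ a * a + b * b := by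
  wlog h : a ≤ b generalizing a b
  · rw [mul_comm a b, add_comm]; exact this b a (le_of_not_ge h)
  obtain ⟨c, rfl⟩ := exists_add_of_le h
  calc 2 * (a * (a + c)) ≤ 2 * (a * (a + c)) + c * c := le_self_add
    _ = _ := by ring

lemma feat_pos {Z : Type*} [MeasurableSpace Z] (ν : Measure Z) [SFinite ν] (f : Z → V → ℝ≥0∞)
    (hf : Measurable (fun p : Z × V => f p.1 p.2)) (S T : Set V) :
    2 * ∫⁻ x in S, ∫⁻ y in T, ∫⁻ z, f z x * f z y ∂ν ≤
      (∫⁻ x in S, ∫⁻ y in S, ∫⁻ z, f z x * f z y ∂ν) + ∫⁻ x in T, ∫⁻ y in T, ∫⁻ z, f z x * f z y ∂ν := by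
  have hz : ∀ z, Measurable (f z) := fun z => hf.comp measurable_prodMk_left
  have hx : ∀ x, Measurable (fun z => f z x) := fun x => hf.comp (measurable_id.prodMk measurable_const)
  have hI : ∀ T : Set V, Measurable (fun z => ∫⁻ y in T, f z y) := fun T => hf.lintegral_prod_right'
  have main : ∀ S T : Set V, ∫⁻ x in S, ∫⁻ y in T, ∫⁻ z, f z x * f z y ∂ν =
      ∫⁻ z, (∫⁻ x in S, f z x) * (∫⁻ y in T, f z y) ∂ν := by
    intro S T
    have h1 : ∀ x, ∫⁻ y in T, ∫⁻ z, f z x * f z y ∂ν = ∫⁻ z, f z x * (∫⁻ y in T, f z y) ∂ν := by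
      intro x
      have hm : Measurable (fun p : V × Z => f p.2 x * f p.2 p.1) :=
        ((hx x).comp measurable_snd).mul (hf.comp measurable_swap)
      rw [lintegral_lintegral_swap (f := fun y z => f z x * f z y) (by exact hm.aemeasurable)]
      apply lintegral_congr; intro z
      rw [lintegral_const_mul _ (hz z)]
    simp_rw [h1]
    have hm : Measurable (fun p : V × Z => f p.2 p.1 * ∫⁻ y in T, f p.2 y) :=
      (hf.comp measurable_swap).mul ((hI T).comp measurable_snd)
    rw [lintegral_lintegral_swap (f := fun x z => f z x * ∫⁻ y in T, f z y) (by exact hm.aemeasurable)]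
    apply lintegral_congr; intro z
    rw [lintegral_mul_const _ (hz z)]
  have mS : Measurable (fun z => (∫⁻ x in S, f z x) * (∫⁻ y in S, f z y)) := (hI S).mul (hI S)
  have mT : Measurable (fun z => (∫⁻ x in S, f z x) * (∫⁻ y in T, f z y)) := (hI S).mul (hI T)
  rw [main, main, main, ← lintegral_add_left mS, ← lintegral_const_mul _ mT]
  exact lintegral_mono fun z => two_ab _ _

lemma gauss_int {b : ℝ} (hb : 0 < b) (m : V) : ∫⁻ z : V, ENNReal.ofReal (Real.exp (-b * ‖z - m‖ ^ 2)) =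
    ENNReal.ofReal ((Real.pi / b) ^ (finrank ℝ V / 2 : ℝ)) := by
  have h := GaussianFourier.integral_rexp_neg_mul_sq_norm (V := V) hb
  have hi : Integrable (fun v : V => Real.exp (-b * ‖v‖ ^ 2)) := by
    by_contra hc
    rw [integral_undef hc] at h
    have : 0 < (Real.pi / b) ^ (finrank ℝ V / 2 : ℝ) := by positivity
    linarith
  rw [lintegral_sub_right_eq_self (fun z : V => ENNReal.ofReal (Real.exp (-b * ‖z‖ ^ 2))) m, ← h,
    ofReal_integral_eq_lintegral_ofReal hi (ae_of_all _ fun _ => (Real.exp_pos _).le)]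

lemma gamma_int {a ρ : ℝ} (ha : 0 < a) (hρ : 0 < ρ) : ∫⁻ t in Ioi (0:ℝ), ENNReal.ofReal (t ^ (a-1) * Real.exp (-(ρ*t))) =
    ENNReal.ofReal ((1/ρ)^a * Real.Gamma a) := by
  have h := Real.integral_rpow_mul_exp_neg_mul_Ioi ha hρ
  have hi : IntegrableOn (fun t : ℝ => t ^ (a-1) * Real.exp (-(ρ*t))) (Ioi 0) := by
    by_contra hc
    rw [integral_undef hc] at h
    have : 0 < (1/ρ)^a * Real.Gamma a := mul_pos (by positivity) (Real.Gamma_pos_of_pos ha)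
    linarith
  rw [← h, ofReal_integral_eq_lintegral_ofReal hi]
  filter_upwards [ae_restrict_mem measurableSet_Ioi] with t ht
  have : (0:ℝ) < t := ht
  positivity

def feat (s : ℝ) (p : ℝ × V) (x : V) : ℝ≥0∞ := ENNReal.ofReal (p.1 ^ s * Real.exp (-2 * p.1 * ‖p.2 - x‖^2))

lemma feat_int {α : ℝ} (hα : 0 < α) {x y : V} (h : x ≠ y) :
    ∫⁻ p, feat ((α/2 - 1 + finrank ℝ V / 2)/2) p x * feat ((α/2 - 1 + finrank ℝ V / 2)/2) p y ∂((volume.restrict (Ioi (0:ℝ))).prod (volume : Measure V)) =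
      ENNReal.ofReal ((Real.pi/4) ^ (finrank ℝ V / 2 : ℝ) * Real.Gamma (α/2)) * edist x y ^ (-α) := by
  set s := (α/2 - 1 + finrank ℝ V / 2)/2 with hs
  set N : ℝ := finrank ℝ V / 2 with hN
  have hm : Measurable (fun p : ℝ × V => feat s p x * feat s p y) := by unfold feat; fun_prop
  rw [lintegral_prod _ hm.aemeasurable]
  have hd : 0 < dist x y := dist_pos.2 h
  have h1 : ∀ t ∈ Ioi (0:ℝ), ∫⁻ z : V, feat s (t,z) x * feat s (t,z) y =
      ENNReal.ofReal ((Real.pi/4)^N) * ENNReal.ofReal (t ^ (α/2 - 1) * Real.exp (-(dist x y ^ 2 * t))) := by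
    intro t ht
    have ht : 0 < t := ht
    have e : ∀ z : V, feat s (t,z) x * feat s (t,z) y = ENNReal.ofReal (t ^ (2*s) * Real.exp (-(dist x y ^ 2 * t))) *
        ENNReal.ofReal (Real.exp (-(4*t) * ‖z - (1/2:ℝ) • (x + y)‖^2)) := by
      intro z
      unfold feat
      simp only
      rw [← ENNReal.ofReal_mul (by positivity), ← ENNReal.ofReal_mul (by positivity)]
      congr 1
      have e1 : t ^ (2*s) = t^s * t^s := by rw [two_mul, Real.rpow_add ht]
      have e2 : ‖z - x‖^2 + ‖z-y‖^2 = 2 * ‖z - (1/2:ℝ) • (x + y)‖^2 + dist x y ^ 2 / 2 := by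
        have p := parallelogram_law_with_norm ℝ (z - x) (z - y)
        have a1 : (z - x) + (z - y) = (2:ℝ) • (z - (1/2:ℝ) • (x + y)) := by module
        have a2 : (z - x) - (z - y) = -(x - y) := by abel
        rw [a1, a2, norm_neg, ← dist_eq_norm x y, norm_smul] at p
        rw [Real.norm_of_nonneg (by norm_num : (0:ℝ) ≤ 2)] at p
        linear_combination (-1/2) * p
      have e3 : Real.exp (-2*t*‖z - x‖^2) * Real.exp (-2*t*‖z-y‖^2) = Real.exp (-(dist x y ^ 2 * t)) * Real.exp (-(4*t) * ‖z - (1/2:ℝ) • (x + y)‖^2) := by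
        rw [← Real.exp_add, ← Real.exp_add]; congr 1; linear_combination (-2*t) * e2
      rw [e1]
      linear_combination (t^s*t^s) * e3
    simp_rw [e]
    rw [lintegral_const_mul _ (by fun_prop), gauss_int (by positivity), ← ENNReal.ofReal_mul (by positivity), ← ENNReal.ofReal_mul (by positivity)]
    congr 1
    have e4 : (Real.pi / (4*t)) ^ N = (Real.pi/4)^N * t^(-N) := by
      rw [← div_div, Real.div_rpow (by positivity) ht.le, Real.rpow_neg ht.le]; rfl
    have e5 : t ^ (2*s) * t^(-N) = t^(α/2-1) := by
      rw [← Real.rpow_add ht]; congr 1; rw [hs]; ring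
    rw [e4]
    linear_combination (Real.exp (-(dist x y ^ 2 * t)) * (Real.pi/4)^N) * e5
  rw [setLIntegral_congr_fun measurableSet_Ioi h1, lintegral_const_mul _ (by fun_prop),
    gamma_int (by positivity) (by positivity), ker_eq h, ← ENNReal.ofReal_mul (by positivity), ← ENNReal.ofReal_mul (by have := Real.Gamma_pos_of_pos (half_pos hα); positivity)]
  congr 1
  have e6 : (1 / dist x y ^ 2) ^ (α/2) = dist x y ^ (-α) := by
    rw [one_div, ← Real.rpow_natCast, ← Real.rpow_neg hd.le, ← Real.rpow_mul hd.le]; congr 1; push_cast; ring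
  rw [e6]; ring

lemma riesz_pos [Nontrivial V] {α : ℝ} (hα : 0 < α) (S T : Set V) :
    2 * ∫⁻ x in S, pot α T x ≤ (∫⁻ x in S, pot α S x) + ∫⁻ x in T, pot α T x := by
  set s := (α/2 - 1 + finrank ℝ V / 2)/2 with hs
  set c := ENNReal.ofReal ((Real.pi/4) ^ (finrank ℝ V / 2 : ℝ) * Real.Gamma (α/2)) with hc
  have hcp : 0 < (Real.pi/4) ^ (finrank ℝ V / 2 : ℝ) * Real.Gamma (α/2) := by
    have := Real.Gamma_pos_of_pos (half_pos hα); positivity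
  have hc0 : c ≠ 0 := by rw [hc]; simpa using hcp
  have hct : c ≠ ⊤ := ENNReal.ofReal_ne_top
  have hm : Measurable (fun p : (ℝ × V) × V => feat s p.1 p.2) := by unfold feat; fun_prop
  have h := feat_pos ((volume.restrict (Ioi (0:ℝ))).prod (volume : Measure V)) (feat s) hm S T
  have e : ∀ S T : Set V, ∫⁻ x in S, ∫⁻ y in T, ∫⁻ z, feat s z x * feat s z y ∂((volume.restrict (Ioi (0:ℝ))).prod (volume : Measure V)) =
      c * ∫⁻ x in S, pot α T x := by
    intro S T
    rw [← lintegral_const_mul _ (pot_meas α T)]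
    apply lintegral_congr; intro x
    unfold pot
    have mk : Measurable (fun z : V => edist x z ^ (-α)) := (ker_meas α).comp measurable_prodMk_left
    rw [← lintegral_const_mul _ mk]
    apply lintegral_congr_ae
    have : ∀ᵐ y ∂(volume.restrict T), y ≠ x := ae_restrict_of_ae (Measure.ae_ne volume x)
    filter_upwards [this] with y hy
    exact feat_int hα hy.symm
  rw [e, e, e, ← mul_add, mul_left_comm] at h
  exact (ENNReal.mul_le_mul_iff_right hc0 hct).1 h

lemma riesz_comp [Nontrivial V] {α : ℝ} (hα : 0 < α) (hα1 : α + 1 < finrank ℝ V) {R : ℝ} (hR : 0 < R) :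
    ∃ C : ℝ≥0∞, C ≠ ⊤ ∧ ∀ E : Set V, MeasurableSet E → volume E = volume (ball (0:V) R) →
      ∫⁻ x in ball (0:V) R, pot α (ball (0:V) R) x ≤ (∫⁻ x in E, pot α E x) + C * Wd E R := by
  obtain ⟨C, hC, h⟩ := pot_comp (V := V) hα hα1 hR
  obtain ⟨M, hM, hMb⟩ := pot_bd (V := V) hα (by linarith)
  refine ⟨2 * C, by finiteness, ?_⟩
  intro E hE hv
  have h1 := h E hE hv
  have h2 := riesz_pos hα E (ball (0:V) R)
  set P := ∫⁻ x in ball (0:V) R, pot α (ball (0:V) R) x with hP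
  have hPf : P ≠ ⊤ := by
    have hb : volume (ball (0:V) R) ≠ ⊤ := measure_ball_lt_top.ne
    have : P ≤ (M + volume (ball (0:V) R)) * volume (ball (0:V) R) := by
      calc P ≤ ∫⁻ x in ball (0:V) R, (M + volume (ball (0:V) R)) := lintegral_mono fun x => hMb _ x
        _ = _ := by simp
    exact ne_top_of_le_ne_top (by finiteness) this
  have h3 : P + P ≤ P + ((∫⁻ x in E, pot α E x) + 2 * C * Wd E R) := by
    calc P + P ≤ 2 * ((∫⁻ x in E, pot α (ball (0:V) R) x) + C * Wd E R) := by rw [← two_mul]; gcongr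
      _ = 2 * (∫⁻ x in E, pot α (ball (0:V) R) x) + 2 * C * Wd E R := by ring
      _ ≤ ((∫⁻ x in E, pot α E x) + P) + 2 * C * Wd E R := by gcongr
      _ = _ := by ring
  exact (ENNReal.add_le_add_iff_left hPf).1 h3

lemma riesz_fin [Nontrivial V] {α : ℝ} (hα : 0 < α) (hα1 : α < finrank ℝ V) {S : Set V} (hb : volume S ≠ ⊤) :
    ∫⁻ x in S, pot α S x ≠ ⊤ := by
  obtain ⟨M, hM, hMb⟩ := pot_bd (V := V) hα hα1
  have : ∫⁻ x in S, pot α S x ≤ (M + volume S) * volume S := by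
    calc _ ≤ ∫⁻ x in S, (M + volume S) := lintegral_mono fun x => hMb _ x
      _ = _ := by simp
  exact ne_top_of_le_ne_top (by finiteness) this
end
end Mf

namespace Mf
open InnerProductSpace Module TopologicalSpace
section
variable {V : Type*} [NormedAddCommGroup V] [InnerProductSpace ℝ V] [FiniteDimensional ℝ V]
  [MeasurableSpace V] [BorelSpace V]

lemma riesz_tr (α : ℝ) (c : V) (S : Set V) : ∫⁻ x in tr c S, pot α (tr c S) x = ∫⁻ x in S, pot α S x := by
  have h1 : ∀ x, pot α (tr c S) x = pot α S (x + c) := by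
    intro x
    have h := (measurePreserving_add_right (volume : Measure V) c).setLIntegral_comp_preimage_emb
      (MeasurableEquiv.addRight c).measurableEmbedding (fun z => edist (x + c) z ^ (-α)) S
    unfold pot
    rw [← h]
    simp [tr]
  simp_rw [h1]
  exact (measurePreserving_add_right (volume : Measure V) c).setLIntegral_comp_preimage_emb
      (MeasurableEquiv.addRight c).measurableEmbedding (pot α S) S

lemma Wd_zero [Nontrivial V] {S : Set V} (hS : MeasurableSet S) {R : ℝ} (hR : 0 < R) (h : Wd S R = 0) :
    S =ᵐ[volume] ball (0:V) R := by
  unfold Wd at h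
  rw [add_eq_zero] at h
  obtain ⟨h1, h2⟩ := h
  rw [lintegral_eq_zero_iff (by fun_prop), Filter.EventuallyEq, ae_restrict_iff' (hS.diff measurableSet_ball)] at h1
  rw [lintegral_eq_zero_iff (by fun_prop), Filter.EventuallyEq, ae_restrict_iff' (measurableSet_ball.diff hS)] at h2
  have h3 : ∀ᵐ x ∂(volume : Measure V), x ∉ sphere (0:V) R :=
    measure_eq_zero_iff_ae_notMem.1 (Measure.addHaar_sphere volume 0 R)
  rw [ae_eq_set]
  constructor
  · rw [measure_eq_zero_iff_ae_notMem]
    filter_upwards [h1, h3] with x a b hx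
    have := a hx
    simp only [Pi.zero_apply, ENNReal.ofReal_eq_zero] at this
    have hx2 := hx.2
    simp only [mem_ball_zero_iff, not_lt] at hx2
    exact b (mem_sphere_zero_iff_norm.2 (by linarith))
  · rw [measure_eq_zero_iff_ae_notMem]
    filter_upwards [h2] with x a hx
    have := a hx
    simp only [Pi.zero_apply, ENNReal.ofReal_eq_zero] at this
    have hx2 := hx.1
    simp only [mem_ball_zero_iff] at hx2
    linarith

lemma core [Nontrivial V] (hn2 : 2 ≤ finrank ℝ V) {α r R : ℝ} (hα : 0 < α) (hα1 : α + 1 < finrank ℝ V)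
    (hr : 0 < r) (hR : 0 < R) :
    ∃ e0 : ℝ, 0 < e0 ∧ ∀ ε : ℝ, 0 ≤ ε → ε < e0 → ∀ E : Set V, IsBounded E → Convex ℝ E → (interior E).Nonempty →
      volume E = volume (ball (0:V) R) →
      volume (⋃ x ∈ frontier E, ball x r) / ENNReal.ofReal (2*r) + ENNReal.ofReal ε * ∫⁻ x in E, pot α E x ≤
        volume (⋃ x ∈ frontier (ball (0:V) R), ball x r) / ENNReal.ofReal (2*r) +
          ENNReal.ofReal ε * ∫⁻ x in ball (0:V) R, pot α (ball (0:V) R) x →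
      ∃ c, volume (symmDiff E (ball c R)) = 0 := by
  obtain ⟨C, hC, δ, hδ, hstar⟩ := star (V := V) hn2 hr hR
  obtain ⟨CP, hCP, hriesz⟩ := riesz_comp (V := V) hα hα1 hR
  have hPBf := riesz_fin (V := V) hα (by linarith) (S := ball (0:V) R) measure_ball_lt_top.ne
  set PB := ∫⁻ x in ball (0:V) R, pot α (ball (0:V) R) x with hPB
  set D := ENNReal.ofReal (2*r) with hD
  have hD0 : D ≠ 0 := by rw [hD]; simpa using hr
  have hDt : D ≠ ⊤ := ENNReal.ofReal_ne_top
  set a := (D * PB).toReal with ha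
  set b := (D * CP * C).toReal with hb
  have ha0 : 0 ≤ a := ENNReal.toReal_nonneg
  have hb0 : 0 ≤ b := ENNReal.toReal_nonneg
  have ea : D * PB = ENNReal.ofReal a := (ENNReal.ofReal_toReal (by finiteness)).symm
  have eb : D * CP * C = ENNReal.ofReal b := (ENNReal.ofReal_toReal (by finiteness)).symm
  refine ⟨min (δ/(a+1)) (1/(2*(b+1))), by positivity, ?_⟩
  intro ε hε0 hε E hEb hc hi hv hmin
  have hε1 : ε * a ≤ δ := by
    have := (lt_min_iff.1 hε).1
    rw [lt_div_iff₀ (by positivity)] at this; nlinarith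
  have hε2 : ε * b ≤ 1/2 := by
    have := (lt_min_iff.1 hε).2
    rw [lt_div_iff₀ (by positivity)] at this; nlinarith
  set e := ENNReal.ofReal ε with he
  have he1 : e * (D * PB) ≤ ENNReal.ofReal δ := by
    rw [ea, he, ← ENNReal.ofReal_mul hε0]; exact ENNReal.ofReal_le_ofReal hε1
  have he2 : e * (D * CP * C) ≤ ENNReal.ofReal (1/2) := by
    rw [eb, he, ← ENNReal.ofReal_mul hε0]; exact ENNReal.ofReal_le_ofReal hε2
  have het : e ≠ ⊤ := ENNReal.ofReal_ne_top
  -- closure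
  set K := closure E with hK
  have hKE : E =ᵐ[volume] K := by
    rw [ae_eq_set]
    refine ⟨by rw [diff_eq_empty.2 subset_closure]; simp, ?_⟩
    refine measure_mono_null ?_ (hc.addHaar_frontier volume)
    exact fun x hx => ⟨hx.1, fun h => hx.2 (interior_subset h)⟩
  have hKc : Convex ℝ K := hc.closure
  have hKk : IsCompact K := hEb.isCompact_closure
  have hKn : K.Nonempty := (hi.mono interior_subset).closure
  have hKv : volume K = volume (ball (0:V) R) := by rw [← measure_congr hKE, hv]
  have hfr : frontier K = frontier E := frontier_mid hc hi (interior_subset.trans subset_closure) le_rfl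
  have hlow := perLow hKc hKk hr hR hKv
  have hup := perUp (V := V) hr hR
  have hbm := bm hKc hKk hKn hr hKv.ge
  rw [hfr] at hlow
  set T := volume (thickening r K) with hT
  set t := volume (ball (0:V) (R + r)) with ht
  set q := volume (ball (0:V) (R - r)) with hq
  set p := volume (⋃ x ∈ frontier E, ball x r) with hp
  set p0 := volume (⋃ x ∈ frontier (ball (0:V) R), ball x r) with hp0
  set PE := ∫⁻ x in E, pot α E x with hPE
  have htf : t ≠ ⊤ := measure_ball_lt_top.ne
  have hTf : T ≠ ⊤ := hKk.isBounded.thickening.measure_lt_top.ne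
  have hPEf : PE ≠ ⊤ := riesz_fin hα (by linarith) (by rw [hv]; exact measure_ball_lt_top.ne)
  have hmin2 : p + e * (D * PE) ≤ p0 + e * (D * PB) := by
    have h := mul_le_mul_right hmin D
    rw [mul_add, mul_add, ENNReal.mul_div_cancel hD0 hDt, ENNReal.mul_div_cancel hD0 hDt] at h
    rwa [mul_left_comm e, mul_left_comm e]
  have h1 : T + e * (D * PE) ≤ t + e * (D * PB) := by
    calc T + e * (D * PE) ≤ (p + q) + e * (D * PE) := by gcongr
      _ = (p + e * (D * PE)) + q := by ring
      _ ≤ (p0 + e * (D * PB)) + q := by gcongr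
      _ = (p0 + q) + e * (D * PB) := by ring
      _ ≤ _ := by gcongr
  obtain ⟨c, hW⟩ := hstar K hKc hKk hKn hKv.ge ((le_self_add.trans h1).trans (by gcongr))
  obtain ⟨g, hg⟩ := exists_add_of_le hbm
  have hgT : T - t = g := by rw [hg]; exact ENNReal.add_sub_cancel_left htf
  have hgf : g ≠ ⊤ := by rw [← hgT]; exact ENNReal.sub_ne_top hTf
  have hPK : ∫⁻ x in tr c K, pot α (tr c K) x = PE := by
    rw [riesz_tr]
    have e1 : pot α K = pot α E := by
      ext x; unfold pot; rw [Measure.restrict_congr_set hKE]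
    rw [e1, hPE, Measure.restrict_congr_set hKE]
  have hSm : MeasurableSet (tr c K) := (tr_compact c hKk).isClosed.measurableSet
  have h2 := hriesz (tr c K) hSm (by rw [tr_vol, hKv])
  rw [hPK] at h2
  rw [hgT] at hW
  have h3 : g + e * (D * PE) ≤ ENNReal.ofReal (1/2) * g + e * (D * PE) := by
    rw [hg, add_assoc] at h1
    have h1' := (ENNReal.add_le_add_iff_left htf).1 h1
    calc g + e * (D * PE) ≤ e * (D * PB) := h1'
      _ ≤ e * (D * (PE + CP * (C * g))) := by gcongr; exact h2.trans (by gcongr)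
      _ = e * (D * CP * C) * g + e * (D * PE) := by ring
      _ ≤ _ := by gcongr
  have h4 : g ≤ ENNReal.ofReal (1/2) * g := (ENNReal.add_le_add_iff_right (by finiteness)).1 h3
  have hg0 : g = 0 := by
    lift g to ℝ≥0 using hgf
    have h5 : ENNReal.ofReal (1/2) * (g : ℝ≥0∞) = ENNReal.ofReal ((1/2) * g) := by
      rw [ENNReal.ofReal_mul (by norm_num), ENNReal.ofReal_coe_nnreal]
    rw [h5, ← ENNReal.ofReal_coe_nnreal, ENNReal.ofReal_le_ofReal_iff (by positivity)] at h4
    have : (g:ℝ) = 0 := by have := g.2; linarith [g.coe_nonneg]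
    exact_mod_cast this
  rw [hg0, mul_zero, nonpos_iff_eq_zero] at hW
  have h6 := Wd_zero hSm hR hW
  refine ⟨c, ?_⟩
  have h7 : volume (symmDiff K (ball c R)) = 0 := by
    rw [← tr_vol c]
    have e2 : tr c (symmDiff K (ball c R)) = symmDiff (tr c K) (ball (0:V) R) := by
      have e3 : tr c (ball c R) = ball (0:V) R := by ext z; simp [tr, dist_eq_norm]
      rw [← e3]; rfl
    rw [e2]
    exact measure_symmDiff_eq_zero_iff.2 h6
  exact measure_symmDiff_eq_zero_iff.2 (hKE.trans (measure_symmDiff_eq_zero_iff.1 h7))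
end
end Mf

/-- Balls are the unique minimizers for small volume. -/
theorem minimizer_is_ball_small_volume (n : ℕ) (hn : 2 ≤ n) (α r : ℝ) (hα : 0 < α)
    (hαn : α < (n : ℝ) - 1) (hr0 : 0 < r) (hr1 : r < 1) :
    ∃ m₀ : ℝ, 0 < m₀ ∧
      ∀ (m : ℝ) (E : Set (EuclideanSpace ℝ (Fin n))), 0 < m → m < m₀ →
        IsBounded E → Convex ℝ E → volume E = 1 →
        (∀ F : Set (EuclideanSpace ℝ (Fin n)), IsBounded F → Convex ℝ F → volume F = 1 →
          perR n r E + ENNReal.ofReal (m ^ (((n : ℝ) + 1 - α) / n)) * rieszEnergy n α E ≤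
            perR n r F + ENNReal.ofReal (m ^ (((n : ℝ) + 1 - α) / n)) * rieszEnergy n α F) →
        ∃ x : EuclideanSpace ℝ (Fin n),
          volume (symmDiff E (ball x (unitRadius n))) = 0 := by
  have hfin : Module.finrank ℝ (EuclideanSpace ℝ (Fin n)) = n := finrank_euclideanSpace_fin
  haveI : Nontrivial (EuclideanSpace ℝ (Fin n)) :=
    Module.nontrivial_of_finrank_pos (R := ℝ) (by rw [hfin]; omega)
  have hn0 : (n:ℝ) ≠ 0 := by positivity
  have hnp : (0:ℝ) < n := by positivity
  set B1 := volume (ball (0 : EuclideanSpace ℝ (Fin n)) 1) with hB1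
  have hB1p : 0 < B1.toReal :=
    ENNReal.toReal_pos (measure_ball_pos volume _ one_pos).ne' measure_ball_lt_top.ne
  have hR : 0 < unitRadius n := by unfold unitRadius; exact Real.rpow_pos_of_pos hB1p _
  set R := unitRadius n with hRdef
  have hvB : volume (ball (0 : EuclideanSpace ℝ (Fin n)) R) = 1 := by
    rw [Mf.vol_ball_pow hR, hfin, ← ENNReal.ofReal_toReal (measure_ball_lt_top.ne : B1 ≠ ⊤),
      ← ENNReal.ofReal_mul (by positivity)]
    have : R ^ n * B1.toReal = 1 := by
      rw [hRdef, unitRadius, ← hB1, ← Real.rpow_natCast, ← Real.rpow_mul hB1p.le, neg_mul,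
        inv_mul_cancel₀ hn0, Real.rpow_neg_one, inv_mul_cancel₀ hB1p.ne']
    rw [this, ENNReal.ofReal_one]
  obtain ⟨e0, he0, hcore⟩ := Mf.core (V := EuclideanSpace ℝ (Fin n)) (by rw [hfin]; exact hn) hα
    (by rw [hfin]; linarith) hr0 hR
  set P := ((n : ℝ) + 1 - α) / n with hP
  have hPp : 0 < P := by rw [hP]; apply div_pos _ hnp; linarith
  refine ⟨e0 ^ (1/P), by positivity, ?_⟩
  intro m E hm hm0 hEb hc hv hmin
  have hε : m ^ P < e0 := by
    have := Real.rpow_lt_rpow hm.le hm0 hPp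
    rwa [← Real.rpow_mul he0.le, one_div, inv_mul_cancel₀ hPp.ne', Real.rpow_one] at this
  -- frontier of the density-one representative
  have hfront : ∀ F : Set (EuclideanSpace ℝ (Fin n)), Convex ℝ F → (interior F).Nonempty →
      frontier (densityOnePoints n F) = frontier F := fun F hF hi =>
    Mf.frontier_mid hF hi (fun x hx => Mf.dens_int hx) (fun x hx => Mf.dens_cl hx)
  have hi : (interior E).Nonempty := by
    by_contra h
    rw [not_nonempty_iff_eq_empty] at h
    have : volume E ≤ volume (frontier E) := by
      apply measure_mono
      rw [frontier, h, diff_empty]; exact subset_closure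
    rw [hc.addHaar_frontier volume, hv] at this
    simp at this
  have hiB : (interior (ball (0 : EuclideanSpace ℝ (Fin n)) R)).Nonempty := by
    rw [isOpen_ball.interior_eq]; exact nonempty_ball.2 hR
  have h := hmin (ball 0 R) isBounded_ball (convex_ball _ _) hvB
  unfold perR minkSum rieszEnergy at h
  rw [hfront E hc hi, hfront _ (convex_ball _ _) hiB] at h
  exact hcore (m ^ P) (by positivity) hε E hEb hc hi (by rw [hv, hvB]) h
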